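/- Let d ≥ 2 and Φ = (Φ₁,…,Φ_d) ∈ C¹(ℝ^d,ℝ^d) be such that for every z ∈ ℝ^d, ∇Φ(z) is a symmetric matrix and ∂₁Φ₁(z) = ∂₂Φ₂(z) = … = ∂_dΦ_d(z). Define W(z) = ½ Σ_{1≤i<j≤d} |∂_iΦ_j(z)|², and let u^± ∈ ℝ^d_a ∩ {W = 0} be two wells for some a ∈ ℝ. If the saturation condition Φ₁(u^+) − Φ₁(u^-) = geod^a_W(u^-,u^+) holds and u is a global minimizer of problem (P) such that either (u ∈ L^∞(Ω,ℝ^d) and W ∈ C²(ℝ^d,[0,∞))) or W satisfies the growth condition (G), then u is one-dimensional, i.e. u = u(x₁). -/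

import Mathlib

open MeasureTheory Filter Topology ENNReal

noncomputable section

/-- Squared Euclidean norm on `ℝ^d` (modelled as `Fin d → ℝ`). -/
def vnorm2 {d : ℕ} (v : Fin d → ℝ) : ℝ := ∑ i, v i ^ 2

/-- Partial derivative in the `i`-th coordinate direction of a map `ℝ^d → ℝ^d`. -/
def pd {d : ℕ} (i : Fin d) (u : (Fin d → ℝ) → Fin d → ℝ) (x : Fin d → ℝ) : Fin d → ℝ :=
  fderiv ℝ u x (Pi.single i 1)

/-- Partial derivative in the `i`-th coordinate direction of a scalar function on `ℝ^d`. -/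
def pdS {d : ℕ} (i : Fin d) (w : (Fin d → ℝ) → ℝ) (x : Fin d → ℝ) : ℝ :=
  fderiv ℝ w x (Pi.single i 1)

/-- Squared Frobenius norm `|∇u|²` of the Jacobian of `u`. -/
def gradSq {d : ℕ} (u : (Fin d → ℝ) → Fin d → ℝ) (x : Fin d → ℝ) : ℝ :=
  ∑ i, ∑ j, (pd i u x j) ^ 2

/-- Divergence-free condition `∇ ⋅ u = 0`. -/
def IsDivFree {d : ℕ} (u : (Fin d → ℝ) → Fin d → ℝ) : Prop :=
  ∀ x, ∑ i, pd i u x i = 0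

/-- Periodicity (period 1) in the last `d-1` coordinates: `u` is a map on `Ω = ℝ × 𝕋^{d-1}`. -/
def IsPeriodic {d : ℕ} [NeZero d] (u : (Fin d → ℝ) → Fin d → ℝ) : Prop :=
  ∀ (x : Fin d → ℝ) (i : Fin d), i ≠ 0 → u (x + Pi.single i 1) = u x

/-- Fundamental domain `ℝ × [0,1)^{d-1}` of `Ω = ℝ × 𝕋^{d-1}`. -/
def strip (d : ℕ) [NeZero d] : Set (Fin d → ℝ) :=
  {x | ∀ i : Fin d, i ≠ 0 → x i ∈ Set.Ico (0 : ℝ) 1}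

/-- The unit cube `[0,1)^d`. -/
def cube (d : ℕ) : Set (Fin d → ℝ) := Set.univ.pi fun _ => Set.Ico (0 : ℝ) 1

/-- The `x'`-average `ū(t) = ∫_{𝕋^{d-1}} u(t,x') dx'`. -/
def avg {d : ℕ} [NeZero d] (u : (Fin d → ℝ) → Fin d → ℝ) (t : ℝ) : Fin d → ℝ :=
  ∫ y in cube d, u (Function.update y 0 t)

/-- Energy density `½|∇u|² + W(u)`. -/
def eden {d : ℕ} (W : (Fin d → ℝ) → ℝ) (u : (Fin d → ℝ) → Fin d → ℝ) (x : Fin d → ℝ) : ℝ :=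
  (1 / 2) * gradSq u x + W (u x)

/-- Total energy `E(u)` on `Ω`, with values in `[0,∞]`. -/
def energy (d : ℕ) [NeZero d] (W : (Fin d → ℝ) → ℝ) (u : (Fin d → ℝ) → Fin d → ℝ) : ℝ≥0∞ :=
  ∫⁻ x in strip d, ENNReal.ofReal (eden W u x)

/-- Membership in `Ḣ¹_div(Ω, ℝ^d)` (with classical derivatives). -/
def Adm (d : ℕ) [NeZero d] (u : (Fin d → ℝ) → Fin d → ℝ) : Prop :=
  Differentiable ℝ u ∧ IsPeriodic u ∧ IsDivFree u ∧ IntegrableOn (gradSq u) (strip d)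

/-- The boundary conditions `ū(-∞) = u⁻`, `ū(+∞) = u⁺`. -/
def BdryCond (d : ℕ) [NeZero d] (u : (Fin d → ℝ) → Fin d → ℝ) (um up : Fin d → ℝ) : Prop :=
  Tendsto (avg u) atBot (𝓝 um) ∧ Tendsto (avg u) atTop (𝓝 up)

/-- `S_a`: the zeros of `W` in the hyperplane `{z₁ = a}`. -/
def wellSet (d : ℕ) [NeZero d] (W : (Fin d → ℝ) → ℝ) (a : ℝ) : Set (Fin d → ℝ) :=
  {z | z 0 = a ∧ W z = 0}

/-- Hypothesis (H2): `liminf_{z₁ → a, |z'| → ∞} W(z₁,z') > 0`. -/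
def H2cond (d : ℕ) [NeZero d] (W : (Fin d → ℝ) → ℝ) (a : ℝ) : Prop :=
  ∃ c > (0 : ℝ), ∃ δ > (0 : ℝ), ∃ R : ℝ, ∀ z : Fin d → ℝ,
    |z 0 - a| < δ → R ≤ ∑ i, (if i = (0 : Fin d) then 0 else z i ^ 2) → c ≤ W z

/-- An admissible one-dimensional transition layer: a curve in the hyperplane `{z₁ = a}`
connecting `u⁻` (at `-∞`) to `u⁺` (at `+∞`). -/
def Adm1D (d : ℕ) [NeZero d] (a : ℝ) (um up : Fin d → ℝ) (γ : ℝ → Fin d → ℝ) : Prop :=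
  Differentiable ℝ γ ∧ (∀ t, γ t 0 = a) ∧
  Tendsto γ atBot (𝓝 um) ∧ Tendsto γ atTop (𝓝 up)

/-- One-dimensional energy `∫_ℝ ½|γ̇|² + W(γ)`. -/
def energy1D (d : ℕ) (W : (Fin d → ℝ) → ℝ) (γ : ℝ → Fin d → ℝ) : ℝ≥0∞ :=
  ∫⁻ t : ℝ, ENNReal.ofReal ((1 / 2) * vnorm2 (deriv γ t) + W (γ t))

/-- Geodesic (pseudo-)distance `geod^a_F(x,y)` in the hyperplane `{z₁ = a}` for the degenerate
metric `2 F g₀`: infimum of `∫_{-1}^{1} √(2F(γ)) |γ̇| dt` over Lipschitz curves in the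
hyperplane joining `x` to `y`. -/
def geodA (d : ℕ) [NeZero d] (F : (Fin d → ℝ) → ℝ) (a : ℝ) (x y : Fin d → ℝ) : ℝ :=
  sInf {L | ∃ γ : ℝ → Fin d → ℝ, (∃ K : NNReal, LipschitzWith K γ) ∧ (∀ t, γ t 0 = a) ∧
    γ (-1) = x ∧ γ 1 = y ∧
    L = ∫ t in Set.Icc (-1 : ℝ) 1, Real.sqrt (2 * F (γ t)) * Real.sqrt (vnorm2 (deriv γ t))}

/-- Growth condition (G): `W(z) ≤ C e^{β|z|²}` if `d = 2` and `W(z) ≤ C(1 + |z|^{2d/(d-2)})`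
if `d ≥ 3`. -/
def GrowthG (d : ℕ) (W : (Fin d → ℝ) → ℝ) : Prop :=
  (d = 2 → ∃ C > (0 : ℝ), ∃ β > (0 : ℝ), ∀ z, W z ≤ C * Real.exp (β * vnorm2 z)) ∧
  (3 ≤ d → ∃ C > (0 : ℝ), ∀ z, W z ≤ C * (1 + vnorm2 z ^ ((d : ℝ) / ((d : ℝ) - 2))))

/-- Tonelli for a product measure, singling out one coordinate and keeping it as a dummy variable
with respect to a probability measure. -/
lemma lintegral_pi_update {ι : Type*} [Fintype ι] [DecidableEq ι] (μ ν : ι → Measure ℝ)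
    [∀ i, SigmaFinite (μ i)] [∀ i, SigmaFinite (ν i)] (i : ι) [IsProbabilityMeasure (ν i)]
    (h : ∀ j ≠ i, μ j = ν j) {f : (ι → ℝ) → ℝ≥0∞} (hf : Measurable f) :
    ∫⁻ x, f x ∂(Measure.pi μ) =
      ∫⁻ y, ∫⁻ t, f (Function.update y i t) ∂(μ i) ∂(Measure.pi ν) := by
  set s : Finset ι := Finset.univ.erase i with hs
  have his : i ∉ s := by simp [hs]
  have hins : insert i s = Finset.univ := by simp [hs]
  set G : (ι → ℝ) → ℝ≥0∞ := fun x => ∫⁻ t, f (Function.update x i t) ∂(μ i) with hG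
  have hGm : Measurable G := by
    have := hf.lmarginal (s := {i}) μ
    rwa [lmarginal_singleton] at this
  have h1 : lmarginal μ Finset.univ f 0 = lmarginal μ s G 0 := by
    rw [← hins, lmarginal_insert' _ hf his]
  have h2 : lmarginal ν Finset.univ G 0 = lmarginal ν s G 0 := by
    rw [← hins, lmarginal_insert' _ hGm his]
    congr 1
    funext x
    simp [hG]
  have h3 : lmarginal μ s G 0 = lmarginal ν s G 0 := by
    unfold lmarginal
    have : (fun j : s => μ j) = fun j : s => ν j := by
      funext j
      exact h j (fun hj => his (hj ▸ j.2))
    rw [this]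
  rw [lintegral_eq_lmarginal_univ (μ := μ) 0, h1, h3, ← h2, ← lintegral_eq_lmarginal_univ]

/-- The half-open unit box with lowest corner `b`. -/
def unitBox {d : ℕ} (b : Fin d → ℝ) : Set (Fin d → ℝ) :=
  Set.univ.pi fun i => Set.Ico (b i) (b i + 1)

/-- Lebesgue measure on the unit box with lowest corner `b`. -/
def boxMeasure {d : ℕ} (b : Fin d → ℝ) : Measure (Fin d → ℝ) :=
  Measure.pi fun i => volume.restrict (Set.Ico (b i) (b i + 1))

instance isProbabilityMeasure_Ico (c : ℝ) :
    IsProbabilityMeasure (volume.restrict (Set.Ico c (c + 1))) :=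
  ⟨by simp⟩

instance {d : ℕ} (b : Fin d → ℝ) : IsProbabilityMeasure (boxMeasure b) := by
  unfold boxMeasure; infer_instance

lemma measurableSet_unitBox {d : ℕ} (b : Fin d → ℝ) : MeasurableSet (unitBox b) :=
  MeasurableSet.univ_pi fun _ => measurableSet_Ico

lemma boxMeasure_eq {d : ℕ} (b : Fin d → ℝ) : boxMeasure b = volume.restrict (unitBox b) := by
  unfold boxMeasure unitBox
  rw [volume_pi, Measure.restrict_pi_pi]

lemma boxMeasure_zero {d : ℕ} : boxMeasure (0 : Fin d → ℝ) = volume.restrict (cube d) := by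
  rw [boxMeasure_eq]; simp [unitBox, cube]

lemma lintegral_boxMeasure {d : ℕ} (b : Fin d → ℝ) (i : Fin d) {f : (Fin d → ℝ) → ℝ≥0∞}
    (hf : Measurable f) :
    ∫⁻ x, f x ∂(boxMeasure b) =
      ∫⁻ y, (∫⁻ t in Set.Ico (b i) (b i + 1), f (Function.update y i t)) ∂(boxMeasure b) :=
  lintegral_pi_update _ _ i (fun _ _ => rfl) hf

/-- One factor of Lebesgue measure on the strip. -/
def stripFactor {d : ℕ} [NeZero d] (i : Fin d) : Measure ℝ :=
  if i = 0 then volume else volume.restrict (Set.Ico 0 1)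

instance {d : ℕ} [NeZero d] (i : Fin d) : SigmaFinite (stripFactor i) := by
  unfold stripFactor; split_ifs <;> infer_instance

lemma volume_restrict_strip (d : ℕ) [NeZero d] :
    volume.restrict (strip d) = Measure.pi (stripFactor (d := d)) := by
  have h : strip d = Set.univ.pi fun i : Fin d => if i = 0 then Set.univ else Set.Ico (0 : ℝ) 1 := by
    ext x
    simp only [strip, Set.mem_ofPred_eq, Set.mem_univ_pi]
    refine forall_congr' fun i => ?_
    by_cases hi : i = 0 <;> simp [hi]
  rw [h, volume_pi, Measure.restrict_pi_pi]
  congr 1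
  funext i
  unfold stripFactor
  split_ifs <;> simp

lemma measurableSet_strip (d : ℕ) [NeZero d] : MeasurableSet (strip d) := by
  have : strip d = ⋂ i : Fin d, {x | i ≠ 0 → x i ∈ Set.Ico (0 : ℝ) 1} := by
    ext x; simp [strip]
  rw [this]
  refine MeasurableSet.iInter fun i => ?_
  by_cases hi : i = 0
  · simp [hi]
  · have h : {x : Fin d → ℝ | i ≠ 0 → x i ∈ Set.Ico (0 : ℝ) 1} =
        (fun x : Fin d → ℝ => x i) ⁻¹' Set.Ico 0 1 := by ext x; simp [hi]
    rw [h]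
    exact measurable_pi_apply i measurableSet_Ico

lemma lintegral_strip {d : ℕ} [NeZero d] {f : (Fin d → ℝ) → ℝ≥0∞} (hf : Measurable f) :
    ∫⁻ x in strip d, f x =
      ∫⁻ y, (∫⁻ t, f (Function.update y 0 t)) ∂(boxMeasure (0 : Fin d → ℝ)) := by
  rw [volume_restrict_strip]
  unfold boxMeasure
  have := lintegral_pi_update (stripFactor (d := d))
    (fun i : Fin d => volume.restrict (Set.Ico ((0 : Fin d → ℝ) i) ((0 : Fin d → ℝ) i + 1))) 0
    (fun j hj => by simp [stripFactor, hj]) hf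
  simpa [stripFactor] using this

lemma lintegral_strip_line {d : ℕ} [NeZero d] {f : (Fin d → ℝ) → ℝ≥0∞} (hf : Measurable f)
    {i : Fin d} (hi : i ≠ 0) :
    ∫⁻ x in strip d, f x =
      ∫⁻ x in strip d, ∫⁻ t in Set.Ico (0 : ℝ) 1, f (Function.update x i t) := by
  rw [volume_restrict_strip]
  have hp : IsProbabilityMeasure (stripFactor i) := by
    have := isProbabilityMeasure_Ico 0
    simpa [stripFactor, hi] using this
  have := lintegral_pi_update (stripFactor (d := d)) (stripFactor (d := d)) i (fun _ _ => rfl) hf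
  simpa [stripFactor, hi] using this

/-- The lowest corner of the slab `[R, R+1) × [0,1)^{d-1}`. -/
def slabCorner (d : ℕ) [NeZero d] (R : ℝ) : Fin d → ℝ := Pi.single 0 R

lemma lintegral_slab {d : ℕ} [NeZero d] (R : ℝ) {f : (Fin d → ℝ) → ℝ≥0∞} (hf : Measurable f) :
    ∫⁻ x, f x ∂(boxMeasure (slabCorner d R)) =
      ∫⁻ t in Set.Ico R (R + 1), ∫⁻ y, f (Function.update y 0 t) ∂(boxMeasure (0 : Fin d → ℝ)) := by
  have := lintegral_pi_update
    (fun i : Fin d => volume.restrict (Set.Ico (slabCorner d R i) (slabCorner d R i + 1)))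
    (fun i : Fin d => volume.restrict (Set.Ico ((0 : Fin d → ℝ) i) ((0 : Fin d → ℝ) i + 1))) 0
    (fun j hj => by simp [slabCorner, hj]) hf
  unfold boxMeasure
  rw [this]
  simp only [slabCorner, Pi.single_eq_same]
  rw [lintegral_lintegral_swap]
  apply Measurable.aemeasurable
  apply hf.comp
  refine measurable_pi_lambda _ fun j => ?_
  by_cases hj : j = 0
  · subst hj; simpa [Function.update] using measurable_snd
  · simpa [Function.update, hj, Function.comp_def] using
      (measurable_pi_apply (X := fun _ : Fin d => ℝ) j).comp (measurable_fst (β := ℝ))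

lemma integrable_boxMeasure {d : ℕ} {E : Type*} [NormedAddCommGroup E] {f : (Fin d → ℝ) → E}
    (hf : Continuous f) (b : Fin d → ℝ) : Integrable f (boxMeasure b) := by
  rw [boxMeasure_eq]
  refine (hf.continuousOn.integrableOn_compact (μ := volume)
    (isCompact_univ_pi (fun i => isCompact_Icc (a := b i) (b := b i + 1)))).mono_set ?_
  exact Set.pi_mono fun i _ => Set.Ico_subset_Icc_self

lemma measurable_pdS {d : ℕ} (i : Fin d) (g : (Fin d → ℝ) → ℝ) : Measurable (pdS i g) :=
  measurable_fderiv_apply_const ℝ g _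

lemma pd_apply {d : ℕ} {u : (Fin d → ℝ) → Fin d → ℝ} (hu : Differentiable ℝ u) (i j : Fin d)
    (x : Fin d → ℝ) : pd i u x j = pdS i (fun x => u x j) x := by
  unfold pd pdS
  have h := hasFDerivAt_pi'.1 (hu x).hasFDerivAt j
  rw [h.fderiv]
  rfl

lemma hasDerivAt_line {d : ℕ} {g : (Fin d → ℝ) → ℝ} (hg : Differentiable ℝ g) (x : Fin d → ℝ)
    (i : Fin d) (t : ℝ) :
    HasDerivAt (fun t => g (Function.update x i t)) (pdS i g (Function.update x i t)) t :=
  (hg _).hasFDerivAt.comp_hasDerivAt t (hasDerivAt_update x i t)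

lemma enorm_sub_le_lintegral_line {d : ℕ} {g : (Fin d → ℝ) → ℝ} (hg : Differentiable ℝ g)
    (x : Fin d → ℝ) (i : Fin d) {s t : ℝ} {I : Set ℝ} (hI : Set.uIoc s t ⊆ I) :
    ‖g (Function.update x i t) - g (Function.update x i s)‖ₑ ≤
      ∫⁻ r in I, ‖pdS i g (Function.update x i r)‖ₑ := by
  set D : ℝ → ℝ := fun r => pdS i g (Function.update x i r) with hD
  have hDm : Measurable D := (measurable_pdS i g).comp (measurable_update x)
  have hle : ∫⁻ r in Set.uIoc s t, ‖D r‖ₑ ≤ ∫⁻ r in I, ‖D r‖ₑ := lintegral_mono_set hI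
  refine le_trans ?_ hle
  by_cases hfin : ∫⁻ r in Set.uIoc s t, ‖D r‖ₑ = ⊤
  · rw [hfin]; exact le_top
  have hint : IntervalIntegrable D volume s t := by
    rw [intervalIntegrable_iff]
    exact ⟨hDm.aestronglyMeasurable, lt_top_iff_ne_top.2 hfin⟩
  rw [← intervalIntegral.integral_eq_sub_of_hasDerivAt (fun r _ => hasDerivAt_line hg x i r) hint]
  rw [← ofReal_norm, intervalIntegral.norm_intervalIntegral_eq, ofReal_norm]
  exact enorm_integral_le_lintegral_enorm _

/-- Cauchy–Schwarz for the Lebesgue integral. -/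
lemma lintegral_mul_sq_le {α : Type*} [MeasurableSpace α] (μ : Measure α) {f g : α → ℝ≥0∞}
    (hf : AEMeasurable f μ) (hg : AEMeasurable g μ) :
    (∫⁻ x, f x * g x ∂μ) ^ 2 ≤ (∫⁻ x, f x ^ 2 ∂μ) * ∫⁻ x, g x ^ 2 ∂μ := by
  have h := ENNReal.lintegral_mul_le_Lp_mul_Lq μ Real.HolderConjugate.two_two hf hg
  have h2 := pow_le_pow_left' h 2
  refine h2.trans (le_of_eq ?_)
  rw [mul_pow, ← ENNReal.rpow_natCast, ← ENNReal.rpow_natCast, ← ENNReal.rpow_mul,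
    ← ENNReal.rpow_mul]
  norm_num

lemma lintegral_sq_le {α : Type*} [MeasurableSpace α] (μ : Measure α) [IsProbabilityMeasure μ]
    {f : α → ℝ≥0∞} (hf : AEMeasurable f μ) :
    (∫⁻ x, f x ∂μ) ^ 2 ≤ ∫⁻ x, f x ^ 2 ∂μ := by
  simpa using lintegral_mul_sq_le μ hf (aemeasurable_const (b := 1))

lemma uIoc_subset_Ico {c s t : ℝ} (hs : s ∈ Set.Ico c (c + 1)) (ht : t ∈ Set.Ico c (c + 1)) :
    Set.uIoc s t ⊆ Set.Ico c (c + 1) :=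
  Set.uIoc_subset_uIcc.trans (Set.ordConnected_Ico.uIcc_subset hs ht)

lemma enorm_sub_sq_le_lintegral_line {d : ℕ} {g : (Fin d → ℝ) → ℝ} (hg : Differentiable ℝ g)
    (x : Fin d → ℝ) (i : Fin d) {c s t : ℝ} (hs : s ∈ Set.Ico c (c + 1))
    (ht : t ∈ Set.Ico c (c + 1)) :
    ‖g (Function.update x i t) - g (Function.update x i s)‖ₑ ^ 2 ≤
      ∫⁻ r in Set.Ico c (c + 1), ‖pdS i g (Function.update x i r)‖ₑ ^ 2 := by
  refine (pow_le_pow_left' (enorm_sub_le_lintegral_line hg x i (uIoc_subset_Ico hs ht)) 2).trans ?_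
  exact lintegral_sq_le _
    ((measurable_pdS i g).comp (measurable_update x)).enorm.aemeasurable

lemma lintegral_lmarginal_box {d : ℕ} (b : Fin d → ℝ) (s : Finset (Fin d))
    {f : (Fin d → ℝ) → ℝ≥0∞} (hf : Measurable f) :
    ∫⁻ x, lmarginal (fun i => volume.restrict (Set.Ico (b i) (b i + 1))) s f x ∂(boxMeasure b) =
      ∫⁻ x, f x ∂(boxMeasure b) := by
  induction s using Finset.induction_on generalizing f with
  | empty => simp
  | insert i s hi ih =>
    rw [lmarginal_insert' _ hf hi, ih, ← lintegral_boxMeasure b i hf]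
    have := hf.lmarginal (s := {i}) (fun i => volume.restrict (Set.Ico (b i) (b i + 1)))
    rwa [lmarginal_singleton] at this

lemma enorm_sq_eq (a : ℝ) : ‖a‖ₑ ^ 2 = ENNReal.ofReal (a ^ 2) := by
  rw [← ofReal_norm, ← ENNReal.ofReal_pow (norm_nonneg a), Real.norm_eq_abs, sq_abs]

lemma enorm_add_sq_le (a b : ℝ) : ‖a + b‖ₑ ^ 2 ≤ 2 * ‖a‖ₑ ^ 2 + 2 * ‖b‖ₑ ^ 2 := by
  have h : (a + b) ^ 2 ≤ 2 * a ^ 2 + 2 * b ^ 2 := by nlinarith [sq_nonneg (a - b)]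
  have h2 := ENNReal.ofReal_le_ofReal h
  rw [ENNReal.ofReal_add (by positivity) (by positivity),
    ENNReal.ofReal_mul (by norm_num), ENNReal.ofReal_mul (by norm_num)] at h2
  simpa [enorm_sq_eq] using h2

lemma ae_mem_unitBox {d : ℕ} (b : Fin d → ℝ) : ∀ᵐ x ∂(boxMeasure b), x ∈ unitBox b := by
  rw [boxMeasure_eq]; exact ae_restrict_mem (measurableSet_unitBox b)

lemma exists_poincare_marginal {d : ℕ} (s : Finset (Fin d)) :
    ∃ C : ℝ≥0∞, C ≠ ⊤ ∧ ∀ (b : Fin d → ℝ) (g : (Fin d → ℝ) → ℝ), Differentiable ℝ g →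
      ∫⁻ x, lmarginal (fun i => volume.restrict (Set.Ico (b i) (b i + 1))) s
        (fun z => ‖g z - g x‖ₑ ^ 2) x ∂(boxMeasure b) ≤
      C * ∫⁻ x, ∑ i, ‖pdS i g x‖ₑ ^ 2 ∂(boxMeasure b) := by
  induction s using Finset.induction_on with
  | empty => exact ⟨0, by simp, fun b g hg => by simp⟩
  | insert i s hi ih =>
    obtain ⟨C, hC, h⟩ := ih
    refine ⟨2 * C + 2, by finiteness, fun b g hg => ?_⟩
    set μ : Fin d → Measure ℝ := fun i => volume.restrict (Set.Ico (b i) (b i + 1)) with hμ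
    have hgm : Measurable g := hg.continuous.measurable
    set F : (Fin d → ℝ) → ℝ≥0∞ := fun x => ‖pdS i g x‖ₑ ^ 2 with hF
    have hFm : Measurable F := (measurable_pdS i g).enorm.pow_const 2
    set G : (Fin d → ℝ) → ℝ≥0∞ := fun x => ∫⁻ r, F (Function.update x i r) ∂(μ i) with hG
    have hGm : Measurable G := by
      have := hFm.lmarginal (s := {i}) μ
      rwa [lmarginal_singleton] at this
    have key : ∀ x ∈ unitBox b, lmarginal μ (insert i s) (fun z => ‖g z - g x‖ₑ ^ 2) x ≤
        2 * lmarginal μ s (fun z => ‖g z - g x‖ₑ ^ 2) x + 2 * lmarginal μ s G x := by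
      intro x hx
      rw [lmarginal_insert' _ ((hgm.sub_const _).enorm.pow_const 2) hi]
      unfold lmarginal
      rw [← lintegral_const_mul' _ _ (by simp), ← lintegral_const_mul' _ _ (by simp),
        ← lintegral_add_right (g := fun y => 2 * G (Function.updateFinset x s y)) _
          ((hGm.comp measurable_updateFinset).const_mul 2)]
      refine lintegral_mono fun y => ?_
      set x' := Function.updateFinset x s y with hx'
      have hxi : x' i = x i := by simp [hx', Function.updateFinset, hi]
      have hmem : x' i ∈ Set.Ico (b i) (b i + 1) := by rw [hxi]; exact hx i trivial
      calc ∫⁻ r, ‖g (Function.update x' i r) - g x‖ₑ ^ 2 ∂(μ i)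
          ≤ ∫⁻ r, (2 * G x' + 2 * ‖g x' - g x‖ₑ ^ 2) ∂(μ i) := by
            refine lintegral_mono_ae ?_
            filter_upwards [ae_restrict_mem measurableSet_Ico] with r hr
            have h1 := enorm_add_sq_le (g (Function.update x' i r) - g x') (g x' - g x)
            rw [sub_add_sub_cancel] at h1
            refine h1.trans ?_
            gcongr
            have h2 := enorm_sub_sq_le_lintegral_line hg x' i hmem hr
            rwa [Function.update_eq_self] at h2
        _ = 2 * ‖g x' - g x‖ₑ ^ 2 + 2 * G x' := by simp [hμ, add_comm]
    calc ∫⁻ x, lmarginal μ (insert i s) (fun z => ‖g z - g x‖ₑ ^ 2) x ∂(boxMeasure b)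
        ≤ ∫⁻ x, (2 * lmarginal μ s (fun z => ‖g z - g x‖ₑ ^ 2) x + 2 * lmarginal μ s G x)
            ∂(boxMeasure b) := by
          refine lintegral_mono_ae ?_
          filter_upwards [ae_mem_unitBox b] with x hx using key x hx
      _ = 2 * (∫⁻ x, lmarginal μ s (fun z => ‖g z - g x‖ₑ ^ 2) x ∂(boxMeasure b)) +
            2 * ∫⁻ x, F x ∂(boxMeasure b) := by
          rw [lintegral_add_right _ ((hGm.lmarginal μ).const_mul 2),
            lintegral_const_mul' _ _ (by simp), lintegral_const_mul' _ _ (by simp),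
            lintegral_lmarginal_box b s hGm, ← lintegral_boxMeasure b i hFm]
      _ ≤ 2 * (C * ∫⁻ x, ∑ i, ‖pdS i g x‖ₑ ^ 2 ∂(boxMeasure b)) +
            2 * ∫⁻ x, ∑ i, ‖pdS i g x‖ₑ ^ 2 ∂(boxMeasure b) := by
          gcongr
          · exact h b g hg
          · exact Finset.single_le_sum (f := fun i => ‖pdS i g _‖ₑ ^ 2) (fun _ _ => zero_le)
              (Finset.mem_univ i)
      _ = _ := by ring

/-- The Poincaré inequality on unit boxes. -/
lemma exists_poincare (d : ℕ) :
    ∃ C : ℝ≥0∞, C ≠ ⊤ ∧ ∀ (b : Fin d → ℝ) (g : (Fin d → ℝ) → ℝ), Differentiable ℝ g →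
      ∫⁻ x, ‖g x - ∫ z, g z ∂(boxMeasure b)‖ₑ ^ 2 ∂(boxMeasure b) ≤
      C * ∫⁻ x, ∑ i, ‖pdS i g x‖ₑ ^ 2 ∂(boxMeasure b) := by
  obtain ⟨C, hC, h⟩ := exists_poincare_marginal (d := d) Finset.univ
  refine ⟨C, hC, fun b g hg => le_trans (lintegral_mono fun x => ?_) (h b g hg)⟩
  have hgm : Measurable g := hg.continuous.measurable
  have hi := integrable_boxMeasure hg.continuous b
  have h1 : g x - ∫ z, g z ∂(boxMeasure b) = - ∫ z, (g z - g x) ∂(boxMeasure b) := by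
    rw [integral_sub hi (integrable_const _)]; simp
  rw [h1, enorm_neg, lmarginal_univ]
  refine (pow_le_pow_left' (enorm_integral_le_lintegral_enorm _) 2).trans ?_
  exact lintegral_sq_le _ (hgm.sub_const _).enorm.aemeasurable

lemma unitBox_slabCorner_subset {d : ℕ} [NeZero d] (R : ℝ) : unitBox (slabCorner d R) ⊆ strip d := by
  intro x hx i hi
  have := hx i trivial
  simpa [slabCorner, hi] using this

lemma mem_Ico_of_mem_slab {d : ℕ} [NeZero d] {R : ℝ} {x : Fin d → ℝ}
    (hx : x ∈ unitBox (slabCorner d R)) : x 0 ∈ Set.Ico R (R + 1) := by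
  simpa [slabCorner] using hx 0 trivial

lemma tendsto_lintegral_slab {d : ℕ} [NeZero d] {f : (Fin d → ℝ) → ℝ≥0∞} (hf : Measurable f)
    (hfin : ∫⁻ x in strip d, f x ≠ ⊤) {l : Filter ℝ} (hl : l = atTop ∨ l = atBot) :
    Tendsto (fun R => ∫⁻ x, f x ∂(boxMeasure (slabCorner d R))) l (𝓝 0) := by
  have heq : ∀ R, ∫⁻ x, f x ∂(boxMeasure (slabCorner d R)) =
      ∫⁻ x in strip d, (unitBox (slabCorner d R)).indicator f x := by
    intro R
    rw [lintegral_indicator (measurableSet_unitBox _),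
      Measure.restrict_restrict (measurableSet_unitBox _),
      Set.inter_eq_left.2 (unitBox_slabCorner_subset R), boxMeasure_eq]
  simp_rw [heq]
  have hcg : l.IsCountablyGenerated := by rcases hl with rfl | rfl <;> infer_instance
  have := tendsto_lintegral_filter_of_dominated_convergence (μ := volume.restrict (strip d))
    (l := l) (F := fun R x => (unitBox (slabCorner d R)).indicator f x) (f := fun _ => 0) f
    (Eventually.of_forall fun R => hf.indicator (measurableSet_unitBox _))
    (Eventually.of_forall fun R => Eventually.of_forall fun x => Set.indicator_le_self _ _ _)
    hfin (Eventually.of_forall fun x => ?_)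
  · simpa using this
  · refine tendsto_const_nhds.congr' ?_
    have : ∀ᶠ R in l, x ∉ unitBox (slabCorner d R) := by
      rcases hl with rfl | rfl
      · filter_upwards [eventually_gt_atTop (x 0)] with R hR hx
        exact absurd (mem_Ico_of_mem_slab hx).1 (not_le.2 hR)
      · filter_upwards [eventually_le_atBot (x 0 - 1)] with R hR hx
        have := (mem_Ico_of_mem_slab hx).2
        linarith
    filter_upwards [this] with R hR
    simp [hR]

lemma measurable_update_pair {d : ℕ} (i : Fin d) :
    Measurable (fun p : ℝ × (Fin d → ℝ) => Function.update p.2 i p.1) := by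
  refine measurable_pi_lambda _ fun j => ?_
  by_cases hj : j = i
  · subst hj; simpa [Function.update] using measurable_fst
  · simpa [Function.update, hj, Function.comp_def] using
      (measurable_pi_apply (X := fun _ : Fin d => ℝ) j).comp (measurable_snd (α := ℝ))

lemma boxMeasure_slab_eq_map {d : ℕ} [NeZero d] (R : ℝ) :
    boxMeasure (slabCorner d R) =
      ((volume.restrict (Set.Ico R (R + 1))).prod (boxMeasure (0 : Fin d → ℝ))).map
        (fun p => Function.update p.2 0 p.1) := by
  refine Measure.ext_of_lintegral _ fun f hf => ?_
  rw [lintegral_slab R hf, lintegral_map hf (measurable_update_pair 0)]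
  exact (lintegral_prod _ (hf.comp (measurable_update_pair 0)).aemeasurable).symm

lemma integral_slab {d : ℕ} [NeZero d] (R : ℝ) {f : (Fin d → ℝ) → ℝ} (hf : Continuous f) :
    Integrable (fun t => ∫ y, f (Function.update y 0 t) ∂(boxMeasure (0 : Fin d → ℝ)))
      (volume.restrict (Set.Ico R (R + 1))) ∧
    ∫ x, f x ∂(boxMeasure (slabCorner d R)) =
      ∫ t in Set.Ico R (R + 1), ∫ y, f (Function.update y 0 t) ∂(boxMeasure (0 : Fin d → ℝ)) := by
  have h := integrable_boxMeasure hf (slabCorner d R)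
  rw [boxMeasure_slab_eq_map] at h ⊢
  have hm := (measurable_update_pair (0 : Fin d)).aemeasurable (μ :=
    ((volume.restrict (Set.Ico R (R + 1))).prod (boxMeasure (0 : Fin d → ℝ))))
  rw [integrable_map_measure hf.aestronglyMeasurable hm] at h
  refine ⟨h.integral_prod_left, ?_⟩
  rw [integral_map hm hf.aestronglyMeasurable]
  exact integral_prod _ h

lemma eventually_forall_Ico {p : ℝ → Prop} {l : Filter ℝ} (hl : l = atTop ∨ l = atBot)
    (h : ∀ᶠ t in l, p t) : ∀ᶠ R in l, ∀ t ∈ Set.Ico R (R + 1), p t := by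
  rcases hl with rfl | rfl
  · obtain ⟨A, hA⟩ := eventually_atTop.1 h
    filter_upwards [eventually_ge_atTop A] with R hR t ht using hA t (hR.trans ht.1)
  · obtain ⟨A, hA⟩ := eventually_atBot.1 h
    filter_upwards [eventually_le_atBot (A - 1)] with R hR t ht
    exact hA t (by linarith [ht.2])

lemma tendsto_mean_slab {d : ℕ} [NeZero d] {f : (Fin d → ℝ) → ℝ} (hf : Continuous f) {c : ℝ}
    {l : Filter ℝ} (hl : l = atTop ∨ l = atBot)
    (h : Tendsto (fun t => ∫ y, f (Function.update y 0 t) ∂(boxMeasure (0 : Fin d → ℝ))) l (𝓝 c)) :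
    Tendsto (fun R => ∫ x, f x ∂(boxMeasure (slabCorner d R))) l (𝓝 c) := by
  rw [Metric.tendsto_nhds] at h ⊢
  intro ε hε
  filter_upwards [eventually_forall_Ico hl (h (ε / 2) (by positivity))] with R hR
  obtain ⟨hi, heq⟩ := integral_slab R hf
  rw [heq]
  set m := fun t => ∫ y, f (Function.update y 0 t) ∂(boxMeasure (0 : Fin d → ℝ)) with hm
  have h1 : (∫ t in Set.Ico R (R + 1), m t) - c = ∫ t in Set.Ico R (R + 1), (m t - c) := by
    rw [integral_sub hi (integrable_const _)]; simp
  rw [Real.dist_eq, h1, ← Real.norm_eq_abs]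
  have := norm_setIntegral_le_of_norm_le_const (μ := volume) (s := Set.Ico R (R + 1))
    (f := fun t => m t - c) (C := ε / 2) (by simp) (fun t ht => by
      rw [Real.norm_eq_abs, ← Real.dist_eq]; exact (hR t ht).le)
  simp at this
  simp only [Real.norm_eq_abs] at this ⊢
  linarith

lemma tendsto_lintegral_sub_sq_slab {d : ℕ} [NeZero d] {g : (Fin d → ℝ) → ℝ}
    (hg : Differentiable ℝ g) (hfin : ∫⁻ x in strip d, ∑ i, ‖pdS i g x‖ₑ ^ 2 ≠ ⊤) {c : ℝ}
    {l : Filter ℝ} (hl : l = atTop ∨ l = atBot)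
    (h : Tendsto (fun t => ∫ y, g (Function.update y 0 t) ∂(boxMeasure (0 : Fin d → ℝ))) l (𝓝 c)) :
    Tendsto (fun R => ∫⁻ x, ‖g x - c‖ₑ ^ 2 ∂(boxMeasure (slabCorner d R))) l (𝓝 0) := by
  obtain ⟨C, hC, hP⟩ := exists_poincare d
  have hmean := tendsto_mean_slab hg.continuous hl h
  have h1 := tendsto_lintegral_slab (f := fun x => ∑ i, ‖pdS i g x‖ₑ ^ 2)
    (Finset.measurable_sum _ fun i _ => (measurable_pdS i g).enorm.pow_const 2) hfin hl
  have h2 : Tendsto (fun R => ‖(∫ x, g x ∂(boxMeasure (slabCorner d R))) - c‖ₑ ^ 2) l (𝓝 0) := by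
    have h3 : Tendsto (fun R => ‖(∫ x, g x ∂(boxMeasure (slabCorner d R))) - c‖ₑ) l (𝓝 ‖c - c‖ₑ) :=
      (hmean.sub_const c).enorm
    have := ENNReal.Tendsto.pow (n := 2) h3
    simpa using this
  have h4 : Tendsto (fun R => 2 * (C * ∫⁻ x, ∑ i, ‖pdS i g x‖ₑ ^ 2 ∂(boxMeasure (slabCorner d R))) +
      2 * ‖(∫ x, g x ∂(boxMeasure (slabCorner d R))) - c‖ₑ ^ 2) l (𝓝 0) := by
    have := (ENNReal.Tendsto.const_mul (ENNReal.Tendsto.const_mul h1 (Or.inr hC))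
      (Or.inr (by simp : (2 : ℝ≥0∞) ≠ ⊤))).add
      (ENNReal.Tendsto.const_mul h2 (Or.inr (by simp : (2 : ℝ≥0∞) ≠ ⊤)))
    simpa using this
  refine tendsto_of_tendsto_of_tendsto_of_le_of_le tendsto_const_nhds h4 (fun _ => zero_le)
    fun R => ?_
  set m := ∫ x, g x ∂(boxMeasure (slabCorner d R)) with hm
  calc ∫⁻ x, ‖g x - c‖ₑ ^ 2 ∂(boxMeasure (slabCorner d R))
      ≤ ∫⁻ x, (2 * ‖g x - m‖ₑ ^ 2 + 2 * ‖m - c‖ₑ ^ 2) ∂(boxMeasure (slabCorner d R)) := by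
        refine lintegral_mono fun x => ?_
        have := enorm_add_sq_le (g x - m) (m - c)
        rwa [sub_add_sub_cancel] at this
    _ = 2 * ∫⁻ x, ‖g x - m‖ₑ ^ 2 ∂(boxMeasure (slabCorner d R)) + 2 * ‖m - c‖ₑ ^ 2 := by
        rw [lintegral_add_right _ measurable_const, lintegral_const_mul' _ _ (by simp)]
        simp
    _ ≤ _ := by
        gcongr
        exact hP _ g hg

lemma enorm_le_lintegral_line {d : ℕ} {g : (Fin d → ℝ) → ℝ} (hg : Differentiable ℝ g)
    (x : Fin d → ℝ) (i : Fin d) {c : ℝ} (hx : x i ∈ Set.Ico c (c + 1)) :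
    ‖g x‖ₑ ≤ ∫⁻ r in Set.Ico c (c + 1),
      (‖g (Function.update x i r)‖ₑ + ‖pdS i g (Function.update x i r)‖ₑ) := by
  have hgl : Measurable fun r : ℝ => ‖g (Function.update x i r)‖ₑ :=
    (hg.continuous.measurable.comp (measurable_update x)).enorm
  have h : ∀ r ∈ Set.Ico c (c + 1), ‖g x‖ₑ ≤ ‖g (Function.update x i r)‖ₑ +
      ∫⁻ r in Set.Ico c (c + 1), ‖pdS i g (Function.update x i r)‖ₑ := by
    intro r hr
    have h1 := enorm_sub_le_lintegral_line hg x i (uIoc_subset_Ico hr hx)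
    rw [Function.update_eq_self] at h1
    calc ‖g x‖ₑ = ‖g (Function.update x i r) + (g x - g (Function.update x i r))‖ₑ := by
          rw [add_sub_cancel]
      _ ≤ _ := (enorm_add_le _ _).trans (by gcongr)
  calc ‖g x‖ₑ = ∫⁻ r in Set.Ico c (c + 1), ‖g x‖ₑ := by simp
    _ ≤ ∫⁻ r in Set.Ico c (c + 1), (‖g (Function.update x i r)‖ₑ +
      ∫⁻ r in Set.Ico c (c + 1), ‖pdS i g (Function.update x i r)‖ₑ) :=
        setLIntegral_mono' measurableSet_Ico h
    _ = _ := by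
      rw [lintegral_add_left hgl, lintegral_add_left hgl]
      simp

/-- The Gagliardo–Nirenberg–Sobolev inequality on unit boxes, for the exponent `1`. -/
lemma lintegral_enorm_rpow_le {d : ℕ} (hd : 2 ≤ d) (b : Fin d → ℝ) {g : (Fin d → ℝ) → ℝ}
    (hg : Differentiable ℝ g) :
    ∫⁻ x, ‖g x‖ₑ ^ ((d : ℝ) / (d - 1)) ∂(boxMeasure b) ≤
      (∫⁻ x, (‖g x‖ₑ + ∑ i, ‖pdS i g x‖ₑ) ∂(boxMeasure b)) ^ ((d : ℝ) / (d - 1)) := by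
  have hd' : (2 : ℝ) ≤ d := by exact_mod_cast hd
  set f : (Fin d → ℝ) → ℝ≥0∞ := fun x => ‖g x‖ₑ + ∑ i, ‖pdS i g x‖ₑ with hf
  have hfm : Measurable f := hg.continuous.measurable.enorm.add
    (Finset.measurable_sum _ fun i _ => (measurable_pdS i g).enorm)
  have hp : Real.HolderConjugate (Fintype.card (Fin d)) ((d : ℝ) / (d - 1)) := by
    rw [Fintype.card_fin, Real.holderConjugate_iff]
    refine ⟨by linarith, ?_⟩
    have : (d : ℝ) ≠ 0 := by linarith
    field_simp
    ring
  refine le_trans ?_ (lintegral_prod_lintegral_pow_le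
    (fun i => volume.restrict (Set.Ico (b i) (b i + 1))) hp hfm)
  refine lintegral_mono_ae ?_
  filter_upwards [ae_mem_unitBox b] with x hx
  have h1 : ‖g x‖ₑ ^ ((d : ℝ) / (d - 1)) = ∏ _i : Fin d, ‖g x‖ₑ ^ ((1 : ℝ) / ((d : ℝ) - 1)) := by
    rw [Finset.prod_const, Finset.card_univ, Fintype.card_fin, ← ENNReal.rpow_natCast,
      ← ENNReal.rpow_mul]
    congr 1
    ring
  rw [h1, Fintype.card_fin]
  refine Finset.prod_le_prod' fun i _ => ?_
  refine ENNReal.rpow_le_rpow ?_ (by apply div_nonneg <;> linarith)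
  refine (enorm_le_lintegral_line hg x i (hx i trivial)).trans (lintegral_mono fun r => ?_)
  simp only
  gcongr
  exact Finset.single_le_sum (f := fun i => ‖pdS i g _‖ₑ) (fun _ _ => zero_le) (Finset.mem_univ i)

lemma vnorm2_nonneg {d : ℕ} (v : Fin d → ℝ) : 0 ≤ vnorm2 v :=
  Finset.sum_nonneg fun _ _ => sq_nonneg _

lemma gradSq_nonneg {d : ℕ} (u : (Fin d → ℝ) → Fin d → ℝ) (x : Fin d → ℝ) : 0 ≤ gradSq u x :=
  Finset.sum_nonneg fun _ _ => Finset.sum_nonneg fun _ _ => sq_nonneg _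

lemma measurable_pd {d : ℕ} (i j : Fin d) (u : (Fin d → ℝ) → Fin d → ℝ) :
    Measurable (fun x => pd i u x j) :=
  (measurable_pi_apply j).comp (measurable_fderiv_apply_const ℝ u _)

lemma measurable_gradSq {d : ℕ} (u : (Fin d → ℝ) → Fin d → ℝ) : Measurable (gradSq u) :=
  Finset.measurable_sum _ fun i _ => Finset.measurable_sum _ fun j _ =>
    (measurable_pd i j u).pow_const 2

lemma continuous_vnorm2 {d : ℕ} : Continuous (vnorm2 (d := d)) := by
  unfold vnorm2; fun_prop

lemma abs_sum_mul_le {d : ℕ} (v w : Fin d → ℝ) :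
    |∑ k, v k * w k| ≤ √(vnorm2 v) * √(vnorm2 w) := by
  rw [← Real.sqrt_mul (vnorm2_nonneg v)]
  exact Real.abs_le_sqrt (Finset.sum_mul_sq_le_sq_mul_sq _ _ _)

lemma abs_pdS_vnorm2_rpow_le {d : ℕ} {v : (Fin d → ℝ) → Fin d → ℝ} (hv : Differentiable ℝ v)
    {σ : ℝ} (hσ : 1 ≤ σ) (i : Fin d) (x : Fin d → ℝ) :
    Differentiable ℝ (fun x => vnorm2 (v x) ^ σ) ∧
    |pdS i (fun x => vnorm2 (v x) ^ σ) x| ≤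
      2 * σ * (vnorm2 (v x) ^ (σ - 1 / 2) * √(gradSq v x)) := by
  have hvk : ∀ k x, HasFDerivAt (fun x => v x k)
      ((ContinuousLinearMap.proj k).comp (fderiv ℝ v x)) x := fun k x =>
    hasFDerivAt_pi'.1 (hv x).hasFDerivAt k
  have hN : ∀ x, HasFDerivAt (fun x => vnorm2 (v x))
      (∑ k, (2 * v x k) • ((ContinuousLinearMap.proj k).comp (fderiv ℝ v x) :
        (Fin d → ℝ) →L[ℝ] ℝ)) x := by
    intro x
    unfold vnorm2
    refine HasFDerivAt.fun_sum fun k _ => ?_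
    simpa using (hvk k x).pow 2
  have hG : ∀ x, HasFDerivAt (fun x => vnorm2 (v x) ^ σ) _ x := fun x =>
    (hN x).rpow_const (Or.inr hσ)
  refine ⟨fun x => (hG x).differentiableAt, ?_⟩
  unfold pdS
  rw [(hG x).fderiv]
  have h1 : (∑ k, (2 * v x k) • ((ContinuousLinearMap.proj k).comp (fderiv ℝ v x) :
        (Fin d → ℝ) →L[ℝ] ℝ)) (Pi.single i 1) = 2 * ∑ k, v x k * pd i v x k := by
    simp [pd, Finset.mul_sum, mul_assoc]
  rw [smul_apply, h1, smul_eq_mul, abs_mul,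
    abs_of_nonneg (mul_nonneg (by linarith) (Real.rpow_nonneg (vnorm2_nonneg _) _)), abs_mul]
  have h2 := abs_sum_mul_le (v x) (pd i v x)
  have h3 : √(vnorm2 (pd i v x)) ≤ √(gradSq v x) := by
    refine Real.sqrt_le_sqrt ?_
    exact Finset.single_le_sum (f := fun i => ∑ j, pd i v x j ^ 2)
      (fun _ _ => Finset.sum_nonneg fun _ _ => sq_nonneg _) (Finset.mem_univ i)
  have h4 : vnorm2 (v x) ^ (σ - 1) * √(vnorm2 (v x)) = vnorm2 (v x) ^ (σ - 1 / 2) := by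
    rw [Real.sqrt_eq_rpow, ← Real.rpow_add_of_nonneg (vnorm2_nonneg _) (by linarith) (by norm_num)]
    congr 1; ring
  calc σ * vnorm2 (v x) ^ (σ - 1) * (|2| * |∑ k, v x k * pd i v x k|)
      ≤ σ * vnorm2 (v x) ^ (σ - 1) * (2 * (√(vnorm2 (v x)) * √(gradSq v x))) := by
        have := Real.rpow_nonneg (vnorm2_nonneg (v x)) (σ - 1)
        rw [abs_two]
        gcongr
        exact h2.trans (by gcongr)
    _ = 2 * σ * (vnorm2 (v x) ^ (σ - 1) * √(vnorm2 (v x)) * √(gradSq v x)) := by ring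
    _ = _ := by rw [h4]

lemma lintegral_ofReal_ne_top {d : ℕ} {f : (Fin d → ℝ) → ℝ} (hf : Continuous f) (b : Fin d → ℝ) :
    ∫⁻ x, ENNReal.ofReal (f x) ∂(boxMeasure b) ≠ ⊤ :=
  ((lintegral_mono fun x => Real.ofReal_le_enorm (f x)).trans_lt
    (integrable_boxMeasure hf b).2).ne

lemma lintegral_ofReal_mul_sq_le {α : Type*} [MeasurableSpace α] (μ : Measure α) {f g : α → ℝ}
    (hf : Measurable f) (hg : Measurable g) (h0 : ∀ x, 0 ≤ f x) (h1 : ∀ x, 0 ≤ g x) :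
    (∫⁻ x, ENNReal.ofReal (f x * g x) ∂μ) ^ 2 ≤
      (∫⁻ x, ENNReal.ofReal (f x ^ 2) ∂μ) * ∫⁻ x, ENNReal.ofReal (g x ^ 2) ∂μ := by
  have := lintegral_mul_sq_le μ hf.ennreal_ofReal.aemeasurable hg.ennreal_ofReal.aemeasurable
  simp_rw [ENNReal.ofReal_mul (h0 _), ENNReal.ofReal_pow (h0 _), ENNReal.ofReal_pow (h1 _)]
  exact this

/-- On unit boxes, a small `H¹` norm controls the integral of the power `2(d-1)/(d-2)`. -/
lemma exists_gns_small {d : ℕ} (hd : 3 ≤ d) :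
    ∃ δ : ℝ≥0∞, δ ≠ 0 ∧ ∀ (b : Fin d → ℝ) (v : (Fin d → ℝ) → Fin d → ℝ), Differentiable ℝ v →
      ∫⁻ x, ENNReal.ofReal (vnorm2 (v x) + gradSq v x) ∂(boxMeasure b) ≤ δ →
      (∫⁻ x, ENNReal.ofReal (vnorm2 (v x) ^ (((d : ℝ) - 1) / (d - 2))) ∂(boxMeasure b)) ^ 2 ≤
        ∫⁻ x, ENNReal.ofReal (vnorm2 (v x)) ∂(boxMeasure b) := by
  have hd' : (3 : ℝ) ≤ d := by exact_mod_cast hd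
  have hd2 : (0 : ℝ) < d - 2 := by linarith
  set σ : ℝ := ((d : ℝ) - 1) / (d - 2) with hσ
  have hσ1 : 1 ≤ σ := by rw [hσ, one_le_div hd2]; linarith
  set p : ℝ := (d : ℝ) / (d - 1) with hp
  have hp2 : p < 2 := by rw [hp, div_lt_iff₀ (by linarith)]; linarith
  have hp0 : 0 ≤ p := by rw [hp]; apply div_nonneg <;> linarith
  have hσp : σ * p = 2 * (σ - 1 / 2) := by
    have : (d : ℝ) - 1 ≠ 0 := by linarith
    rw [hσ, hp]; field_simp; ring
  set K : ℝ := 1 + d * (2 * σ) with hK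
  have hK0 : 0 < K := by positivity
  refine ⟨ENNReal.ofReal (1 / (2 * K ^ 2)), by simpa using by positivity, fun b v hv hY => ?_⟩
  have hvc : Continuous fun x => vnorm2 (v x) := continuous_vnorm2.comp hv.continuous
  set q : (Fin d → ℝ) → ℝ := fun x => vnorm2 (v x) ^ (σ - 1 / 2) with hq
  have hq0 : ∀ x, 0 ≤ q x := fun x => Real.rpow_nonneg (vnorm2_nonneg _) _
  have hqc : Continuous q := hvc.rpow_const fun x => Or.inr (by linarith)
  have hG : ∀ x, vnorm2 (v x) ^ σ = q x * √(vnorm2 (v x)) := fun x => by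
    rw [hq, Real.sqrt_eq_rpow, ← Real.rpow_add_of_nonneg (vnorm2_nonneg _) (by linarith)
      (by norm_num)]
    congr 1; ring
  set X := ∫⁻ x, ENNReal.ofReal (q x ^ 2) ∂(boxMeasure b) with hX
  have hXfin : X ≠ ⊤ := lintegral_ofReal_ne_top (hqc.pow 2) b
  have hGd := (abs_pdS_vnorm2_rpow_le hv hσ1 ⟨0, by lia⟩ 0).1
  have h1 := lintegral_enorm_rpow_le (by lia) b hGd
  have h2 : ∀ x, ‖vnorm2 (v x) ^ σ‖ₑ ^ p = ENNReal.ofReal (q x ^ 2) := fun x => by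
    rw [Real.enorm_of_nonneg (Real.rpow_nonneg (vnorm2_nonneg _) _),
      ENNReal.ofReal_rpow_of_nonneg (Real.rpow_nonneg (vnorm2_nonneg _) _) hp0,
      ← Real.rpow_mul (vnorm2_nonneg _), hσp, mul_comm, Real.rpow_mul (vnorm2_nonneg _),
      Real.rpow_two]
  simp_rw [← hp, h2] at h1
  have hgm : Measurable fun x => K * (√(vnorm2 (v x)) + √(gradSq v x)) :=
    (hvc.measurable.sqrt.add (measurable_gradSq v).sqrt).const_mul K
  have hsm : Measurable fun x => ENNReal.ofReal (vnorm2 (v x) + gradSq v x) :=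
    (hvc.measurable.add (measurable_gradSq v)).ennreal_ofReal
  have h3 : ∀ x, ‖vnorm2 (v x) ^ σ‖ₑ + ∑ i, ‖pdS i (fun x => vnorm2 (v x) ^ σ) x‖ₑ ≤
      ENNReal.ofReal (q x * (K * (√(vnorm2 (v x)) + √(gradSq v x)))) := by
    intro x
    have e1 : ∀ i, ‖pdS i (fun x => vnorm2 (v x) ^ σ) x‖ₑ ≤
        ENNReal.ofReal (2 * σ * (q x * √(gradSq v x))) := fun i => by
      rw [← ofReal_norm]
      exact ENNReal.ofReal_le_ofReal (abs_pdS_vnorm2_rpow_le hv hσ1 i x).2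
    have hs1 := Real.sqrt_nonneg (vnorm2 (v x))
    have hs2 := Real.sqrt_nonneg (gradSq v x)
    have hqx := hq0 x
    calc _ ≤ ENNReal.ofReal (q x * √(vnorm2 (v x))) +
          ∑ i : Fin d, ENNReal.ofReal (2 * σ * (q x * √(gradSq v x))) := by
          gcongr with i
          · rw [hG, Real.enorm_of_nonneg (by positivity)]
          · exact e1 i
      _ = ENNReal.ofReal (q x * √(vnorm2 (v x)) + d * (2 * σ * (q x * √(gradSq v x)))) := by
          rw [Finset.sum_const, Finset.card_univ, Fintype.card_fin, nsmul_eq_mul,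
            ENNReal.ofReal_add (by positivity) (by positivity),
            ENNReal.ofReal_mul (p := (d : ℝ)) (by positivity), ENNReal.ofReal_natCast]
      _ ≤ _ := by
          refine ENNReal.ofReal_le_ofReal ?_
          have : 0 ≤ q x * √(gradSq v x) := by positivity
          have : 0 ≤ (d * (2 * σ)) * (q x * √(vnorm2 (v x))) := by positivity
          rw [hK]; nlinarith
  have h4 : (∫⁻ x, ENNReal.ofReal (q x * (K * (√(vnorm2 (v x)) + √(gradSq v x))))
      ∂(boxMeasure b)) ^ 2 ≤ X := by
    refine (lintegral_ofReal_mul_sq_le _ hqc.measurable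
      hgm hq0 (fun x => by positivity)).trans ?_
    refine mul_le_of_le_one_right' ?_
    calc _ ≤ ∫⁻ x, ENNReal.ofReal (2 * K ^ 2) * ENNReal.ofReal (vnorm2 (v x) + gradSq v x)
          ∂(boxMeasure b) := by
          refine lintegral_mono fun x => ?_
          rw [← ENNReal.ofReal_mul (by positivity)]
          refine ENNReal.ofReal_le_ofReal ?_
          rw [mul_pow]
          have s1 := Real.sq_sqrt (vnorm2_nonneg (v x))
          have s2 := Real.sq_sqrt (gradSq_nonneg v x)
          have : (√(vnorm2 (v x)) + √(gradSq v x)) ^ 2 ≤ 2 * (vnorm2 (v x) + gradSq v x) := by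
            nlinarith [sq_nonneg (√(vnorm2 (v x)) - √(gradSq v x))]
          nlinarith [sq_nonneg K]
      _ ≤ ENNReal.ofReal (2 * K ^ 2) * ENNReal.ofReal (1 / (2 * K ^ 2)) := by
          rw [lintegral_const_mul _ hsm]
          gcongr
      _ = 1 := by
          rw [← ENNReal.ofReal_mul (by positivity), mul_one_div_cancel (by positivity)]
          simp
  have h5 : X ^ (2 : ℝ) ≤ X ^ p := by
    have h6 : X ≤ (∫⁻ x, ENNReal.ofReal (q x * (K * (√(vnorm2 (v x)) + √(gradSq v x))))
        ∂(boxMeasure b)) ^ p :=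
      h1.trans (ENNReal.rpow_le_rpow (lintegral_mono h3) hp0)
    calc X ^ (2 : ℝ) ≤ _ := ENNReal.rpow_le_rpow h6 (by norm_num)
      _ ≤ X ^ p := by
        rw [← ENNReal.rpow_mul, mul_comm, ENNReal.rpow_mul]
        refine ENNReal.rpow_le_rpow ?_ hp0
        rw [ENNReal.rpow_two]; exact h4
  have hX1 : X ≤ 1 := by
    by_contra! h
    exact absurd h5 (not_le.2 (ENNReal.rpow_lt_rpow_of_exponent_lt h hXfin hp2))
  have h7 := lintegral_ofReal_mul_sq_le (boxMeasure b) hqc.measurable hvc.measurable.sqrt hq0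
    (fun x => Real.sqrt_nonneg _)
  simp_rw [← hG, Real.sq_sqrt (vnorm2_nonneg _)] at h7
  exact h7.trans (mul_le_of_le_one_left' hX1)

/-- Mean of a scalar function over the slice `{x₁ = t}`. -/
def sliceMean {d : ℕ} [NeZero d] (f : (Fin d → ℝ) → ℝ) (t : ℝ) : ℝ :=
  ∫ y, f (Function.update y 0 t) ∂(boxMeasure (0 : Fin d → ℝ))

lemma sliceMean_eq_face {n : ℕ} (f : (Fin (n + 1) → ℝ) → ℝ) (t : ℝ) :
    sliceMean f t = ∫ x in Set.Icc (0 : Fin n → ℝ) 1, f (Fin.insertNth 0 t x) := by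
  have hmp := measurePreserving_piFinSuccAbove
    (fun i : Fin (n + 1) => volume.restrict (Set.Ico ((0 : Fin (n + 1) → ℝ) i) (0 + 1))) 0
  unfold sliceMean boxMeasure
  have h1 : ∀ y : Fin (n + 1) → ℝ, f (Function.update y 0 t) =
      (fun z : ℝ × (Fin n → ℝ) => f (Fin.insertNth 0 t z.2))
        (MeasurableEquiv.piFinSuccAbove (fun _ => ℝ) 0 y) := by
    intro y
    congr 1
    ext j
    refine Fin.cases ?_ (fun k => ?_) j
    · simp
    · simp [MeasurableEquiv.piFinSuccAbove, Fin.insertNthEquiv, Fin.tail]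
  simp_rw [h1]
  have h2 := hmp.integral_comp' (fun z : ℝ × (Fin n → ℝ) => f (Fin.insertNth 0 t z.2))
  refine h2.trans ((integral_fun_snd fun x : Fin n → ℝ => f (Fin.insertNth 0 t x)).trans ?_)
  simp only [Pi.zero_apply, zero_add]
  rw [← Measure.restrict_pi_pi,
    setIntegral_congr_set (Measure.univ_pi_Ico_ae_eq_Icc (f := fun _ => (0 : ℝ)) (g := fun _ => 1))]
  simp [Pi.zero_def, Pi.one_def, volume_pi]

lemma strip_inter_ae_eq {n : ℕ} (s t : ℝ) :
    (strip (n + 1) ∩ {x | x 0 ∈ Set.Icc s t} : Set (Fin (n + 1) → ℝ)) =ᵐ[volume]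
      Set.Icc (Fin.cons s 0) (Fin.cons t 1) := by
  have h1 : (strip (n + 1) ∩ {x | x 0 ∈ Set.Icc s t} : Set (Fin (n + 1) → ℝ)) =
      Set.univ.pi fun i => if i = 0 then Set.Icc s t else Set.Ico 0 1 := by
    ext x
    simp only [strip, Set.mem_inter_iff, Set.mem_ofPred_eq, Set.mem_univ_pi]
    constructor
    · rintro ⟨h, h0⟩ i
      by_cases hi : i = 0
      · subst hi; simpa using h0
      · simpa [hi] using h i hi
    · intro h
      refine ⟨fun i hi => by simpa [hi] using h i, by simpa using h 0⟩
  rw [h1, ← Set.pi_univ_Icc]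
  refine Measure.ae_eq_set_pi fun i _ => ?_
  refine Fin.cases ?_ (fun k => ?_) i
  · exact EventuallyEq.of_eq (by simp; rfl)
  · simpa using Ico_ae_eq_Icc

/-- The divergence theorem on a slab of the strip, for periodic fields. -/
lemma integral_div_slab {d : ℕ} [NeZero d] {F : (Fin d → ℝ) → Fin d → ℝ}
    (hF : Differentiable ℝ F) (hper : IsPeriodic F)
    (hint : IntegrableOn (fun x => ∑ i, pd i F x i) (strip d)) {s t : ℝ} (hst : s ≤ t) :
    ∫ x in strip d ∩ {x | x 0 ∈ Set.Icc s t}, ∑ i, pd i F x i =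
      sliceMean (fun x => F x 0) t - sliceMean (fun x => F x 0) s := by
  obtain ⟨n, rfl⟩ : ∃ n, d = n + 1 := ⟨d - 1, by have := NeZero.pos d; lia⟩
  rw [setIntegral_congr_set (strip_inter_ae_eq s t)]
  have hi2 := (hint.mono_set (Set.inter_subset_left (t := {x | x 0 ∈ Set.Icc s t}))).congr_set_ae
    (strip_inter_ae_eq s t).symm
  have hle : (Fin.cons s 0 : Fin (n + 1) → ℝ) ≤ Fin.cons t 1 := by
    intro i
    refine Fin.cases ?_ (fun k => ?_) i <;> simp [hst]
  have := integral_divergence_of_hasFDerivAt_off_countable (Fin.cons s 0) (Fin.cons t 1) hle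
    F (fderiv ℝ F) ∅ Set.countable_empty hF.continuous.continuousOn
    (fun x _ => (hF x).hasFDerivAt) hi2
  refine this.trans ?_
  rw [Fin.sum_univ_succ, Finset.sum_eq_zero, add_zero]
  · rw [sliceMean_eq_face, sliceMean_eq_face]
    rfl
  · intro k _
    have hk : ∀ x : Fin n → ℝ, F (k.succ.insertNth (1 : ℝ) x) = F (k.succ.insertNth (0 : ℝ) x) := by
      intro x
      rw [← hper (k.succ.insertNth (0 : ℝ) x) k.succ (Fin.succ_ne_zero k)]
      congr 1
      ext j
      refine Fin.succAboveCases k.succ ?_ (fun m => ?_) j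
      · simp
      · simp [Fin.succAbove_ne]
    simp [hk]

/-- A periodic field with integrable divergence: the integral of the divergence over the strip
is the difference of the limiting mean fluxes. -/
lemma integral_div_strip {d : ℕ} [NeZero d] {F : (Fin d → ℝ) → Fin d → ℝ}
    (hF : Differentiable ℝ F) (hper : IsPeriodic F)
    (hint : IntegrableOn (fun x => ∑ i, pd i F x i) (strip d)) {cm cp : ℝ}
    (hm : ∀ δ > 0, ∃ᶠ t in atBot, |sliceMean (fun x => F x 0) t - cm| < δ)
    (hp : ∀ δ > 0, ∃ᶠ t in atTop, |sliceMean (fun x => F x 0) t - cp| < δ) :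
    ∫ x in strip d, ∑ i, pd i F x i = cp - cm := by
  have hcov : AECover (volume.restrict (strip d)) (atBot ×ˢ atTop : Filter (ℝ × ℝ))
      (fun p : ℝ × ℝ => {x : Fin d → ℝ | x 0 ∈ Set.Icc p.1 p.2}) := by
    refine ⟨ae_of_all _ fun x => ?_, fun p => ?_⟩
    · exact (eventually_le_atBot (x 0)).prod_mk (eventually_ge_atTop (x 0))
    · exact measurable_pi_apply (0 : Fin d) measurableSet_Icc
  have hT := hcov.integral_tendsto_of_countably_generated hint
  set I := ∫ x in strip d, ∑ i, pd i F x i with hI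
  by_contra hne
  have hε : 0 < |I - (cp - cm)| / 3 := by
    have := abs_pos.2 (sub_ne_zero.2 hne); positivity
  set ε := |I - (cp - cm)| / 3 with hεdef
  have hle : ∀ᶠ p : ℝ × ℝ in atBot ×ˢ atTop, p.1 ≤ p.2 :=
    ((eventually_le_atBot (0 : ℝ)).prod_mk (eventually_ge_atTop (0 : ℝ))).mono
      fun p hp => hp.1.trans hp.2
  obtain ⟨pa, hpa, pb, hpb, hab⟩ := eventually_prod_iff.1
    ((Metric.tendsto_nhds.1 hT ε hε).and hle)
  obtain ⟨s, hs1, hs2⟩ := ((hm ε hε).and_eventually hpa).exists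
  obtain ⟨t, ht1, ht2⟩ := ((hp ε hε).and_eventually hpb).exists
  obtain ⟨h1, h2⟩ := hab hs2 ht2
  have hmeas : MeasurableSet {x : Fin d → ℝ | x 0 ∈ Set.Icc s t} :=
    measurable_pi_apply (0 : Fin d) measurableSet_Icc
  rw [Measure.restrict_restrict hmeas, Set.inter_comm, integral_div_slab hF hper hint h2,
    Real.dist_eq] at h1
  have h3 : |I - (cp - cm)| = 3 * ε := by rw [hεdef]; ring
  rw [abs_lt] at hs1 ht1 h1
  have : |I - (cp - cm)| < 3 * ε := by
    rw [abs_lt]; constructor <;> linarith [hs1.1, hs1.2, ht1.1, ht1.2, h1.1, h1.2]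
  linarith

lemma abs_sliceMean_sub_le {d : ℕ} [NeZero d] {f : (Fin d → ℝ) → ℝ} (hf : Continuous f) (c t : ℝ) :
    ENNReal.ofReal |sliceMean f t - c| ≤
      ∫⁻ y, ‖f (Function.update y 0 t) - c‖ₑ ∂(boxMeasure (0 : Fin d → ℝ)) := by
  have hi : Integrable (fun y => f (Function.update y 0 t)) (boxMeasure (0 : Fin d → ℝ)) :=
    integrable_boxMeasure (hf.comp (continuous_id.update 0 continuous_const)) 0
  have : sliceMean f t - c =
      ∫ y, (f (Function.update y 0 t) - c) ∂(boxMeasure (0 : Fin d → ℝ)) := by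
    rw [integral_sub hi (integrable_const _)]
    simp [sliceMean]
  rw [this, ← Real.norm_eq_abs, ofReal_norm]
  exact enorm_integral_le_lintegral_enorm _

lemma frequently_of_eventually_Ico {q : ℝ → Prop} {l : Filter ℝ} (hl : l = atTop ∨ l = atBot)
    (h : ∀ᶠ R in l, ∃ t ∈ Set.Ico R (R + 1), q t) : ∃ᶠ t in l, q t := by
  rcases hl with rfl | rfl
  · refine frequently_atTop.2 fun A => ?_
    obtain ⟨R, ⟨t, ht, hq⟩, hR⟩ := (h.and (eventually_ge_atTop A)).exists
    exact ⟨t, hR.trans ht.1, hq⟩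
  · refine frequently_atBot.2 fun A => ?_
    obtain ⟨R, ⟨t, ht, hq⟩, hR⟩ := (h.and (eventually_le_atBot (A - 1))).exists
    exact ⟨t, by linarith [ht.2], hq⟩

/-- If a nonnegative function tends to zero in mean on slabs, it is small on some slices. -/
lemma frequently_slice_lt {d : ℕ} [NeZero d] {f : (Fin d → ℝ) → ℝ≥0∞} (hf : Measurable f)
    {l : Filter ℝ} (hl : l = atTop ∨ l = atBot)
    (h : Tendsto (fun R => ∫⁻ x, f x ∂(boxMeasure (slabCorner d R))) l (𝓝 0)) {δ : ℝ≥0∞}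
    (hδ : δ ≠ 0) :
    ∃ᶠ t in l, ∫⁻ y, f (Function.update y 0 t) ∂(boxMeasure (0 : Fin d → ℝ)) < δ := by
  refine frequently_of_eventually_Ico hl ?_
  filter_upwards [h.eventually_lt_const (pos_iff_ne_zero.2 hδ)] with R hR
  by_contra! hcon
  rw [lintegral_slab R hf] at hR
  have : δ ≤ ∫⁻ t in Set.Ico R (R + 1),
      (∫⁻ y, f (Function.update y 0 t) ∂(boxMeasure (0 : Fin d → ℝ))) := by
    calc δ = ∫⁻ t in Set.Ico R (R + 1), δ := by simp
      _ ≤ _ := setLIntegral_mono' measurableSet_Ico hcon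
  exact absurd hR (not_lt.2 this)

lemma frequently_sliceMean {d : ℕ} [NeZero d] {f : (Fin d → ℝ) → ℝ} (hf : Continuous f) {c : ℝ}
    {l : Filter ℝ} (hl : l = atTop ∨ l = atBot)
    (h : Tendsto (fun R => ∫⁻ x, ‖f x - c‖ₑ ∂(boxMeasure (slabCorner d R))) l (𝓝 0)) {δ : ℝ}
    (hδ : 0 < δ) : ∃ᶠ t in l, |sliceMean f t - c| < δ := by
  refine (frequently_slice_lt (hf.sub continuous_const).measurable.enorm hl h
    (by simpa using hδ : ENNReal.ofReal δ ≠ 0)).mono fun t ht => ?_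
  exact (ENNReal.ofReal_lt_ofReal_iff hδ).1 ((abs_sliceMean_sub_le hf c t).trans_lt ht)

lemma avg_apply {d : ℕ} [NeZero d] {u : (Fin d → ℝ) → Fin d → ℝ} (hu : Continuous u) (t : ℝ)
    (k : Fin d) : avg u t k = sliceMean (fun x => u x k) t := by
  have hi : Integrable (fun y => u (Function.update y 0 t)) (boxMeasure (0 : Fin d → ℝ)) :=
    integrable_boxMeasure (hu.comp (continuous_id.update 0 continuous_const)) 0
  unfold avg sliceMean
  rw [← boxMeasure_zero]
  exact ((ContinuousLinearMap.proj (R := ℝ) (φ := fun _ : Fin d => ℝ) k).integral_comp_comm hi).symm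

lemma lintegral_gradSq_ne_top {d : ℕ} [NeZero d] {u : (Fin d → ℝ) → Fin d → ℝ}
    (hu : IntegrableOn (gradSq u) (strip d)) :
    ∫⁻ x in strip d, ENNReal.ofReal (gradSq u x) ≠ ⊤ :=
  ((lintegral_mono fun _ => Real.ofReal_le_enorm _).trans_lt hu.2).ne

lemma ofReal_gradSq {d : ℕ} (u : (Fin d → ℝ) → Fin d → ℝ) (x : Fin d → ℝ) :
    ENNReal.ofReal (gradSq u x) = ∑ i, ∑ j, ‖pd i u x j‖ₑ ^ 2 := by
  unfold gradSq
  rw [ENNReal.ofReal_sum_of_nonneg fun _ _ => Finset.sum_nonneg fun _ _ => sq_nonneg _]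
  refine Finset.sum_congr rfl fun i _ => ?_
  rw [ENNReal.ofReal_sum_of_nonneg fun _ _ => sq_nonneg _]
  simp_rw [enorm_sq_eq]

lemma ofReal_vnorm2 {d : ℕ} (v : Fin d → ℝ) : ENNReal.ofReal (vnorm2 v) = ∑ k, ‖v k‖ₑ ^ 2 := by
  unfold vnorm2
  rw [ENNReal.ofReal_sum_of_nonneg fun _ _ => sq_nonneg _]
  simp_rw [enorm_sq_eq]

lemma enorm_pdS_sq_le {d : ℕ} {u : (Fin d → ℝ) → Fin d → ℝ} (hu : Differentiable ℝ u)
    (i k : Fin d) (x : Fin d → ℝ) :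
    ‖pdS i (fun x => u x k) x‖ₑ ^ 2 ≤ ENNReal.ofReal (gradSq u x) := by
  rw [ofReal_gradSq, ← pd_apply hu]
  refine le_trans ?_ (Finset.single_le_sum (f := fun i => ∑ j, ‖pd i u x j‖ₑ ^ 2)
    (fun _ _ => zero_le) (Finset.mem_univ i))
  exact Finset.single_le_sum (f := fun j => ‖pd i u x j‖ₑ ^ 2)
    (fun _ _ => zero_le) (Finset.mem_univ k)

lemma sum_enorm_pdS_sq_le {d : ℕ} {u : (Fin d → ℝ) → Fin d → ℝ} (hu : Differentiable ℝ u)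
    (k : Fin d) (x : Fin d → ℝ) :
    ∑ i, ‖pdS i (fun x => u x k) x‖ₑ ^ 2 ≤ ENNReal.ofReal (gradSq u x) := by
  rw [ofReal_gradSq]
  refine Finset.sum_le_sum fun i _ => ?_
  rw [← pd_apply hu]
  exact Finset.single_le_sum (f := fun j => ‖pd i u x j‖ₑ ^ 2)
    (fun _ _ => zero_le) (Finset.mem_univ k)

lemma differentiable_component {d : ℕ} {u : (Fin d → ℝ) → Fin d → ℝ} (hu : Differentiable ℝ u)
    (k : Fin d) : Differentiable ℝ fun x => u x k :=
  fun x => differentiableAt_pi.1 (hu x) k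

lemma gradSq_sub_const {d : ℕ} (u : (Fin d → ℝ) → Fin d → ℝ) (c : Fin d → ℝ) :
    gradSq (fun x => u x - c) = gradSq u := by
  funext x
  unfold gradSq pd
  simp_rw [fderiv_sub_const]

lemma tendsto_slab_gradSq {d : ℕ} [NeZero d] {u : (Fin d → ℝ) → Fin d → ℝ} (hu : Adm d u)
    {l : Filter ℝ} (hl : l = atTop ∨ l = atBot) :
    Tendsto (fun R => ∫⁻ x, ENNReal.ofReal (gradSq u x) ∂(boxMeasure (slabCorner d R))) l (𝓝 0) :=
  tendsto_lintegral_slab (measurable_gradSq u).ennreal_ofReal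
    (lintegral_gradSq_ne_top hu.2.2.2) hl

/-- The field approaches its limiting mean in `L²` on slabs. -/
lemma tendsto_slab_vnorm2 {d : ℕ} [NeZero d] {u : (Fin d → ℝ) → Fin d → ℝ} (hu : Adm d u)
    {l : Filter ℝ} (hl : l = atTop ∨ l = atBot) {c : Fin d → ℝ} (hc : Tendsto (avg u) l (𝓝 c)) :
    Tendsto (fun R => ∫⁻ x, ENNReal.ofReal (vnorm2 (u x - c)) ∂(boxMeasure (slabCorner d R)))
      l (𝓝 0) := by
  have h : ∀ k : Fin d, Tendsto (fun R => ∫⁻ x, ‖u x k - c k‖ₑ ^ 2 ∂(boxMeasure (slabCorner d R)))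
      l (𝓝 0) := by
    intro k
    refine tendsto_lintegral_sub_sq_slab (differentiable_component hu.1 k) ?_ hl ?_
    · exact ne_top_of_le_ne_top (lintegral_gradSq_ne_top hu.2.2.2)
        (lintegral_mono fun x => sum_enorm_pdS_sq_le hu.1 k x)
    · refine (tendsto_pi_nhds.1 hc k).congr fun t => ?_
      exact avg_apply hu.1.continuous t k
  have h2 := tendsto_finsetSum Finset.univ fun k _ => h k
  rw [Finset.sum_const_zero] at h2
  refine h2.congr fun R => ?_
  rw [← lintegral_finsetSum]
  · simp_rw [ofReal_vnorm2, Pi.sub_apply]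
  · intro k _
    exact (((differentiable_component hu.1 k).continuous.measurable.sub_const _).enorm).pow_const 2

lemma tendsto_lintegral_of_sq {α ι : Type*} [MeasurableSpace α] {μ : ι → Measure α}
    [∀ i, IsProbabilityMeasure (μ i)] {f : α → ℝ≥0∞} (hf : Measurable f) {l : Filter ι}
    (h : Tendsto (fun i => ∫⁻ x, f x ^ 2 ∂(μ i)) l (𝓝 0)) :
    Tendsto (fun i => ∫⁻ x, f x ∂(μ i)) l (𝓝 0) := by
  have h2 := (ENNReal.continuous_rpow_const (y := 1 / 2)).tendsto 0 |>.comp h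
  rw [ENNReal.zero_rpow_of_pos (by norm_num)] at h2
  refine tendsto_of_tendsto_of_tendsto_of_le_of_le tendsto_const_nhds h2 (fun _ => zero_le) ?_
  intro i
  have := ENNReal.rpow_le_rpow (z := 1 / 2) (lintegral_sq_le (μ i) hf.aemeasurable) (by norm_num)
  rwa [← ENNReal.rpow_two, ← ENNReal.rpow_mul, mul_one_div_cancel two_ne_zero,
    ENNReal.rpow_one] at this

lemma abs_apply_le_sqrt_vnorm2 {d : ℕ} (v : Fin d → ℝ) (k : Fin d) : |v k| ≤ √(vnorm2 v) :=
  Real.abs_le_sqrt (Finset.single_le_sum (f := fun k => v k ^ 2) (fun _ _ => sq_nonneg _)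
    (Finset.mem_univ k))

lemma norm_le_sqrt_vnorm2 {d : ℕ} (v : Fin d → ℝ) : ‖v‖ ≤ √(vnorm2 v) :=
  (pi_norm_le_iff_of_nonneg (Real.sqrt_nonneg _)).2 fun k => abs_apply_le_sqrt_vnorm2 v k

lemma vnorm2_le {d : ℕ} (v : Fin d → ℝ) : vnorm2 v ≤ d * ‖v‖ ^ 2 := by
  unfold vnorm2
  calc ∑ i, v i ^ 2 ≤ ∑ _i : Fin d, ‖v‖ ^ 2 := by
        refine Finset.sum_le_sum fun i _ => ?_
        rw [← sq_abs]
        exact pow_le_pow_left₀ (abs_nonneg _) (norm_le_pi_norm v i) 2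
    _ = _ := by simp

/-- A function of `u` growing at most linearly in `u - c` is close in slice mean to its value
at the limit `c`. -/
lemma frequently_sliceMean_of_lipschitz {d : ℕ} [NeZero d] {u : (Fin d → ℝ) → Fin d → ℝ}
    (hu : Adm d u) {l : Filter ℝ} (hl : l = atTop ∨ l = atBot) {c : Fin d → ℝ}
    (hc : Tendsto (avg u) l (𝓝 c)) {f : (Fin d → ℝ) → ℝ} (hf : Continuous f) {K : ℝ} (hK : 0 ≤ K)
    (hle : ∀ x, |f (u x) - f c| ≤ K * √(vnorm2 (u x - c))) {δ : ℝ} (hδ : 0 < δ) :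
    ∃ᶠ t in l, |sliceMean (fun x => f (u x)) t - f c| < δ := by
  have hvm : Measurable fun x => √(vnorm2 (u x - c)) :=
    ((continuous_vnorm2.comp (hu.1.continuous.sub continuous_const)).sqrt).measurable
  refine frequently_sliceMean (hf.comp hu.1.continuous) hl ?_ hδ
  have h1 := tendsto_lintegral_of_sq (μ := fun R => boxMeasure (slabCorner d R)) hvm.ennreal_ofReal
    (l := l) (by
      simp_rw [← ENNReal.ofReal_pow (Real.sqrt_nonneg _), Real.sq_sqrt (vnorm2_nonneg _)]
      exact tendsto_slab_vnorm2 hu hl hc)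
  have h2 := ENNReal.Tendsto.const_mul (a := ENNReal.ofReal K) h1 (Or.inr ENNReal.ofReal_ne_top)
  rw [mul_zero] at h2
  refine tendsto_of_tendsto_of_tendsto_of_le_of_le tendsto_const_nhds h2 (fun _ => zero_le) ?_
  intro R
  simp only
  rw [← lintegral_const_mul _ hvm.ennreal_ofReal]
  refine lintegral_mono fun x => ?_
  rw [← ENNReal.ofReal_mul hK, ← ofReal_norm]
  exact ENNReal.ofReal_le_ofReal (hle x)

/-- The same for growth of order `2(d-1)/(d-2)` in dimension `d ≥ 3`. -/
lemma frequently_sliceMean_of_growth {d : ℕ} [NeZero d] (hd : 3 ≤ d)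
    {u : (Fin d → ℝ) → Fin d → ℝ}
    (hu : Adm d u) {l : Filter ℝ} (hl : l = atTop ∨ l = atBot) {c : Fin d → ℝ}
    (hc : Tendsto (avg u) l (𝓝 c)) {f : (Fin d → ℝ) → ℝ} (hf : Continuous f) {K : ℝ} (hK : 0 ≤ K)
    (hle : ∀ x, |f (u x) - f c| ≤ K * (√(vnorm2 (u x - c)) +
      vnorm2 (u x - c) ^ (((d : ℝ) - 1) / (d - 2)))) {δ : ℝ} (hδ : 0 < δ) :
    ∃ᶠ t in l, |sliceMean (fun x => f (u x)) t - f c| < δ := by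
  set σ : ℝ := ((d : ℝ) - 1) / (d - 2)
  have hvc : Continuous fun x => vnorm2 (u x - c) :=
    continuous_vnorm2.comp (hu.1.continuous.sub continuous_const)
  have hvm : Measurable fun x => √(vnorm2 (u x - c)) := hvc.sqrt.measurable
  refine frequently_sliceMean (hf.comp hu.1.continuous) hl ?_ hδ
  have hv := tendsto_slab_vnorm2 hu hl hc
  have h1 := tendsto_lintegral_of_sq (μ := fun R => boxMeasure (slabCorner d R)) hvm.ennreal_ofReal
    (l := l) (by
      simp_rw [← ENNReal.ofReal_pow (Real.sqrt_nonneg _), Real.sq_sqrt (vnorm2_nonneg _)]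
      exact hv)
  have h2 : Tendsto (fun R => ∫⁻ x, ENNReal.ofReal (vnorm2 (u x - c) ^ σ)
      ∂(boxMeasure (slabCorner d R))) l (𝓝 0) := by
    obtain ⟨η, hη, hG⟩ := exists_gns_small hd
    have h3 := hv.add (tendsto_slab_gradSq hu hl)
    rw [add_zero] at h3
    have h4 := (ENNReal.continuous_rpow_const (y := 1 / 2)).tendsto 0 |>.comp hv
    rw [ENNReal.zero_rpow_of_pos (by norm_num)] at h4
    refine tendsto_of_tendsto_of_tendsto_of_le_of_le' tendsto_const_nhds h4
      (Eventually.of_forall fun _ => zero_le) ?_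
    filter_upwards [h3.eventually_le_const (pos_iff_ne_zero.2 hη)] with R hR
    have h5 := hG (slabCorner d R) (fun x => u x - c) (hu.1.sub_const c) (by
      rw [gradSq_sub_const]
      simp_rw [ENNReal.ofReal_add (vnorm2_nonneg _) (gradSq_nonneg _ _)]
      rw [lintegral_add_left hvc.measurable.ennreal_ofReal]
      exact hR)
    have h6 := ENNReal.rpow_le_rpow (z := 1 / 2) h5 (by norm_num)
    rwa [← ENNReal.rpow_two, ← ENNReal.rpow_mul, mul_one_div_cancel two_ne_zero,
      ENNReal.rpow_one] at h6
  have h3 := ENNReal.Tendsto.const_mul (a := ENNReal.ofReal K) (h1.add h2)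
    (Or.inr ENNReal.ofReal_ne_top)
  rw [add_zero, mul_zero] at h3
  refine tendsto_of_tendsto_of_tendsto_of_le_of_le tendsto_const_nhds h3 (fun _ => zero_le) ?_
  intro R
  simp only
  rw [← lintegral_add_left hvm.ennreal_ofReal,
    ← lintegral_const_mul' _ _ ENNReal.ofReal_ne_top]
  refine lintegral_mono fun x => ?_
  simp only
  rw [← ENNReal.ofReal_add (Real.sqrt_nonneg _) (Real.rpow_nonneg (vnorm2_nonneg _) _),
    ← ENNReal.ofReal_mul hK, ← ofReal_norm]
  exact ENNReal.ofReal_le_ofReal (hle x)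

lemma fderiv_apply_eq_sum {d : ℕ} (g : (Fin d → ℝ) → ℝ) (x v : Fin d → ℝ) :
    fderiv ℝ g x v = ∑ i, v i * pdS i g x := by
  have h := LinearMap.pi_apply_eq_sum_univ (fderiv ℝ g x : (Fin d → ℝ) →ₗ[ℝ] ℝ) v
  simp only [ContinuousLinearMap.coe_coe, smul_eq_mul] at h
  rw [h]
  refine Finset.sum_congr rfl fun i _ => ?_
  unfold pdS
  congr 2
  ext j
  simp [Pi.single_apply, eq_comm]

lemma norm_fderiv_le_sum {d : ℕ} (g : (Fin d → ℝ) → ℝ) (x : Fin d → ℝ) :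
    ‖fderiv ℝ g x‖ ≤ ∑ i, |pdS i g x| := by
  refine ContinuousLinearMap.opNorm_le_bound _ (Finset.sum_nonneg fun _ _ => abs_nonneg _) fun v => ?_
  rw [fderiv_apply_eq_sum, Finset.sum_mul]
  refine (norm_sum_le _ _).trans (Finset.sum_le_sum fun i _ => ?_)
  rw [norm_mul, mul_comm, Real.norm_eq_abs]
  gcongr
  exact norm_le_pi_norm v i

lemma frequently_sliceMean_of_bounded {d : ℕ} [NeZero d] {u : (Fin d → ℝ) → Fin d → ℝ}
    (hu : Adm d u) {l : Filter ℝ} (hl : l = atTop ∨ l = atBot) {c : Fin d → ℝ}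
    (hc : Tendsto (avg u) l (𝓝 c)) {f : (Fin d → ℝ) → ℝ} (hf : ContDiff ℝ 1 f)
    (hb : ∃ M, ∀ x, ‖u x‖ ≤ M) {δ : ℝ} (hδ : 0 < δ) :
    ∃ᶠ t in l, |sliceMean (fun x => f (u x)) t - f c| < δ := by
  obtain ⟨M, hM⟩ := hb
  set r := max M ‖c‖
  have hfd : Continuous fun z => ‖fderiv ℝ f z‖ := (hf.continuous_fderiv one_ne_zero).norm
  obtain ⟨K, hK⟩ := (isCompact_closedBall (0 : Fin d → ℝ) r).bddAbove_image hfd.continuousOn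
  have hK' : ∀ z ∈ Metric.closedBall (0 : Fin d → ℝ) r, ‖fderiv ℝ f z‖ ≤ K := fun z hz =>
    hK ⟨z, hz, rfl⟩
  have hcm : c ∈ Metric.closedBall (0 : Fin d → ℝ) r := by simp [r]
  have hK0 : 0 ≤ K := (norm_nonneg _).trans (hK' c hcm)
  refine frequently_sliceMean_of_lipschitz hu hl hc hf.continuous hK0 (fun x => ?_) hδ
  have h := (convex_closedBall (0 : Fin d → ℝ) r).norm_image_sub_le_of_norm_fderiv_le
    (fun z _ => hf.differentiable one_ne_zero z) hK' hcm
    (mem_closedBall_zero_iff.2 ((hM x).trans (le_max_left _ _)))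
  exact h.trans (by gcongr; exact norm_le_sqrt_vnorm2 _)

/-- In dimension two the field converges uniformly along suitable slices. -/
lemma frequently_sliceMean_of_dim_two [NeZero 2] {u : (Fin 2 → ℝ) → Fin 2 → ℝ}
    (hu : Adm 2 u) {l : Filter ℝ} (hl : l = atTop ∨ l = atBot) {c : Fin 2 → ℝ}
    (hc : Tendsto (avg u) l (𝓝 c)) {f : (Fin 2 → ℝ) → ℝ} (hf : Continuous f)
    {δ : ℝ} (hδ : 0 < δ) :
    ∃ᶠ t in l, |sliceMean (fun x => f (u x)) t - f c| < δ := by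
  obtain ⟨η, hη, hcont⟩ := Metric.continuousAt_iff.1 (hf.continuousAt (x := c)) (δ / 2) (by positivity)
  set v : (Fin 2 → ℝ) → Fin 2 → ℝ := fun x => u x - c with hv
  have hvd : Differentiable ℝ v := hu.1.sub_const c
  have hvk := fun k => differentiable_component hvd k
  set q : (Fin 2 → ℝ) → ℝ≥0∞ := fun x => ∑ k, (‖v x k‖ₑ + ‖pdS 1 (fun x => v x k) x‖ₑ) with hq
  have hm1 : ∀ k, Measurable fun x => ‖v x k‖ₑ := fun k => (hvk k).continuous.measurable.enorm
  have hm2 : ∀ k, Measurable fun x => ‖pdS 1 (fun x => v x k) x‖ₑ := fun k =>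
    (measurable_pdS _ _).enorm
  have hm : ∀ k, Measurable fun x => ‖v x k‖ₑ + ‖pdS 1 (fun x => v x k) x‖ₑ := fun k =>
    (hm1 k).add (hm2 k)
  have hqm : Measurable q := Finset.measurable_sum _ fun k _ => hm k
  have hq0 : Tendsto (fun R => ∫⁻ x, q x ∂(boxMeasure (slabCorner 2 R))) l (𝓝 0) := by
    have h1 : ∀ k, Tendsto (fun R => ∫⁻ x, ‖v x k‖ₑ ∂(boxMeasure (slabCorner 2 R))) l (𝓝 0) := by
      intro k
      refine tendsto_lintegral_of_sq (μ := fun R => boxMeasure (slabCorner 2 R)) (hm1 k) ?_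
      refine tendsto_of_tendsto_of_tendsto_of_le_of_le tendsto_const_nhds
        (tendsto_slab_vnorm2 hu hl hc) (fun _ => zero_le) fun R => lintegral_mono fun x => ?_
      simp only
      rw [ofReal_vnorm2]
      exact Finset.single_le_sum (f := fun k => ‖v x k‖ₑ ^ 2) (fun _ _ => zero_le)
        (Finset.mem_univ k)
    have h2 : ∀ k, Tendsto (fun R => ∫⁻ x, ‖pdS 1 (fun x => v x k) x‖ₑ
        ∂(boxMeasure (slabCorner 2 R))) l (𝓝 0) := by
      intro k
      refine tendsto_lintegral_of_sq (μ := fun R => boxMeasure (slabCorner 2 R)) (hm2 k) ?_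
      refine tendsto_of_tendsto_of_tendsto_of_le_of_le tendsto_const_nhds
        (tendsto_slab_gradSq hu hl) (fun _ => zero_le) fun R => lintegral_mono fun x => ?_
      have := enorm_pdS_sq_le hvd 1 k x
      rwa [hv, gradSq_sub_const] at this
    have h3 := tendsto_finsetSum Finset.univ fun k _ => (h1 k).add (h2 k)
    simp only [add_zero, Finset.sum_const_zero] at h3
    refine h3.congr fun R => ?_
    rw [hq, lintegral_finsetSum _ fun k _ => hm k]
    exact Finset.sum_congr rfl fun k _ => (lintegral_add_left (hm1 k) _).symm
  refine (frequently_slice_lt hqm hl hq0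
    (by simpa using hη : ENNReal.ofReal η ≠ 0)).mono fun t ht => ?_
  have hupd : ∀ y z : Fin 2 → ℝ, ∀ r, Function.update (Function.update y 1 r) 0 t =
      Function.update (Function.update z 0 t) 1 r := by
    intro y z r
    ext j
    fin_cases j <;> simp
  have hsmall : ∀ y ∈ unitBox (0 : Fin 2 → ℝ), ‖v (Function.update y 0 t)‖ < η := by
    intro y hy
    have hk : ∀ k, ‖v (Function.update y 0 t) k‖ₑ < ENNReal.ofReal η := by
      intro k
      refine lt_of_le_of_lt ?_ ht
      refine (enorm_le_lintegral_line (hvk k) (Function.update y 0 t) 1 (c := 0)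
        (by simpa using hy 1 trivial)).trans ?_
      have hqmt : Measurable fun y => q (Function.update y 0 t) :=
        hqm.comp (continuous_id.update 0 continuous_const).measurable
      rw [lintegral_boxMeasure 0 1 hqmt]
      simp_rw [fun z r => hupd z y r]
      rw [lintegral_const, measure_univ, mul_one]
      refine lintegral_mono fun r => ?_
      exact Finset.single_le_sum (f := fun k => ‖v (Function.update (Function.update y 0 t) 1 r) k‖ₑ
        + ‖pdS 1 (fun x => v x k) (Function.update (Function.update y 0 t) 1 r)‖ₑ)
        (fun _ _ => zero_le) (Finset.mem_univ k)
    refine (pi_norm_lt_iff hη).2 fun k => ?_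
    have := hk k
    rw [← ofReal_norm] at this
    exact (ENNReal.ofReal_lt_ofReal_iff hη).1 this
  have h := abs_sliceMean_sub_le (hf.comp hu.1.continuous) (f c) t
  have h2 : ∫⁻ y, ‖(f ∘ u) (Function.update y 0 t) - f c‖ₑ ∂(boxMeasure (0 : Fin 2 → ℝ)) ≤
      ENNReal.ofReal (δ / 2) := by
    calc _ ≤ ∫⁻ _y, ENNReal.ofReal (δ / 2) ∂(boxMeasure (0 : Fin 2 → ℝ)) := by
          refine lintegral_mono_ae ?_
          filter_upwards [ae_mem_unitBox 0] with y hy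
          have h3 := hsmall y hy
          have h4 := hcont (x := u (Function.update y 0 t)) (by rwa [dist_eq_norm])
          rw [← ofReal_norm]
          exact ENNReal.ofReal_le_ofReal (by rw [← dist_eq_norm]; exact h4.le)
      _ = _ := by simp
  have h5 := (ENNReal.ofReal_le_ofReal_iff (by positivity)).1 (h.trans h2)
  exact lt_of_le_of_lt h5 (by linarith)

lemma pd_add_mul_invariant {d : ℕ} [NeZero d] {Φ : (Fin d → ℝ) → Fin d → ℝ}
    (hΦ : Differentiable ℝ Φ) (hsym : ∀ z, ∀ i j : Fin d, pd i Φ z j = pd j Φ z i)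
    (hdiag : ∀ z, ∀ i j : Fin d, pd i Φ z i = pd j Φ z j) (i : Fin d) {ε : ℝ} (hε : ε ^ 2 = 1)
    (t : ℝ) (z : Fin d → ℝ) :
    pd 0 Φ (z + t • (Pi.single 0 1 - ε • Pi.single i 1)) 0 +
        ε * pd 0 Φ (z + t • (Pi.single 0 1 - ε • Pi.single i 1)) i =
      pd 0 Φ z 0 + ε * pd 0 Φ z i := by
  set w : Fin d → ℝ := Pi.single 0 1 - ε • Pi.single i 1 with hw
  set ψ : (Fin d → ℝ) → ℝ := fun z => Φ z 0 + ε * Φ z i with hψ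
  have hψd : ∀ z, HasFDerivAt ψ ((ContinuousLinearMap.proj 0).comp (fderiv ℝ Φ z) +
      ε • (ContinuousLinearMap.proj i).comp (fderiv ℝ Φ z)) z := fun z =>
    (hasFDerivAt_pi'.1 (hΦ z).hasFDerivAt 0).add
      ((hasFDerivAt_pi'.1 (hΦ z).hasFDerivAt i).const_smul ε)
  have hpd : ∀ z, fderiv ℝ ψ z (Pi.single 0 1) = pd 0 Φ z 0 + ε * pd 0 Φ z i := fun z => by
    rw [(hψd z).fderiv]; simp [pd]
  have hw0 : ∀ z, fderiv ℝ ψ z w = 0 := fun z => by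
    have h1 := hsym z 0 i
    have h2 := hdiag z 0 i
    rw [(hψd z).fderiv, hw, map_sub, map_smul]
    simp only [pd] at h1 h2
    simp [h1, h2]
    linear_combination (-(fderiv ℝ Φ z) (Pi.single i 1) i) * hε
  have hconst : ∀ z, ψ (z + t • w) = ψ z := fun z => by
    have hline : ∀ s : ℝ, HasDerivAt (fun s : ℝ => ψ (z + s • w)) 0 s := fun s => by
      have h1 : HasDerivAt (fun s : ℝ => z + s • w) w s := by
        simpa using ((hasDerivAt_id s).smul_const w).const_add z
      have h2 := (hψd (z + s • w)).differentiableAt.hasFDerivAt.comp_hasDerivAt s h1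
      rwa [hw0] at h2
    have := is_const_of_deriv_eq_zero (fun s => (hline s).differentiableAt)
      (fun s => (hline s).deriv) t 0
    simpa using this
  have h3 : fderiv ℝ ψ (z + t • w) = fderiv ℝ ψ z := by
    rw [← fderiv_comp_add_right]
    congr 1
    exact funext hconst
  rw [← hpd, ← hpd, h3]

/-- The common diagonal entry of the Jacobian is controlled by the off-diagonal ones. -/
lemma abs_pd_diag_le {d : ℕ} [NeZero d] (hd : 2 ≤ d) {Φ : (Fin d → ℝ) → Fin d → ℝ}
    (hΦ : Differentiable ℝ Φ) (hsym : ∀ z, ∀ i j : Fin d, pd i Φ z j = pd j Φ z i)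
    (hdiag : ∀ z, ∀ i j : Fin d, pd i Φ z i = pd j Φ z j) {r B : ℝ}
    (hB : ∀ z, ‖z‖ ≤ r → ∀ i ≠ 0, |pd 0 Φ z i| ≤ B) {z : Fin d → ℝ}
    (hz : (2 * d + 1) * ‖z‖ ≤ r) :
    |pd 0 Φ z 0| ≤ |pd 0 Φ 0 0| + (2 * d + 4) * B := by
  have hstep : ∀ (i : Fin d), i ≠ 0 → ∀ (ε : ℝ), ε ^ 2 = 1 → ∀ (t : ℝ) (y : Fin d → ℝ), ‖y‖ ≤ r →
      ‖y + t • (Pi.single 0 1 - ε • Pi.single i 1)‖ ≤ r →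
      |pd 0 Φ (y + t • (Pi.single 0 1 - ε • Pi.single i 1)) 0 - pd 0 Φ y 0| ≤ 2 * B := by
    intro i hi ε hε t y hy hy2
    have h1 := pd_add_mul_invariant hΦ hsym hdiag i hε t y
    have h2 := hB _ hy i hi
    have h3 := hB _ hy2 i hi
    have hε1 : |ε| = 1 := by
      rwa [← sq_abs, pow_eq_one_iff_of_nonneg (abs_nonneg _) two_ne_zero] at hε
    have h4 : pd 0 Φ (y + t • (Pi.single 0 1 - ε • Pi.single i 1)) 0 - pd 0 Φ y 0 =
        ε * (pd 0 Φ y i - pd 0 Φ (y + t • (Pi.single 0 1 - ε • Pi.single i 1)) i) := by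
      linear_combination h1
    rw [h4, abs_mul, hε1, one_mul]
    exact (abs_sub _ _).trans (by linarith)
  have hsingle : ∀ i : Fin d, ‖(Pi.single i 1 : Fin d → ℝ)‖ = 1 := fun i => by
    rw [Pi.norm_single]; simp
  have hnz : ∀ i, |z i| ≤ ‖z‖ := fun i => norm_le_pi_norm z i
  have hw1 : ∀ i : Fin d, ‖z i • ((Pi.single 0 1 : Fin d → ℝ) - (1 : ℝ) • Pi.single i 1)‖ ≤
      2 * ‖z‖ := by
    intro i
    rw [norm_smul, mul_comm, Real.norm_eq_abs, one_smul]
    gcongr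
    · exact (norm_sub_le _ _).trans (by rw [hsingle, hsingle]; norm_num)
    · exact hnz i
  have hB0 : 0 ≤ B := by
    have h0 : (0 : ℝ) ≤ r := le_trans (by positivity) hz
    exact (abs_nonneg _).trans (hB 0 (by simpa using h0) ⟨1, by lia⟩
      (by rw [Ne, Fin.ext_iff]; simp))
  have hnorm : ∀ s : Finset (Fin d),
      ‖z + ∑ i ∈ s, z i • ((Pi.single 0 1 : Fin d → ℝ) - (1 : ℝ) • Pi.single i 1)‖ ≤ r := by
    intro s
    refine le_trans (norm_add_le _ _) (le_trans ?_ hz)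
    have h1 : ‖∑ i ∈ s, z i • ((Pi.single 0 1 : Fin d → ℝ) - (1 : ℝ) • Pi.single i 1)‖ ≤
        s.card * (2 * ‖z‖) := by
      refine (norm_sum_le_of_le s fun i _ => hw1 i).trans ?_
      simp
    have h2 : (s.card : ℝ) ≤ d := by
      exact_mod_cast (Finset.card_le_univ s).trans (by simp)
    nlinarith [norm_nonneg z]
  have hind : ∀ s : Finset (Fin d), 0 ∉ s →
      |pd 0 Φ (z + ∑ i ∈ s, z i • ((Pi.single 0 1 : Fin d → ℝ) - (1 : ℝ) • Pi.single i 1)) 0 -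
        pd 0 Φ z 0| ≤ s.card * (2 * B) := by
    intro s
    induction s using Finset.induction_on with
    | empty => simp
    | insert i s hi ih =>
      intro h0
      rw [Finset.mem_insert, not_or] at h0
      have h1 := ih h0.2
      have h2 := hnorm (insert i s)
      rw [Finset.sum_insert hi, add_left_comm, add_comm] at h2 ⊢
      have h3 := hstep i (Ne.symm h0.1) 1 (by norm_num) (z i) _ (hnorm s) h2
      rw [Finset.card_insert_of_notMem hi]
      push_cast
      refine (abs_sub_le _ (pd 0 Φ (z + ∑ i ∈ s, z i • ((Pi.single 0 1 : Fin d → ℝ) -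
        (1 : ℝ) • Pi.single i 1)) 0) _).trans ?_
      linarith
  set S : ℝ := ∑ i, z i with hS
  have hend : z + ∑ i ∈ Finset.univ.erase 0, z i • ((Pi.single 0 1 : Fin d → ℝ) -
      (1 : ℝ) • Pi.single i 1) = S • Pi.single 0 1 := by
    have h1 : ∑ i ∈ Finset.univ.erase 0, z i • ((Pi.single 0 1 : Fin d → ℝ) -
        (1 : ℝ) • Pi.single i 1) = ∑ i, z i • ((Pi.single 0 1 : Fin d → ℝ) -
        (1 : ℝ) • Pi.single i 1) := by
      rw [← Finset.add_sum_erase _ _ (Finset.mem_univ 0)]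
      simp
    rw [h1]
    simp_rw [smul_sub, Finset.sum_sub_distrib, ← Finset.sum_smul, one_smul]
    rw [← pi_eq_sum_univ' z]
    abel
  have hSd : |S| ≤ d * ‖z‖ := by
    refine (Finset.abs_sum_le_sum_abs _ _).trans ?_
    refine (Finset.sum_le_sum fun i _ => hnz i).trans ?_
    simp
  have hSr : |S| ≤ r := hSd.trans (le_trans (by nlinarith [norm_nonneg z]) hz)
  have h1 := hind (Finset.univ.erase 0) (by simp)
  rw [hend] at h1
  have hcard : (((Finset.univ : Finset (Fin d)).erase 0).card : ℝ) ≤ d := by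
    exact_mod_cast (Finset.card_le_univ _).trans (by simp)
  set i₁ : Fin d := ⟨1, by lia⟩
  have hi₁ : i₁ ≠ 0 := by rw [Ne, Fin.ext_iff]; simp [i₁]
  have hmid : S • (Pi.single 0 1 : Fin d → ℝ) +
      (-(S / 2)) • (Pi.single 0 1 - (1 : ℝ) • Pi.single i₁ 1) =
      (S / 2) • Pi.single 0 1 + (S / 2) • Pi.single i₁ 1 := by
    module
  have hmid2 : ((S / 2) • Pi.single 0 1 + (S / 2) • Pi.single i₁ 1 : Fin d → ℝ) +
      (-(S / 2)) • (Pi.single 0 1 - (-1 : ℝ) • Pi.single i₁ 1) = 0 := by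
    module
  have hmidr : ‖((S / 2) • Pi.single 0 1 + (S / 2) • Pi.single i₁ 1 : Fin d → ℝ)‖ ≤ r := by
    refine (norm_add_le _ _).trans ?_
    rw [norm_smul, norm_smul, hsingle, hsingle, Real.norm_eq_abs, abs_div, abs_two]
    linarith
  have h2 := hstep i₁ hi₁ 1 (by norm_num) (-(S / 2)) (S • Pi.single 0 1)
    (by rw [norm_smul, hsingle, mul_one]; exact hSr) (by rw [hmid]; exact hmidr)
  rw [hmid] at h2
  have h3 := hstep i₁ hi₁ (-1) (by norm_num) (-(S / 2)) _ hmidr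
    (by rw [hmid2, norm_zero]; exact (abs_nonneg S).trans hSr)
  rw [hmid2] at h3
  have h4 : (((Finset.univ : Finset (Fin d)).erase 0).card : ℝ) * (2 * B) ≤ d * (2 * B) := by
    gcongr
  have h5 := abs_le.1 h1
  have h6 := abs_le.1 h2
  have h7 := abs_le.1 h3
  have h8 := abs_le.1 (le_refl |pd 0 Φ 0 0|)
  rw [abs_le]
  constructor <;> linarith [h5.1, h5.2, h6.1, h6.2, h7.1, h7.2, h8.1, h8.2]

lemma sq_pd_le_two_mul {d : ℕ} {Φ : (Fin d → ℝ) → Fin d → ℝ}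
    (hsym : ∀ z, ∀ i j : Fin d, pd i Φ z j = pd j Φ z i) {W : (Fin d → ℝ) → ℝ}
    (hW : ∀ z, W z = (1 / 2) * ∑ i, ∑ j, if i < j then (pd i Φ z j) ^ 2 else 0)
    {i j : Fin d} (hij : i ≠ j) (z : Fin d → ℝ) : pd i Φ z j ^ 2 ≤ 2 * W z := by
  have h : ∀ i j : Fin d, i < j → pd i Φ z j ^ 2 ≤ 2 * W z := fun i j hlt => by
    rw [hW, ← mul_assoc, mul_one_div_cancel two_ne_zero, one_mul]
    have hnn : ∀ i j : Fin d, 0 ≤ if i < j then (pd i Φ z j) ^ 2 else 0 := fun i j => by positivity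
    calc pd i Φ z j ^ 2 = if i < j then (pd i Φ z j) ^ 2 else 0 := by rw [if_pos hlt]
      _ ≤ ∑ j, if i < j then (pd i Φ z j) ^ 2 else 0 :=
          Finset.single_le_sum (f := fun j => if i < j then (pd i Φ z j) ^ 2 else 0)
            (fun j _ => hnn i j) (Finset.mem_univ j)
      _ ≤ _ := Finset.single_le_sum (f := fun i => ∑ j, if i < j then (pd i Φ z j) ^ 2 else 0)
            (fun i _ => Finset.sum_nonneg fun j _ => hnn i j) (Finset.mem_univ i)
  rcases lt_or_gt_of_ne hij with h1 | h1
  · exact h i j h1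
  · rw [hsym]
    exact h j i h1

lemma exists_norm_fderiv_le_of_growth {d : ℕ} [NeZero d] (hd : 3 ≤ d)
    {Φ : (Fin d → ℝ) → Fin d → ℝ} (hΦ : Differentiable ℝ Φ)
    (hsym : ∀ z, ∀ i j : Fin d, pd i Φ z j = pd j Φ z i)
    (hdiag : ∀ z, ∀ i j : Fin d, pd i Φ z i = pd j Φ z j) {W : (Fin d → ℝ) → ℝ}
    (hW : ∀ z, W z = (1 / 2) * ∑ i, ∑ j, if i < j then (pd i Φ z j) ^ 2 else 0)
    (hG : GrowthG d W) :
    ∃ K, 0 ≤ K ∧ ∀ z r, ‖z‖ ≤ r →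
      ‖fderiv ℝ (fun z => Φ z 0) z‖ ≤ K * (1 + r ^ ((d : ℝ) / (d - 2))) := by
  obtain ⟨C, hC, hWC⟩ := hG.2 hd
  have hd3 : (3 : ℝ) ≤ d := by exact_mod_cast hd
  set p : ℝ := (d : ℝ) / (d - 2)
  have hp : 0 ≤ p := by
    have : (0 : ℝ) < d - 2 := by linarith
    positivity
  set D : ℝ := √d * (2 * d + 1) with hD
  set B : ℝ → ℝ := fun r => √(2 * C) * (1 + (√d * r) ^ p) with hB
  have hoff : ∀ z r, ‖z‖ ≤ r → ∀ i j : Fin d, i ≠ j → |pd i Φ z j| ≤ B r := by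
    intro z r hz i j hij
    have hr : 0 ≤ r := (norm_nonneg z).trans hz
    have h1 : vnorm2 z ≤ (√d * r) ^ 2 := by
      rw [mul_pow, Real.sq_sqrt (by positivity)]
      exact (vnorm2_le z).trans (by gcongr)
    have h2 : vnorm2 z ^ p ≤ ((√d * r) ^ p) ^ 2 := by
      refine (Real.rpow_le_rpow (vnorm2_nonneg z) h1 hp).trans (le_of_eq ?_)
      rw [← Real.rpow_natCast, ← Real.rpow_natCast, ← Real.rpow_mul (by positivity),
        ← Real.rpow_mul (by positivity), mul_comm p]
    have h3 : (0 : ℝ) ≤ (√d * r) ^ p := by positivity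
    have h4 : pd i Φ z j ^ 2 ≤ B r ^ 2 := by
      refine (sq_pd_le_two_mul hsym hW hij z).trans ?_
      rw [hB, mul_pow, Real.sq_sqrt (by positivity), mul_assoc]
      gcongr
      refine (hWC z).trans ?_
      gcongr
      nlinarith
    exact abs_le_of_sq_le_sq h4 (by positivity)
  refine ⟨|pd 0 Φ 0 0| + (3 * d + 4) * √(2 * C) * (1 + D ^ p), by positivity, fun z r hz => ?_⟩
  have hr : 0 ≤ r := (norm_nonneg z).trans hz
  have hmono : B r ≤ B ((2 * d + 1) * r) := by
    simp only [hB]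
    gcongr
    nlinarith
  have h1 : ∀ i, |pdS i (fun z => Φ z 0) z| ≤
      (if i = 0 then |pd 0 Φ z 0| else 0) + B ((2 * d + 1) * r) := by
    intro i
    rw [← pd_apply hΦ]
    split_ifs with hi
    · subst hi
      have : 0 ≤ B ((2 * d + 1) * r) := by positivity
      linarith
    · rw [zero_add]
      exact (hoff z r hz i 0 hi).trans hmono
  have h2 : |pd 0 Φ z 0| ≤ |pd 0 Φ 0 0| + (2 * d + 4) * B ((2 * d + 1) * r) :=
    abs_pd_diag_le (by lia) hΦ hsym hdiag (fun z hz i hi => hoff z _ hz 0 i hi.symm)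
      (by gcongr)
  have h3 : B ((2 * d + 1) * r) ≤ √(2 * C) * ((1 + D ^ p) * (1 + r ^ p)) := by
    simp only [hB]
    gcongr
    rw [← mul_assoc, Real.mul_rpow (by positivity) hr]
    have : 0 ≤ D ^ p := by positivity
    have : 0 ≤ r ^ p := by positivity
    nlinarith
  have h4 : 0 ≤ r ^ p := by positivity
  calc ‖fderiv ℝ (fun z => Φ z 0) z‖ ≤ ∑ i, |pdS i (fun z => Φ z 0) z| := norm_fderiv_le_sum _ _
    _ ≤ ∑ i, ((if i = 0 then |pd 0 Φ z 0| else 0) + B ((2 * d + 1) * r)) :=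
        Finset.sum_le_sum fun i _ => h1 i
    _ = |pd 0 Φ z 0| + d * B ((2 * d + 1) * r) := by simp [Finset.sum_add_distrib]
    _ ≤ |pd 0 Φ 0 0| + (3 * d + 4) * B ((2 * d + 1) * r) := by linarith
    _ ≤ |pd 0 Φ 0 0| * (1 + r ^ p) +
        (3 * d + 4) * (√(2 * C) * ((1 + D ^ p) * (1 + r ^ p))) := by
        gcongr
        exact le_mul_of_one_le_right (abs_nonneg _) (by linarith)
    _ = _ := by ring

/-- Along suitable slices the flux `Φ₁(u)` converges to its value at the limiting state. -/
lemma frequently_sliceMean_flux {d : ℕ} [NeZero d] (hd : 2 ≤ d)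
    {Φ : (Fin d → ℝ) → Fin d → ℝ} (hΦ : ContDiff ℝ 1 Φ)
    (hsym : ∀ z, ∀ i j : Fin d, pd i Φ z j = pd j Φ z i)
    (hdiag : ∀ z, ∀ i j : Fin d, pd i Φ z i = pd j Φ z j) {W : (Fin d → ℝ) → ℝ}
    (hW : ∀ z, W z = (1 / 2) * ∑ i, ∑ j, if i < j then (pd i Φ z j) ^ 2 else 0)
    {u : (Fin d → ℝ) → Fin d → ℝ} (hu : Adm d u)
    (hside : (∃ M, ∀ x, ‖u x‖ ≤ M) ∨ GrowthG d W)
    {l : Filter ℝ} (hl : l = atTop ∨ l = atBot) {c : Fin d → ℝ} (hc : Tendsto (avg u) l (𝓝 c))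
    {δ : ℝ} (hδ : 0 < δ) :
    ∃ᶠ t in l, |sliceMean (fun x => Φ (u x) 0) t - Φ c 0| < δ := by
  have hΦ0 : ContDiff ℝ 1 fun z => Φ z 0 := contDiff_pi.1 hΦ 0
  rcases hside with hb | hG
  · exact frequently_sliceMean_of_bounded hu hl hc hΦ0 hb hδ
  rcases hd.eq_or_lt with rfl | hd3
  · exact frequently_sliceMean_of_dim_two hu hl hc hΦ0.continuous hδ
  have hd3 : 3 ≤ d := hd3
  have hdr : (3 : ℝ) ≤ d := by exact_mod_cast hd3
  have hd2 : (0 : ℝ) < d - 2 := by linarith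
  obtain ⟨K, hK, hKle⟩ := exists_norm_fderiv_le_of_growth hd3 (hΦ.differentiable one_ne_zero)
    hsym hdiag hW hG
  set p : ℝ := (d : ℝ) / (d - 2) with hp
  have hp0 : 0 ≤ p := by positivity
  refine frequently_sliceMean_of_growth hd3 hu hl hc hΦ0.continuous
    (K := K * (1 + 2 ^ p * ‖c‖ ^ p) + K * 2 ^ p) (by positivity) (fun x => ?_) hδ
  set r := ‖u x - c‖ with hr
  have hr0 : 0 ≤ r := norm_nonneg _
  have hball : ∀ z ∈ Metric.closedBall c r,
      ‖fderiv ℝ (fun z => Φ z 0) z‖ ≤ K * (1 + (‖c‖ + r) ^ p) := by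
    intro z hz
    refine hKle z _ ?_
    rw [mem_closedBall_iff_norm] at hz
    calc ‖z‖ = ‖c + (z - c)‖ := by rw [add_sub_cancel]
      _ ≤ _ := (norm_add_le _ _).trans (by gcongr)
  have h := (convex_closedBall c r).norm_image_sub_le_of_norm_fderiv_le
    (fun z _ => hΦ0.differentiable one_ne_zero z) hball (Metric.mem_closedBall_self hr0)
    (mem_closedBall_iff_norm.2 le_rfl)
  have hsum : (‖c‖ + r) ^ p ≤ 2 ^ p * ‖c‖ ^ p + 2 ^ p * r ^ p := by
    have hmax : ‖c‖ + r ≤ 2 * max ‖c‖ r := by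
      linarith [le_max_left ‖c‖ r, le_max_right ‖c‖ r]
    refine (Real.rpow_le_rpow (by positivity) hmax hp0).trans ?_
    rw [Real.mul_rpow two_pos.le (by positivity)]
    have h1 : 0 ≤ (2 : ℝ) ^ p * ‖c‖ ^ p := by positivity
    have h2 : 0 ≤ (2 : ℝ) ^ p * r ^ p := by positivity
    rcases max_choice ‖c‖ r with h3 | h3 <;> rw [h3] <;> linarith
  set s := √(vnorm2 (u x - c)) with hs
  have hs0 : 0 ≤ s := Real.sqrt_nonneg _
  have hrs : r ≤ s := norm_le_sqrt_vnorm2 _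
  have hpow : s ^ p * s = vnorm2 (u x - c) ^ (((d : ℝ) - 1) / (d - 2)) := by
    have h1 : s ^ p * s = s ^ (p + 1) := by
      rw [Real.rpow_add_one' hs0 (by positivity)]
    rw [h1, hs, Real.sqrt_eq_rpow, ← Real.rpow_mul (vnorm2_nonneg _)]
    congr 1
    rw [hp]
    field_simp
    ring
  rw [Real.norm_eq_abs] at h
  have hA : 0 ≤ s ^ p * s := by positivity
  calc |Φ (u x) 0 - Φ c 0| ≤ K * (1 + (‖c‖ + r) ^ p) * r := h
    _ ≤ K * (1 + (2 ^ p * ‖c‖ ^ p + 2 ^ p * r ^ p)) * r := by gcongr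
    _ ≤ K * (1 + (2 ^ p * ‖c‖ ^ p + 2 ^ p * s ^ p)) * s := by gcongr
    _ = K * (1 + 2 ^ p * ‖c‖ ^ p) * s + K * 2 ^ p * (s ^ p * s) := by ring
    _ ≤ _ := by
      rw [← hpow]
      have h1 : 0 ≤ K * (1 + 2 ^ p * ‖c‖ ^ p) * (s ^ p * s) := by positivity
      have h2 : 0 ≤ K * 2 ^ p * s := by positivity
      linarith

lemma lintegral_Ico_periodic {φ : ℝ → ℝ≥0∞} (hper : Function.Periodic φ 1) (τ : ℝ) :
    ∫⁻ t in Set.Ico (0 : ℝ) 1, φ (t + τ) = ∫⁻ t in Set.Ico (0 : ℝ) 1, φ t := by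
  have h1 : ∫⁻ t in Set.Ico (0 : ℝ) 1, φ (t + τ) = ∫⁻ t in Set.Ico τ (τ + 1), φ t := by
    have h := (measurePreserving_add_right volume τ).setLIntegral_comp_preimage_emb
      (measurableEmbedding_addRight τ) φ (Set.Ico τ (τ + 1))
    rw [← h]
    congr 2
    ext x
    simp [add_comm τ 1]
  have h2 := (isAddFundamentalDomain_Ioc one_pos τ).setLIntegral_eq
    (isAddFundamentalDomain_Ioc one_pos 0) φ fun g x => by
      obtain ⟨g, n, rfl⟩ := g
      have := hper.zsmul n x
      simpa [add_comm] using this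
  rw [h1, setLIntegral_congr Ico_ae_eq_Ioc, h2, zero_add, setLIntegral_congr Ico_ae_eq_Ioc]

lemma add_smul_single_eq_update {d : ℕ} (x : Fin d → ℝ) (i : Fin d) (τ : ℝ) :
    x + τ • Pi.single i 1 = Function.update x i (x i + τ) := by
  ext j
  by_cases hj : j = i
  · subst hj; simp
  · simp [hj]

/-- The integral over the strip of a periodic function is invariant under translations. -/
lemma lintegral_strip_translate {d : ℕ} [NeZero d] {f : (Fin d → ℝ) → ℝ≥0∞} (hf : Measurable f)
    (hper : ∀ x, ∀ i : Fin d, i ≠ 0 → f (x + Pi.single i 1) = f x) (i : Fin d) (τ : ℝ) :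
    ∫⁻ x in strip d, f (x + τ • Pi.single i 1) = ∫⁻ x in strip d, f x := by
  by_cases hi : i = 0
  · subst hi
    have h := (measurePreserving_add_right volume
      (τ • Pi.single 0 1 : Fin d → ℝ)).setLIntegral_comp_preimage_emb
      (measurableEmbedding_addRight _) f (strip d)
    rw [← h]
    congr 2
    ext x
    simp +contextual [strip]
  · have hm : Measurable fun x => f (x + τ • Pi.single i 1) := hf.comp (measurable_add_const _)
    rw [lintegral_strip_line hm hi, lintegral_strip_line hf hi]
    refine lintegral_congr fun x => ?_
    have hφ : Function.Periodic (fun t => f (Function.update x i t)) 1 := fun t => by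
      have := hper (Function.update x i t) i hi
      rw [← one_smul ℝ (Pi.single i 1), add_smul_single_eq_update] at this
      simpa using this
    rw [← lintegral_Ico_periodic hφ τ]
    refine lintegral_congr fun t => ?_
    simp only [add_smul_single_eq_update]
    simp

/-- Difference quotient in a coordinate direction. -/
def diffQuot {d : ℕ} (i : Fin d) (h : ℝ) (g : (Fin d → ℝ) → ℝ) (x : Fin d → ℝ) : ℝ :=
  h⁻¹ * (g (x + h • Pi.single i 1) - g x)

lemma differentiable_diffQuot {d : ℕ} (i : Fin d) (h : ℝ) {g : (Fin d → ℝ) → ℝ}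
    (hg : Differentiable ℝ g) : Differentiable ℝ (diffQuot i h g) :=
  ((hg.comp (differentiable_id.add_const _)).sub hg).const_mul _

lemma pdS_diffQuot {d : ℕ} (i j : Fin d) (h : ℝ) {g : (Fin d → ℝ) → ℝ} (hg : Differentiable ℝ g)
    (x : Fin d → ℝ) : pdS j (diffQuot i h g) x = diffQuot i h (pdS j g) x := by
  have h1 : HasFDerivAt (fun x => g (x + h • Pi.single i 1))
      (fderiv ℝ g (x + h • Pi.single i 1)) x := by
    have := (hg (x + h • Pi.single i 1)).hasFDerivAt.comp x ((hasFDerivAt_id x).add_const _)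
    simpa [Function.comp_def] using this
  have h2 : HasFDerivAt (diffQuot i h g) (h⁻¹ • (fderiv ℝ g (x + h • Pi.single i 1) - fderiv ℝ g x)) x :=
    (h1.sub (hg x).hasFDerivAt).const_smul h⁻¹
  rw [pdS, h2.fderiv]
  rfl

lemma tendsto_diffQuot {d : ℕ} (i : Fin d) {g : (Fin d → ℝ) → ℝ} (hg : Differentiable ℝ g)
    (x : Fin d → ℝ) : Tendsto (fun n : ℕ => diffQuot i (1 / ((n : ℝ) + 1)) g x) atTop
      (𝓝 (pdS i g x)) := by
  have h1 : HasDerivAt (fun t : ℝ => g (x + t • Pi.single i 1)) (pdS i g x) 0 := by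
    have h2 : HasDerivAt (fun t : ℝ => x + t • (Pi.single i 1 : Fin d → ℝ)) (Pi.single i 1) 0 := by
      simpa using ((hasDerivAt_id (0 : ℝ)).smul_const (Pi.single i 1 : Fin d → ℝ)).const_add x
    have h3 := (hg (x + (0 : ℝ) • Pi.single i 1)).hasFDerivAt.comp_hasDerivAt 0 h2
    simpa [pdS, Function.comp_def] using h3
  have h4 := h1.tendsto_slope_zero
  have h5 : Tendsto (fun n : ℕ => 1 / ((n : ℝ) + 1)) atTop (𝓝[≠] 0) :=
    tendsto_nhdsWithin_iff.2 ⟨tendsto_one_div_add_atTop_nhds_zero_nat,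
      Eventually.of_forall fun n => by simpa using (Nat.cast_add_one_ne_zero n)⟩
  refine (h4.comp h5).congr fun n => ?_
  simp [diffQuot]

lemma lintegral_sq_diffQuot_le {d : ℕ} [NeZero d] {g : (Fin d → ℝ) → ℝ}
    (hg : Differentiable ℝ g) (hper : ∀ x, ∀ i : Fin d, i ≠ 0 → g (x + Pi.single i 1) = g x)
    (i : Fin d) {h : ℝ} (h0 : 0 < h) :
    ∫⁻ x in strip d, ‖diffQuot i h g x‖ₑ ^ 2 ≤ ∫⁻ x in strip d, ‖pdS i g x‖ₑ ^ 2 := by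
  have hm := measurable_pdS i g
  set q : (Fin d → ℝ) → ℝ≥0∞ := fun x => ‖pdS i g x‖ₑ ^ 2 with hq
  have hqm : Measurable q := hm.enorm.pow_const 2
  have hqper : ∀ x, ∀ j : Fin d, j ≠ 0 → q (x + Pi.single j 1) = q x := by
    intro x j hj
    have : fderiv ℝ g (x + Pi.single j 1) = fderiv ℝ g x := by
      rw [← fderiv_comp_add_right]
      congr 1
      exact funext fun y => hper y j hj
    simp only [hq, pdS, this]
  have hpt : ∀ x, ‖diffQuot i h g x‖ₑ ^ 2 ≤
      ENNReal.ofReal h⁻¹ * ∫⁻ t in Set.Ioc 0 h, q (x + t • Pi.single i 1) := by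
    intro x
    have h1 := enorm_sub_le_lintegral_line hg x i (s := x i) (t := x i + h)
      (I := Set.Ioc (x i) (x i + h)) (by rw [Set.uIoc_of_le (by linarith)])
    have h2 := (measurePreserving_add_left volume (x i)).setLIntegral_comp_preimage_emb
      (measurableEmbedding_addLeft (x i)) (fun r => ‖pdS i g (Function.update x i r)‖ₑ)
      (Set.Ioc (x i) (x i + h))
    have h3 : (fun t => x i + t) ⁻¹' (Set.Ioc (x i) (x i + h)) = Set.Ioc 0 h := by
      ext t; simp
    rw [h3] at h2
    rw [← h2, Function.update_eq_self, ← add_smul_single_eq_update] at h1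
    simp_rw [← add_smul_single_eq_update] at h1
    have hmt : Measurable fun t : ℝ => ‖pdS i g (x + t • Pi.single i 1)‖ₑ :=
      (hm.comp (by fun_prop : Measurable fun t : ℝ => x + t • (Pi.single i 1 : Fin d → ℝ))).enorm
    have h4 := lintegral_mul_sq_le (volume.restrict (Set.Ioc 0 h)) hmt.aemeasurable
      (aemeasurable_const (b := 1))
    simp only [mul_one, one_pow, lintegral_const, Measure.restrict_apply_univ, Real.volume_Ioc,
      sub_zero, one_mul] at h4
    have h5 : ‖diffQuot i h g x‖ₑ ^ 2 = ENNReal.ofReal h⁻¹ ^ 2 * ‖g (x + h • Pi.single i 1) - g x‖ₑ ^ 2 := by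
      rw [diffQuot, enorm_mul, mul_pow, Real.enorm_eq_ofReal (by positivity)]
    rw [h5]
    calc _ ≤ ENNReal.ofReal h⁻¹ ^ 2 * ((∫⁻ t in Set.Ioc 0 h, q (x + t • Pi.single i 1)) *
          ENNReal.ofReal h) := by
          gcongr
          exact (pow_le_pow_left' h1 2).trans h4
      _ = (ENNReal.ofReal h⁻¹ * ENNReal.ofReal h) * (ENNReal.ofReal h⁻¹ *
          ∫⁻ t in Set.Ioc 0 h, q (x + t • Pi.single i 1)) := by ring
      _ = _ := by
          rw [← ENNReal.ofReal_mul (by positivity), inv_mul_cancel₀ h0.ne', ENNReal.ofReal_one, one_mul]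
  have hjm : Measurable fun p : (Fin d → ℝ) × ℝ => q (p.1 + p.2 • Pi.single i 1) :=
    hqm.comp (by fun_prop)
  calc _ ≤ ∫⁻ x in strip d, ENNReal.ofReal h⁻¹ * ∫⁻ t in Set.Ioc 0 h, q (x + t • Pi.single i 1) :=
        lintegral_mono hpt
    _ = ENNReal.ofReal h⁻¹ * ∫⁻ x in strip d, (∫⁻ t in Set.Ioc 0 h, q (x + t • Pi.single i 1)) := by
        rw [lintegral_const_mul _ hjm.lintegral_prod_right']
    _ = ENNReal.ofReal h⁻¹ * ∫⁻ t in Set.Ioc 0 h, (∫⁻ x in strip d, q (x + t • Pi.single i 1)) := by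
        rw [lintegral_lintegral_swap hjm.aemeasurable]
    _ = ENNReal.ofReal h⁻¹ * ∫⁻ t in Set.Ioc 0 h, (∫⁻ x in strip d, q x) := by
        simp_rw [lintegral_strip_translate hqm hqper]
    _ = _ := by
        rw [lintegral_const, Measure.restrict_apply_univ, Real.volume_Ioc, sub_zero, mul_comm _
          (ENNReal.ofReal h), ← mul_assoc, ← ENNReal.ofReal_mul (by positivity),
          inv_mul_cancel₀ h0.ne', ENNReal.ofReal_one, one_mul]

lemma lintegral_sq_pdS_ne_top {d : ℕ} [NeZero d] {u : (Fin d → ℝ) → Fin d → ℝ} (hu : Adm d u)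
    (i j : Fin d) : ∫⁻ x in strip d, ‖pdS i (fun x => u x j) x‖ₑ ^ 2 ≠ ⊤ :=
  ((lintegral_mono fun x => enorm_pdS_sq_le hu.1 i j x).trans_lt
    (lintegral_gradSq_ne_top hu.2.2.2).lt_top).ne

lemma integrable_sq_of_lintegral {α : Type*} [MeasurableSpace α] {μ : Measure α} {f : α → ℝ}
    (hf : Measurable f) (h : ∫⁻ x, ‖f x‖ₑ ^ 2 ∂μ ≠ ⊤) : Integrable (fun x => f x ^ 2) μ :=
  ⟨(hf.pow_const 2).aestronglyMeasurable, by
    simpa only [HasFiniteIntegral, enorm_pow] using h.lt_top⟩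

lemma integrable_mul_of_lintegral {α : Type*} [MeasurableSpace α] {μ : Measure α} {f g : α → ℝ}
    (hf : Measurable f) (hg : Measurable g) (h1 : ∫⁻ x, ‖f x‖ₑ ^ 2 ∂μ ≠ ⊤)
    (h2 : ∫⁻ x, ‖g x‖ₑ ^ 2 ∂μ ≠ ⊤) : Integrable (fun x => f x * g x) μ := by
  refine ((integrable_sq_of_lintegral hf h1).add (integrable_sq_of_lintegral hg h2)).mono'
    (hf.mul hg).aestronglyMeasurable (Eventually.of_forall fun x => ?_)
  simp only [Real.norm_eq_abs, Pi.add_apply, abs_mul]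
  nlinarith [sq_nonneg (|f x| - |g x|), sq_abs (f x), sq_abs (g x)]

lemma IsPeriodic.diffQuot_apply {d : ℕ} [NeZero d] {u : (Fin d → ℝ) → Fin d → ℝ}
    (hu : IsPeriodic u) (i j : Fin d) (h : ℝ) (x : Fin d → ℝ) {k : Fin d} (hk : k ≠ 0) :
    diffQuot i h (fun x => u x j) (x + Pi.single k 1) = diffQuot i h (fun x => u x j) x := by
  simp only [diffQuot]
  rw [add_right_comm, hu _ k hk, hu _ k hk]

lemma tendsto_lintegral_slab_mul {d : ℕ} [NeZero d] {u : (Fin d → ℝ) → Fin d → ℝ} (hu : Adm d u)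
    {l : Filter ℝ} (hl : l = atTop ∨ l = atBot) {c : Fin d → ℝ} (hc : Tendsto (avg u) l (𝓝 c))
    {A : (Fin d → ℝ) → ℝ} (hA : Measurable A) (hfin : ∫⁻ x in strip d, ‖A x‖ₑ ^ 2 ≠ ⊤)
    (i : Fin d) :
    Tendsto (fun R => ∫⁻ x, ‖A x‖ₑ * ‖u x i‖ₑ ∂(boxMeasure (slabCorner d R))) l (𝓝 0) := by
  have hum : Measurable fun x => ‖u x i‖ₑ :=
    (differentiable_component hu.1 i).continuous.measurable.enorm
  have h1 := tendsto_lintegral_slab (hA.enorm.pow_const 2) hfin hl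
  have h2 : ∀ R, ∫⁻ x, ‖u x i‖ₑ ^ 2 ∂(boxMeasure (slabCorner d R)) ≤
      2 * ∫⁻ x, ENNReal.ofReal (vnorm2 (u x - c)) ∂(boxMeasure (slabCorner d R)) +
        2 * ‖c i‖ₑ ^ 2 := by
    intro R
    calc _ ≤ ∫⁻ x, (2 * ENNReal.ofReal (vnorm2 (u x - c)) + 2 * ‖c i‖ₑ ^ 2)
          ∂(boxMeasure (slabCorner d R)) := by
          refine lintegral_mono fun x => ?_
          have h := enorm_add_sq_le (u x i - c i) (c i)
          rw [sub_add_cancel] at h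
          refine h.trans ?_
          gcongr
          rw [ofReal_vnorm2]
          exact Finset.single_le_sum (f := fun k => ‖(u x - c) k‖ₑ ^ 2) (fun _ _ => zero_le)
            (Finset.mem_univ i)
      _ = _ := by
          rw [lintegral_add_right _ measurable_const, lintegral_const, measure_univ, mul_one,
            lintegral_const_mul]
          exact (continuous_vnorm2.comp (hu.1.continuous.sub continuous_const)).measurable.ennreal_ofReal
  have h3 := ((ENNReal.Tendsto.const_mul (tendsto_slab_vnorm2 hu hl hc)
    (a := 2) (Or.inr (by simp))).add_const (2 * ‖c i‖ₑ ^ 2))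
  have hfinc : 2 * ‖c i‖ₑ ^ 2 ≠ ⊤ := by finiteness
  have h4 := ENNReal.Tendsto.mul h1 (Or.inr (by simpa using hfinc)) h3 (Or.inr (by simp))
  rw [zero_mul] at h4
  have h5 : Tendsto (fun R => (∫⁻ x, ‖A x‖ₑ * ‖u x i‖ₑ ∂(boxMeasure (slabCorner d R))) ^ 2) l
      (𝓝 0) := by
    refine tendsto_of_tendsto_of_tendsto_of_le_of_le tendsto_const_nhds h4 (fun _ => zero_le)
      fun R => ?_
    refine (lintegral_mul_sq_le _ hA.enorm.aemeasurable hum.aemeasurable).trans ?_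
    gcongr
    exact h2 R
  have h6 := (ENNReal.continuous_rpow_const (y := 1 / 2)).tendsto 0 |>.comp h5
  rw [ENNReal.zero_rpow_of_pos (by norm_num)] at h6
  refine h6.congr fun R => ?_
  simp only [Function.comp_apply]
  rw [← ENNReal.rpow_natCast, ← ENNReal.rpow_mul]
  norm_num

lemma integral_diffQuot_mul_eq_zero {d : ℕ} [NeZero d] {u : (Fin d → ℝ) → Fin d → ℝ}
    (hu : Adm d u) {um up : Fin d → ℝ} (hbc : BdryCond d u um up) {h : ℝ} (h0 : 0 < h) :
    ∫ x in strip d, ∑ i, ∑ j, diffQuot i h (fun x => u x j) x * pd j u x i = 0 := by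
  have hcomp := fun k => differentiable_component hu.1 k
  have hAd : ∀ i j, Differentiable ℝ (diffQuot i h fun x => u x j) := fun i j =>
    differentiable_diffQuot i h (hcomp j)
  have hAfin : ∀ i j, ∫⁻ x in strip d, ‖diffQuot i h (fun x => u x j) x‖ₑ ^ 2 ≠ ⊤ := fun i j =>
    ((lintegral_sq_diffQuot_le (hcomp j) (fun x k hk => congrFun (hu.2.1 x k hk) j) i h0).trans_lt
      (lintegral_sq_pdS_ne_top hu i j).lt_top).ne
  set F : (Fin d → ℝ) → Fin d → ℝ := fun x j => ∑ i, diffQuot i h (fun x => u x j) x * u x i with hF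
  have hFd : Differentiable ℝ F := differentiable_pi.2 fun j =>
    Differentiable.fun_sum fun i _ => (hAd i j).mul (hcomp i)
  have hFper : IsPeriodic F := fun x k hk => by
    funext j
    simp only [hF, hu.2.1.diffQuot_apply _ _ _ _ hk, hu.2.1 x k hk]
  have hdiv : ∀ x, ∑ j, pd j F x j = ∑ i, ∑ j, diffQuot i h (fun x => u x j) x * pd j u x i := by
    intro x
    have h1 : ∀ j, pd j F x j = ∑ i, (diffQuot i h (fun x => u x j) x * pd j u x i +
        u x i * diffQuot i h (pdS j fun x => u x j) x) := by
      intro j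
      rw [pd_apply hFd]
      have hd : HasFDerivAt (fun x => F x j) (∑ i, (diffQuot i h (fun x => u x j) x •
          fderiv ℝ (fun x => u x i) x + u x i • fderiv ℝ (diffQuot i h fun x => u x j) x)) x :=
        HasFDerivAt.fun_sum fun i _ => (hAd i j x).hasFDerivAt.mul (hcomp i x).hasFDerivAt
      rw [pdS, hd.fderiv, _root_.sum_apply]
      refine Finset.sum_congr rfl fun i _ => ?_
      rw [← pdS_diffQuot i j h (hcomp j), pd_apply hu.1]
      rfl
    simp_rw [h1, Finset.sum_add_distrib]
    rw [Finset.sum_comm, add_eq_left, Finset.sum_comm]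
    refine Finset.sum_eq_zero fun i _ => ?_
    have h2 : ∀ y, ∑ j, pdS j (fun x => u x j) y = 0 := fun y => by
      simpa only [pd_apply hu.1] using hu.2.2.1 y
    rw [← Finset.mul_sum]
    simp only [diffQuot]
    rw [← Finset.mul_sum, Finset.sum_sub_distrib, h2, h2]
    simp
  have hint : IntegrableOn (fun x => ∑ j, pd j F x j) (strip d) := by
    simp_rw [hdiv]
    refine integrable_finsetSum _ fun i _ => integrable_finsetSum _ fun j _ => ?_
    simp_rw [pd_apply hu.1]
    exact integrable_mul_of_lintegral (hAd i j).continuous.measurable (measurable_pdS _ _)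
      (hAfin i j) (lintegral_sq_pdS_ne_top hu j i)
  have hlim : ∀ {l : Filter ℝ} (_ : l = atTop ∨ l = atBot) {c : Fin d → ℝ}
      (_ : Tendsto (avg u) l (𝓝 c)) (δ : ℝ), δ > 0 → ∃ᶠ t in l, |sliceMean (fun x => F x 0) t - 0| < δ := by
    intro l hl c hc δ hδ
    refine frequently_sliceMean (differentiable_component hFd 0).continuous hl ?_ hδ
    have h1 := tendsto_finsetSum Finset.univ fun i _ =>
      tendsto_lintegral_slab_mul hu hl hc (hAd i 0).continuous.measurable (hAfin i 0) i
    rw [Finset.sum_const_zero] at h1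
    refine tendsto_of_tendsto_of_tendsto_of_le_of_le tendsto_const_nhds h1 (fun _ => zero_le)
      fun R => ?_
    have hmm : ∀ i, Measurable fun x => ‖diffQuot i h (fun x => u x 0) x‖ₑ * ‖u x i‖ₑ := fun i =>
      (hAd i 0).continuous.measurable.enorm.mul (hcomp i).continuous.measurable.enorm
    rw [← lintegral_finsetSum _ fun i _ => hmm i]
    refine lintegral_mono fun x => ?_
    simp only [hF, sub_zero, ← enorm_mul]
    exact enorm_sum_le _ _
  have := integral_div_strip hFd hFper hint (cm := 0) (cp := 0)
    (hlim (Or.inr rfl) hbc.1) (hlim (Or.inl rfl) hbc.2)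
  simpa only [hdiv, sub_zero] using this

lemma integrable_pd_mul_pd {d : ℕ} [NeZero d] {u : (Fin d → ℝ) → Fin d → ℝ} (hu : Adm d u)
    (i j k l : Fin d) : IntegrableOn (fun x => pd i u x j * pd k u x l) (strip d) := by
  simp_rw [pd_apply hu.1]
  exact integrable_mul_of_lintegral (measurable_pdS _ _) (measurable_pdS _ _)
    (lintegral_sq_pdS_ne_top hu i j) (lintegral_sq_pdS_ne_top hu k l)

/-- The quadratic null Lagrangian of a divergence-free field has nonpositive integral. -/
lemma integral_null_lagrangian_nonpos {d : ℕ} [NeZero d] {u : (Fin d → ℝ) → Fin d → ℝ}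
    (hu : Adm d u) {um up : Fin d → ℝ} (hbc : BdryCond d u um up) :
    ∫ x in strip d, ∑ i, ∑ j, pd i u x j * pd j u x i ≤ 0 := by
  have hcomp := fun k => differentiable_component hu.1 k
  set hn : ℕ → ℝ := fun n => 1 / ((n : ℝ) + 1) with hhn
  have hn0 : ∀ n, 0 < hn n := fun n => by positivity
  set A : ℕ → Fin d → Fin d → (Fin d → ℝ) → ℝ := fun n i j => diffQuot i (hn n) fun x => u x j
  have hAd : ∀ n i j, Continuous (A n i j) := fun n i j =>
    (differentiable_diffQuot i _ (hcomp j)).continuous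
  have hAle : ∀ n i j, ∫⁻ x in strip d, ‖A n i j x‖ₑ ^ 2 ≤
      ∫⁻ x in strip d, ‖pdS i (fun x => u x j) x‖ₑ ^ 2 := fun n i j =>
    lintegral_sq_diffQuot_le (hcomp j) (fun x k hk => congrFun (hu.2.1 x k hk) j) i (hn0 n)
  have hAfin : ∀ n i j, ∫⁻ x in strip d, ‖A n i j x‖ₑ ^ 2 ≠ ⊤ := fun n i j =>
    ((hAle n i j).trans_lt (lintegral_sq_pdS_ne_top hu i j).lt_top).ne
  have hAsq : ∀ n i j, IntegrableOn (fun x => A n i j x ^ 2) (strip d) := fun n i j =>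
    integrable_sq_of_lintegral (hAd n i j).measurable (hAfin n i j)
  have hAmul : ∀ n i j, IntegrableOn (fun x => A n i j x * pd j u x i) (strip d) := fun n i j => by
    simp_rw [pd_apply hu.1]
    exact integrable_mul_of_lintegral (hAd n i j).measurable (measurable_pdS _ _)
      (hAfin n i j) (lintegral_sq_pdS_ne_top hu j i)
  have hPsq : ∀ i j, IntegrableOn (fun x => pd i u x j ^ 2) (strip d) := fun i j => by
    simpa only [sq] using integrable_pd_mul_pd hu i j i j
  have hAint : ∀ n i j, ∫ x in strip d, A n i j x ^ 2 ≤ ∫ x in strip d, pd i u x j ^ 2 := by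
    intro n i j
    have h1 := hAle n i j
    simp_rw [enorm_sq_eq, ← pd_apply hu.1] at h1
    rw [← ofReal_integral_eq_lintegral_ofReal (hAsq n i j) (Eventually.of_forall fun _ => sq_nonneg _),
      ← ofReal_integral_eq_lintegral_ofReal (hPsq i j) (Eventually.of_forall fun _ => sq_nonneg _)] at h1
    exact (ENNReal.ofReal_le_ofReal_iff (integral_nonneg fun _ => sq_nonneg _)).1 h1
  set G := ∫ x in strip d, gradSq u x with hG
  have hGsum : G = ∑ i, ∑ j, ∫ x in strip d, pd i u x j ^ 2 := by
    rw [hG]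
    unfold gradSq
    rw [integral_finsetSum _ fun i _ => integrable_finsetSum _ fun j _ => hPsq i j]
    exact Finset.sum_congr rfl fun i _ => integral_finsetSum _ fun j _ => hPsq i j
  have hG0 : 0 ≤ G := integral_nonneg fun _ => gradSq_nonneg _ _
  set N : (Fin d → ℝ) → ℝ := fun x => ∑ i, ∑ j, pd i u x j * pd j u x i with hN
  have hNint : IntegrableOn N (strip d) :=
    integrable_finsetSum _ fun i _ => integrable_finsetSum _ fun j _ => integrable_pd_mul_pd hu _ _ _ _
  have hS : ∀ n x, ∑ i, ∑ j, (A n i j x + pd j u x i) ^ 2 =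
      ∑ i, ∑ j, A n i j x ^ 2 + 2 * ∑ i, ∑ j, A n i j x * pd j u x i + gradSq u x := by
    intro n x
    unfold gradSq
    rw [Finset.sum_comm (f := fun i j => pd i u x j ^ 2), Finset.mul_sum, ← Finset.sum_add_distrib,
      ← Finset.sum_add_distrib]
    refine Finset.sum_congr rfl fun i _ => ?_
    rw [Finset.mul_sum, ← Finset.sum_add_distrib, ← Finset.sum_add_distrib]
    exact Finset.sum_congr rfl fun j _ => by ring
  have hS2 : ∀ x, ∑ i, ∑ j, (pd i u x j + pd j u x i) ^ 2 = 2 * gradSq u x + 2 * N x := by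
    intro x
    have h1 : ∑ i, ∑ j, (pd i u x j + pd j u x i) ^ 2 = ∑ i, ∑ j, pd i u x j ^ 2 +
        2 * N x + ∑ i, ∑ j, pd j u x i ^ 2 := by
      rw [hN, Finset.mul_sum, ← Finset.sum_add_distrib, ← Finset.sum_add_distrib]
      refine Finset.sum_congr rfl fun i _ => ?_
      rw [Finset.mul_sum, ← Finset.sum_add_distrib, ← Finset.sum_add_distrib]
      exact Finset.sum_congr rfl fun j _ => by ring
    rw [h1, Finset.sum_comm (f := fun i j => pd j u x i ^ 2)]
    unfold gradSq
    ring
  have hSA : ∀ n, IntegrableOn (fun x => ∑ i, ∑ j, A n i j x ^ 2) (strip d) := fun n =>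
    integrable_finsetSum _ fun i _ => integrable_finsetSum _ fun j _ => hAsq n i j
  have hSM : ∀ n, IntegrableOn (fun x => ∑ i, ∑ j, A n i j x * pd j u x i) (strip d) := fun n =>
    integrable_finsetSum _ fun i _ => integrable_finsetSum _ fun j _ => hAmul n i j
  have hbound : ∀ n, ∫⁻ x in strip d, ENNReal.ofReal (∑ i, ∑ j, (A n i j x + pd j u x i) ^ 2) ≤
      ENNReal.ofReal (2 * G) := by
    intro n
    have hi : IntegrableOn (fun x => ∑ i, ∑ j, (A n i j x + pd j u x i) ^ 2) (strip d) := by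
      simp_rw [hS]
      exact ((hSA n).add ((hSM n).const_mul 2)).add hu.2.2.2
    rw [← ofReal_integral_eq_lintegral_ofReal hi (Eventually.of_forall fun x =>
      Finset.sum_nonneg fun i _ => Finset.sum_nonneg fun j _ => sq_nonneg _)]
    refine ENNReal.ofReal_le_ofReal ?_
    simp_rw [hS]
    have hSB : IntegrableOn (fun x => ∑ i, ∑ j, A n i j x ^ 2 +
        2 * ∑ i, ∑ j, A n i j x * pd j u x i) (strip d) := (hSA n).add ((hSM n).const_mul 2)
    rw [integral_add hSB hu.2.2.2, integral_add (hSA n) ((hSM n).const_mul 2), integral_const_mul,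
      integral_diffQuot_mul_eq_zero hu hbc (hn0 n), mul_zero, add_zero, two_mul]
    refine add_le_add_left ?_ _
    rw [hGsum, integral_finsetSum _ fun i _ => integrable_finsetSum _ fun j _ => hAsq n i j]
    refine Finset.sum_le_sum fun i _ => ?_
    rw [integral_finsetSum _ fun j _ => hAsq n i j]
    exact Finset.sum_le_sum fun j _ => hAint n i j
  have hpm : ∀ i j, Measurable fun x => pd i u x j := fun i j => measurable_pd i j u
  have hfatou := lintegral_liminf_le (μ := volume.restrict (strip d)) (u := atTop)
    (f := fun n x => ENNReal.ofReal (∑ i, ∑ j, (A n i j x + pd j u x i) ^ 2)) fun n =>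
      (Finset.measurable_sum _ fun i _ => Finset.measurable_sum _ fun j _ =>
        (((hAd n i j).measurable.add (hpm j i)).pow_const 2)).ennreal_ofReal
  have hptw : ∀ x, liminf (fun n => ENNReal.ofReal (∑ i, ∑ j, (A n i j x + pd j u x i) ^ 2)) atTop =
      ENNReal.ofReal (2 * gradSq u x + 2 * N x) := by
    intro x
    rw [← hS2]
    refine Tendsto.liminf_eq (ENNReal.tendsto_ofReal ?_)
    refine tendsto_finsetSum _ fun i _ => tendsto_finsetSum _ fun j _ => ?_
    refine Tendsto.pow (Tendsto.add_const _ ?_) 2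
    rw [pd_apply hu.1]
    exact tendsto_diffQuot i (hcomp j) x
  simp_rw [hptw] at hfatou
  have hle := hfatou.trans (liminf_le_of_le (by isBoundedDefault)
    fun b hb => (hb.exists.choose_spec).trans (hbound _))
  have hint : IntegrableOn (fun x => 2 * gradSq u x + 2 * N x) (strip d) :=
    (hu.2.2.2.const_mul 2).add (hNint.const_mul 2)
  rw [← ofReal_integral_eq_lintegral_ofReal hint
    (Eventually.of_forall fun x => by
      simp only [Pi.zero_apply]
      rw [← hS2]
      exact Finset.sum_nonneg fun i _ => Finset.sum_nonneg fun j _ => sq_nonneg _)] at hle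
  have h := (ENNReal.ofReal_le_ofReal_iff (by positivity)).1 hle
  rw [integral_add (hu.2.2.2.const_mul 2) (hNint.const_mul 2), integral_const_mul,
    integral_const_mul] at h
  linarith

lemma hasFDerivAt_profile {d : ℕ} [NeZero d] {σ : ℝ → Fin d → ℝ} {σ' : ℝ → Fin d → ℝ}
    (hσ : ∀ t, HasDerivAt σ (σ' t) t) (x : Fin d → ℝ) :
    HasFDerivAt (fun x : Fin d → ℝ => σ (x 0))
      ((ContinuousLinearMap.toSpanSingleton ℝ (σ' (x 0))).comp
        (ContinuousLinearMap.proj (R := ℝ) (φ := fun _ : Fin d => ℝ) 0)) x :=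
  (hσ (x 0)).hasFDerivAt.comp x (ContinuousLinearMap.proj (R := ℝ) (φ := fun _ : Fin d => ℝ) 0).hasFDerivAt

lemma pd_profile {d : ℕ} [NeZero d] {σ : ℝ → Fin d → ℝ} {σ' : ℝ → Fin d → ℝ}
    (hσ : ∀ t, HasDerivAt σ (σ' t) t) (x : Fin d → ℝ) (i j : Fin d) :
    pd i (fun x : Fin d → ℝ => σ (x 0)) x j = if i = 0 then σ' (x 0) j else 0 := by
  rw [pd, (hasFDerivAt_profile hσ x).fderiv]
  split_ifs with hi
  · subst hi; simp
  · simp [Ne.symm hi]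

lemma gradSq_profile {d : ℕ} [NeZero d] {σ : ℝ → Fin d → ℝ} {σ' : ℝ → Fin d → ℝ}
    (hσ : ∀ t, HasDerivAt σ (σ' t) t) (x : Fin d → ℝ) :
    gradSq (fun x : Fin d → ℝ => σ (x 0)) x = vnorm2 (σ' (x 0)) := by
  unfold gradSq vnorm2
  simp_rw [pd_profile hσ]
  rw [Finset.sum_eq_single 0 (fun i _ hi => by simp [hi]) (by simp)]
  simp

/-- One-dimensional profiles that are eventually constant are admissible. -/
lemma adm_profile {d : ℕ} [NeZero d] {W : (Fin d → ℝ) → ℝ} (hW : Continuous W) (hW0 : ∀ z, 0 ≤ W z)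
    {a : ℝ} {um up : Fin d → ℝ} {σ σ' : ℝ → Fin d → ℝ} (hσ : ∀ t, HasDerivAt σ (σ' t) t)
    (hσ'c : Continuous σ') (ha : ∀ t, σ t 0 = a) (hm : ∀ᶠ t in atBot, σ t = um)
    (hp : ∀ᶠ t in atTop, σ t = up)
    (hfin : ∫⁻ t, ENNReal.ofReal ((1 / 2) * vnorm2 (σ' t) + W (σ t)) ≠ ⊤) :
    Adm d (fun x => σ (x 0)) ∧ BdryCond d (fun x => σ (x 0)) um up ∧
      energy d W (fun x => σ (x 0)) = ∫⁻ t, ENNReal.ofReal ((1 / 2) * vnorm2 (σ' t) + W (σ t)) := by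
  have hσc : Continuous σ := continuous_iff_continuousAt.2 fun t => (hσ t).continuousAt
  have hden : Continuous fun t => (1 / 2) * vnorm2 (σ' t) + W (σ t) :=
    ((continuous_vnorm2.comp hσ'c).const_mul _).add (hW.comp hσc)
  have hE : energy d W (fun x => σ (x 0)) =
      ∫⁻ t, ENNReal.ofReal ((1 / 2) * vnorm2 (σ' t) + W (σ t)) := by
    unfold energy eden
    simp_rw [gradSq_profile hσ]
    rw [lintegral_strip (f := fun x => ENNReal.ofReal ((1 / 2) * vnorm2 (σ' (x 0)) + W (σ (x 0))))
      (hden.comp (continuous_apply 0)).measurable.ennreal_ofReal]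
    simp
  have havg : ∀ t, avg (fun x : Fin d → ℝ => σ (x 0)) t = σ t := fun t => by
    unfold avg
    rw [← boxMeasure_zero]
    simp
  have hσ0 : ∀ t, σ' t 0 = 0 := fun t => by
    have h1 := hasDerivAt_pi.1 (hσ t) 0
    simp_rw [ha] at h1
    exact h1.unique (hasDerivAt_const t a)
  refine ⟨⟨fun x => (hasFDerivAt_profile hσ x).differentiableAt, fun x i hi => ?_, fun x => ?_, ?_⟩,
    ⟨?_, ?_⟩, hE⟩
  · simp [Ne.symm hi]
  · simp_rw [pd_profile hσ]
    simp [hσ0]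
  · have hfun : gradSq (fun x : Fin d → ℝ => σ (x 0)) = fun x => vnorm2 (σ' (x 0)) :=
      funext (gradSq_profile hσ)
    rw [hfun]
    refine ⟨((continuous_vnorm2.comp hσ'c).comp (continuous_apply 0)).aestronglyMeasurable, ?_⟩
    have h1 : ∫⁻ x in strip d, ENNReal.ofReal (vnorm2 (σ' (x 0))) ≤
        ∫⁻ x in strip d, 2 * ENNReal.ofReal (eden W (fun x => σ (x 0)) x) := by
      refine lintegral_mono fun x => ?_
      rw [← ENNReal.ofReal_ofNat, ← ENNReal.ofReal_mul (by norm_num)]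
      refine ENNReal.ofReal_le_ofReal ?_
      rw [eden, gradSq_profile hσ]
      linarith [hW0 (σ (x 0))]
    rw [lintegral_const_mul' _ _ (by simp)] at h1
    rw [HasFiniteIntegral]
    refine lt_of_le_of_lt ?_ (h1.trans_lt ?_)
    · refine lintegral_mono fun x => ?_
      rw [Real.enorm_eq_ofReal (vnorm2_nonneg _)]
    · rw [← energy, hE]
      exact ENNReal.mul_lt_top (by simp) hfin.lt_top
  · exact (tendsto_congr havg).2 ((tendsto_congr' hm).2 tendsto_const_nhds)
  · exact (tendsto_congr havg).2 ((tendsto_congr' hp).2 tendsto_const_nhds)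

/-- Reparametrizing a `C¹` curve to nearly equipartition its energy. -/
lemma exists_competitor {d : ℕ} [NeZero d] {W : (Fin d → ℝ) → ℝ} (hW : Continuous W)
    (hW0 : ∀ z, 0 ≤ W z) {a : ℝ} {um up : Fin d → ℝ} (hWm : W um = 0) (hWp : W up = 0)
    {c c' : ℝ → Fin d → ℝ} (hc : ∀ t, HasDerivAt c (c' t) t) (hc'c : Continuous c')
    (hca : ∀ t, c t 0 = a) {s r : ℝ} (hm : ∀ t ≤ s, c t = um) (hp : ∀ t ≥ r, c t = up)
    {ε : ℝ} (hε : 0 < ε) :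
    ∃ v, Adm d v ∧ BdryCond d v um up ∧ energy d W v ≤
      ENNReal.ofReal (∫ t in Set.Icc s r, √(2 * W (c t) + ε ^ 2) * √(vnorm2 (c' t) + ε ^ 2)) := by
  have hcc : Continuous c := continuous_iff_continuousAt.2 fun t => (hc t).continuousAt
  set p : ℝ → ℝ := fun t => √(vnorm2 (c' t) + ε ^ 2)
  set q : ℝ → ℝ := fun t => √(2 * W (c t) + ε ^ 2)
  have hpc : Continuous p := ((continuous_vnorm2.comp hc'c).add continuous_const).sqrt
  have hqc : Continuous q := (((hW.comp hcc).const_mul 2).add continuous_const).sqrt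
  have hpε : ∀ t, ε ≤ p t := fun t => Real.le_sqrt_of_sq_le (by linarith [vnorm2_nonneg (c' t)])
  have hqε : ∀ t, ε ≤ q t := fun t => Real.le_sqrt_of_sq_le (by linarith [hW0 (c t)])
  have hp0 : ∀ t, 0 < p t := fun t => hε.trans_le (hpε t)
  have hq0 : ∀ t, 0 < q t := fun t => hε.trans_le (hqε t)
  have hp2 : ∀ t, p t ^ 2 = vnorm2 (c' t) + ε ^ 2 := fun t =>
    Real.sq_sqrt (add_nonneg (vnorm2_nonneg _) (sq_nonneg _))
  have hq2 : ∀ t, q t ^ 2 = 2 * W (c t) + ε ^ 2 := fun t =>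
    Real.sq_sqrt (add_nonneg (mul_nonneg two_pos.le (hW0 _)) (sq_nonneg _))
  have hWout : ∀ t, t ∉ Set.Icc s r → W (c t) = 0 := fun t ht => by
    rw [Set.mem_Icc, not_and_or, not_le, not_le] at ht
    rcases ht with h | h
    · rw [hm t h.le, hWm]
    · rw [hp t h.le, hWp]
  have hc'out : ∀ t, t ∉ Set.Icc s r → c' t = 0 := fun t ht => by
    rw [Set.mem_Icc, not_and_or, not_le, not_le] at ht
    rcases ht with h | h
    · refine (hc t).unique ((hasDerivAt_const t um).congr_of_eventuallyEq ?_)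
      filter_upwards [Iio_mem_nhds h] with y hy using hm y (le_of_lt hy)
    · refine (hc t).unique ((hasDerivAt_const t up).congr_of_eventuallyEq ?_)
      filter_upwards [Ioi_mem_nhds h] with y hy using hp y (le_of_lt hy)
  obtain ⟨M, hM⟩ := (isCompact_Icc (a := s) (b := r)).bddAbove_image hqc.continuousOn
  have hqM : ∀ t, q t ≤ max M ε := fun t => by
    by_cases ht : t ∈ Set.Icc s r
    · exact (hM ⟨t, ht, rfl⟩).trans (le_max_left _ _)
    · refine le_trans (le_of_eq ?_) (le_max_right _ _)
      simp only [q, hWout t ht]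
      simp [Real.sqrt_sq hε.le]
  set g : ℝ → ℝ := fun t => p t / q t with hg
  have hgc : Continuous g := hpc.div hqc fun t => (hq0 t).ne'
  have hg0 : ∀ t, 0 < g t := fun t => div_pos (hp0 t) (hq0 t)
  set m := ε / max M ε with hmdef
  have hm0 : 0 < m := div_pos hε (hε.trans_le (le_max_right _ _))
  have hgm : ∀ t, m ≤ g t := fun t => div_le_div₀ (hp0 t).le (hpε t) (hq0 t) (hqM t)
  set S : ℝ → ℝ := fun t => ∫ y in (0 : ℝ)..t, g y with hS
  have hSd : ∀ t, HasDerivAt S (g t) t := fun t => (hgc.integral_hasStrictDerivAt 0 t).hasDerivAt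
  have hScont : Continuous S := continuous_iff_continuousAt.2 fun t => (hSd t).continuousAt
  have hSmono : StrictMono S := strictMono_of_deriv_pos fun t => by rw [(hSd t).deriv]; exact hg0 t
  have hSm : Monotone fun t => S t - m * t := by
    have hd : ∀ t, HasDerivAt (fun t => S t - m * t) (g t - m) t := fun t => by
      have h : HasDerivAt (fun t => S t - m * id t) (g t - m * 1) t :=
        (hSd t).sub ((hasDerivAt_id t).const_mul m)
      rwa [mul_one] at h
    refine monotone_of_deriv_nonneg (fun t => (hd t).differentiableAt) fun t => ?_
    rw [(hd t).deriv]
    linarith [hgm t]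
  have hS0 : S 0 = 0 := by simp [hS]
  have hStop : Tendsto S atTop atTop := by
    refine tendsto_atTop_mono' _ ?_ (tendsto_id.const_mul_atTop hm0)
    filter_upwards [eventually_ge_atTop 0] with t ht
    have := hSm ht
    simp only [hS0, mul_zero, sub_zero] at this
    simp only [id]
    linarith
  have hSbot : Tendsto S atBot atBot := by
    refine tendsto_atBot_mono' _ ?_ (tendsto_id.const_mul_atBot hm0)
    filter_upwards [eventually_le_atBot 0] with t ht
    have := hSm ht
    simp only [hS0, mul_zero, sub_zero] at this
    simp only [id]
    linarith
  have hSsurj : Function.Surjective S := hScont.surjective hStop hSbot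
  set e : ℝ ≃o ℝ := StrictMono.orderIsoOfSurjective S hSmono hSsurj
  have heS : ∀ t, e t = S t := fun t => rfl
  set θ : ℝ → ℝ := fun y => e.symm y with hθ
  have hθc : Continuous θ := e.symm.continuous
  have hθS : ∀ t, θ (S t) = t := fun t => e.symm_apply_apply t
  have hSθ : ∀ y, S (θ y) = y := fun y => e.apply_symm_apply y
  have hθd : ∀ y, HasDerivAt θ (g (θ y))⁻¹ y := fun y =>
    HasDerivAt.of_local_left_inverse hθc.continuousAt (hSd (θ y)) (hg0 _).ne'
      (Eventually.of_forall hSθ)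
  have hσd : ∀ y, HasDerivAt (fun y => c (θ y)) ((g (θ y))⁻¹ • c' (θ y)) y := fun y =>
    (hc (θ y)).scomp y (hθd y)
  have hσ'c : Continuous fun y => (g (θ y))⁻¹ • c' (θ y) :=
    ((hgc.comp hθc).inv₀ fun y => (hg0 _).ne').smul (hc'c.comp hθc)
  have hvs : ∀ (b : ℝ) (w : Fin d → ℝ), vnorm2 (b • w) = b ^ 2 * vnorm2 w := fun b w => by
    simp [vnorm2, mul_pow, Finset.mul_sum]
  have hcv : ∫⁻ y, ENNReal.ofReal ((1 / 2) * vnorm2 ((g (θ y))⁻¹ • c' (θ y)) + W (c (θ y))) =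
      ∫⁻ t, ENNReal.ofReal |g t| *
        ENNReal.ofReal ((1 / 2) * vnorm2 ((g t)⁻¹ • c' t) + W (c t)) := by
    have h := lintegral_image_eq_lintegral_abs_deriv_mul MeasurableSet.univ
      (fun t _ => (hSd t).hasDerivWithinAt) hSmono.injective.injOn
      (fun y => ENNReal.ofReal ((1 / 2) * vnorm2 ((g (θ y))⁻¹ • c' (θ y)) + W (c (θ y))))
    rw [Set.image_univ, hSsurj.range_eq, Measure.restrict_univ] at h
    simpa only [hθS] using h
  have hle : ∫⁻ y, ENNReal.ofReal ((1 / 2) * vnorm2 ((g (θ y))⁻¹ • c' (θ y)) + W (c (θ y))) ≤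
      ENNReal.ofReal (∫ t in Set.Icc s r, q t * p t) := by
    have hqp : IntegrableOn (fun t => q t * p t) (Set.Icc s r) :=
      (hqc.mul hpc).continuousOn.integrableOn_compact isCompact_Icc
    rw [hcv, ofReal_integral_eq_lintegral_ofReal hqp
      (Eventually.of_forall fun t => (mul_pos (hq0 t) (hp0 t)).le),
      ← lintegral_indicator measurableSet_Icc]
    refine lintegral_mono fun t => ?_
    rw [← ENNReal.ofReal_mul (abs_nonneg _), abs_of_pos (hg0 t), hvs]
    by_cases ht : t ∈ Set.Icc s r
    · rw [Set.indicator_of_mem ht]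
      refine ENNReal.ofReal_le_ofReal ?_
      have h1 : vnorm2 (c' t) ≤ p t ^ 2 := by rw [hp2]; linarith [sq_nonneg ε]
      have h2 : 2 * W (c t) ≤ q t ^ 2 := by rw [hq2]; linarith [sq_nonneg ε]
      have h3 : 0 < p t := hp0 t
      have h4 : 0 < q t := hq0 t
      calc g t * ((1 / 2) * ((g t)⁻¹ ^ 2 * vnorm2 (c' t)) + W (c t))
          ≤ g t * ((1 / 2) * ((g t)⁻¹ ^ 2 * p t ^ 2) + q t ^ 2 / 2) := by
            have := (hg0 t).le
            gcongr
            linarith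
        _ = q t * p t := by
            simp only [hg]
            field_simp
            ring
    · rw [Set.indicator_of_notMem ht, hWout t ht, hc'out t ht]
      simp [vnorm2]
  obtain ⟨h1, h2, h3⟩ := adm_profile (σ := fun y => c (θ y)) hW hW0 hσd hσ'c (fun y => hca _)
    (um := um) (up := up)
    (by
      filter_upwards [eventually_le_atBot (S s)] with y hy
      exact hm _ (by rw [← hθS s]; exact e.symm.monotone hy))
    (by
      filter_upwards [eventually_ge_atTop (S r)] with y hy
      refine hp _ ?_
      rw [ge_iff_le, ← hθS r]
      exact e.symm.monotone hy)
    (hle.trans_lt ENNReal.ofReal_lt_top).ne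
  exact ⟨_, h1, h2, h3.trans_le hle⟩

/-- A Lipschitz curve carries a sequence of admissible competitors whose energies are
asymptotically bounded by its weighted length. -/
lemma energy_le_of_minimizer_of_curve {d : ℕ} [NeZero d] {W : (Fin d → ℝ) → ℝ} (hW : Continuous W)
    (hW0 : ∀ z, 0 ≤ W z) {a : ℝ} {um up : Fin d → ℝ} (hWm : W um = 0) (hWp : W up = 0)
    {E : ℝ≥0∞} (hE : ∀ v, Adm d v → BdryCond d v um up → E ≤ energy d W v)
    {γ : ℝ → Fin d → ℝ} {K : NNReal} (hγ : LipschitzWith K γ) (hγa : ∀ t, γ t 0 = a)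
    (hγm : γ (-1) = um) (hγp : γ 1 = up) :
    E ≤ ENNReal.ofReal
      (∫ t in Set.Icc (-1 : ℝ) 1, √(2 * W (γ t)) * √(vnorm2 (deriv γ t))) := by
  set κ : ℝ → Fin d → ℝ := fun t => γ (max (-1) (min 1 t)) with hκ
  have hκl : LipschitzWith K κ := by
    have h1 : LipschitzWith 1 fun t : ℝ => max (-1) (min 1 t) :=
      (LipschitzWith.id.const_min 1).const_max (-1)
    have h2 := hγ.comp h1
    rwa [mul_one] at h2
  have hκc : Continuous κ := hκl.continuous
  have hκa : ∀ t, κ t 0 = a := fun t => hγa _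
  have hκm : ∀ t ≤ -1, κ t = um := fun t ht => by
    have h1 : min 1 t ≤ -1 := (min_le_right _ _).trans ht
    simp only [hκ, max_eq_left h1, hγm]
  have hκp : ∀ t ≥ 1, κ t = up := fun t ht => by
    have h1 : min 1 t = 1 := min_eq_left ht
    simp only [hκ, h1]
    norm_num [hγp]
  have hκeq : ∀ t ∈ Set.Icc (-1 : ℝ) 1, κ t = γ t := fun t ht => by
    simp only [hκ, min_eq_right ht.2, max_eq_right ht.1]
  obtain ⟨M, hM⟩ : ∃ M, ∀ t, ‖κ t‖ ≤ M := by
    obtain ⟨M, hM⟩ := (isCompact_Icc (a := (-1 : ℝ)) (b := 1)).exists_bound_of_continuousOn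
      hγ.continuous.continuousOn
    exact ⟨M, fun t => hM _ ⟨le_max_left _ _, max_le (by norm_num) (min_le_left _ _)⟩⟩
  set G : ℝ → Fin d → ℝ := fun t => ∫ y in (0 : ℝ)..t, κ y with hG
  have hGd : ∀ t, HasDerivAt G (κ t) t := fun t => (hκc.integral_hasStrictDerivAt 0 t).hasDerivAt
  have hGsub : ∀ s t, G t - G s = ∫ y in s..t, κ y := fun s t =>
    intervalIntegral.integral_interval_sub_left (hκc.intervalIntegrable _ _)
      (hκc.intervalIntegrable _ _)
  set c : ℝ → ℝ → Fin d → ℝ := fun h t => h⁻¹ • (G (t + h) - G t) with hc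
  set c' : ℝ → ℝ → Fin d → ℝ := fun h t => h⁻¹ • (κ (t + h) - κ t) with hc'
  have hcd : ∀ h t, HasDerivAt (c h) (c' h t) t := fun h t =>
    (((hGd (t + h)).comp_add_const t h).sub (hGd t)).const_smul h⁻¹
  have hc'c : ∀ h, Continuous (c' h) := fun h =>
    ((hκc.comp (continuous_id.add continuous_const)).sub hκc).const_smul h⁻¹
  have hcconst : ∀ h > 0, ∀ t (w : Fin d → ℝ), (∀ y ∈ Set.Icc t (t + h), κ y = w) → c h t = w := by
    intro h hh t w hw
    simp only [hc, hGsub]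
    rw [intervalIntegral.integral_congr (g := fun _ => w)
      (by rw [Set.uIcc_of_le (by linarith)]; exact hw)]
    simp [smul_smul, hh.ne']
  have hca : ∀ h > 0, ∀ t, c h t 0 = a := by
    intro h hh t
    have h1 := (ContinuousLinearMap.proj (R := ℝ) (φ := fun _ : Fin d => ℝ) 0).intervalIntegral_comp_comm
      (hκc.intervalIntegrable t (t + h) (μ := volume))
    simp only [ContinuousLinearMap.proj_apply, hκa, intervalIntegral.integral_const,
      add_sub_cancel_left, smul_eq_mul] at h1
    simp only [hc, hGsub, Pi.smul_apply, ← h1, smul_eq_mul]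
    field_simp
  have hcM : ∀ h > 0, ∀ t, ‖c h t‖ ≤ M := by
    intro h hh t
    simp only [hc, hGsub]
    rw [norm_smul, Real.norm_eq_abs, abs_of_pos (inv_pos.2 hh)]
    have h1 := intervalIntegral.norm_integral_le_of_norm_le_const (a := t) (b := t + h)
      (f := κ) (fun y _ => hM y)
    rw [add_sub_cancel_left, abs_of_pos hh] at h1
    calc h⁻¹ * ‖∫ y in t..t + h, κ y‖ ≤ h⁻¹ * (M * h) := by gcongr
      _ = M := by field_simp
  have hc'K : ∀ h > 0, ∀ t, ‖c' h t‖ ≤ K := by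
    intro h hh t
    simp only [hc']
    rw [norm_smul, Real.norm_eq_abs, abs_of_pos (inv_pos.2 hh)]
    have h1 := hκl.dist_le_mul (t + h) t
    rw [dist_eq_norm, dist_eq_norm, add_sub_cancel_left, Real.norm_eq_abs, abs_of_pos hh] at h1
    calc h⁻¹ * ‖κ (t + h) - κ t‖ ≤ h⁻¹ * (K * h) := by gcongr
      _ = K := by field_simp
  set η : ℕ → ℝ := fun n => 1 / ((n : ℝ) + 1) with hη
  have hη0 : ∀ n, 0 < η n := fun n => Nat.one_div_pos_of_nat
  have hη1 : ∀ n, η n ≤ 1 := fun n => by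
    rw [hη, div_le_one (by positivity)]
    linarith [n.cast_nonneg (α := ℝ)]
  have hηt : Tendsto η atTop (𝓝 0) := tendsto_one_div_add_atTop_nhds_zero_nat
  have hηt' : Tendsto η atTop (𝓝[≠] 0) :=
    tendsto_nhdsWithin_iff.2 ⟨hηt, Eventually.of_forall fun n => (hη0 n).ne'⟩
  have hle : ∀ n, E ≤ ENNReal.ofReal (∫ t in Set.Icc (-2 : ℝ) 1,
      √(2 * W (c (η n) t) + η n ^ 2) * √(vnorm2 (c' (η n) t) + η n ^ 2)) := fun n => by
    obtain ⟨v, h1, h2, h3⟩ := exists_competitor hW hW0 hWm hWp (hcd (η n)) (hc'c _)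
      (hca _ (hη0 n)) (s := -2) (r := 1) (um := um) (up := up)
      (fun t ht => hcconst _ (hη0 n) t um fun y hy => hκm y (by linarith [hy.2, hη1 n]))
      (fun t ht => hcconst _ (hη0 n) t up fun y hy => hκp y (ht.trans hy.1)) (hη0 n)
    exact (hE v h1 h2).trans h3
  obtain ⟨B, hB⟩ := (isCompact_closedBall (0 : Fin d → ℝ) M).bddAbove_image hW.continuousOn
  have hlim : Tendsto (fun n => ∫ t in Set.Icc (-2 : ℝ) 1,
      √(2 * W (c (η n) t) + η n ^ 2) * √(vnorm2 (c' (η n) t) + η n ^ 2)) atTop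
      (𝓝 (∫ t in Set.Icc (-2 : ℝ) 1, √(2 * W (κ t)) * √(vnorm2 (deriv κ t)))) := by
    refine tendsto_integral_of_dominated_convergence
      (fun _ => √(2 * B + 1) * √(d * (K : ℝ) ^ 2 + 1)) (fun n => ?_) (integrable_const _)
      (fun n => Eventually.of_forall fun t => ?_) ?_
    · have h1 : Continuous (c (η n)) :=
        continuous_iff_continuousAt.2 fun t => (hcd _ t).continuousAt
      exact ((((hW.comp h1).const_mul 2).add continuous_const).sqrt.mul
        ((continuous_vnorm2.comp (hc'c _)).add continuous_const).sqrt).aestronglyMeasurable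
    · rw [Real.norm_of_nonneg (by positivity)]
      have h1 : W (c (η n) t) ≤ B := hB ⟨_, by simpa using hcM _ (hη0 n) t, rfl⟩
      have h2 : vnorm2 (c' (η n) t) ≤ d * (K : ℝ) ^ 2 :=
        (vnorm2_le _).trans (by gcongr; exact hc'K _ (hη0 n) t)
      have h3 : η n ^ 2 ≤ 1 := pow_le_one₀ (hη0 n).le (hη1 n)
      gcongr
    · refine ae_restrict_of_ae ?_
      filter_upwards [hκl.ae_differentiableAt_real] with t ht
      have h1 : Tendsto (fun n => c (η n) t) atTop (𝓝 (κ t)) :=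
        (hasDerivAt_iff_tendsto_slope_zero.1 (hGd t)).comp hηt'
      have h2 : Tendsto (fun n => c' (η n) t) atTop (𝓝 (deriv κ t)) :=
        (hasDerivAt_iff_tendsto_slope_zero.1 ht.hasDerivAt).comp hηt'
      have h3 : Tendsto (fun n => η n ^ 2) atTop (𝓝 0) := by simpa using hηt.pow 2
      have h4 : Tendsto (fun n => √(2 * W (c (η n) t) + η n ^ 2)) atTop (𝓝 √(2 * W (κ t))) := by
        have := ((((hW.tendsto _).comp h1).const_mul 2).add h3).sqrt
        rwa [add_zero] at this
      have h5 : Tendsto (fun n => √(vnorm2 (c' (η n) t) + η n ^ 2)) atTop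
          (𝓝 √(vnorm2 (deriv κ t))) := by
        have := (((continuous_vnorm2.tendsto _).comp h2).add h3).sqrt
        rwa [add_zero] at this
      exact h4.mul h5
  have heq : ∫ t in Set.Icc (-2 : ℝ) 1, √(2 * W (κ t)) * √(vnorm2 (deriv κ t)) =
      ∫ t in Set.Icc (-1 : ℝ) 1, √(2 * W (γ t)) * √(vnorm2 (deriv γ t)) := by
    rw [setIntegral_eq_of_subset_of_forall_sdiff_eq_zero measurableSet_Icc
      (Set.Icc_subset_Icc_left (show (-2 : ℝ) ≤ -1 by norm_num)) fun t ht => ?_]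
    · rw [integral_Icc_eq_integral_Ioo, integral_Icc_eq_integral_Ioo]
      refine setIntegral_congr_fun measurableSet_Ioo fun t ht => ?_
      have h1 : κ =ᶠ[𝓝 t] γ := by
        filter_upwards [Ioo_mem_nhds ht.1 ht.2] with y hy using hκeq y ⟨hy.1.le, hy.2.le⟩
      simp only [h1.eq_of_nhds, h1.deriv_eq]
    · have h1 : t ≤ -1 := by
        by_contra h
        exact ht.2 ⟨(not_le.1 h).le, ht.1.2⟩
      rw [hκm t h1, hWm]
      simp
  rw [← heq]
  exact ge_of_tendsto' ((ENNReal.continuous_ofReal.tendsto _).comp hlim) hle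

/-- The energy of a minimizer is at most the geodesic pseudo-distance between the wells. -/
lemma energy_le_geodA {d : ℕ} [NeZero d] {W : (Fin d → ℝ) → ℝ} (hW : Continuous W)
    (hW0 : ∀ z, 0 ≤ W z) {a : ℝ} {um up : Fin d → ℝ} (hum : um 0 = a) (hup : up 0 = a)
    (hWm : W um = 0) (hWp : W up = 0)
    {E : ℝ≥0∞} (hE : ∀ v, Adm d v → BdryCond d v um up → E ≤ energy d W v) :
    E ≠ ⊤ ∧ E.toReal ≤ geodA d W a um up := by
  obtain ⟨γ, K, h1, h2, h3, h4⟩ : ∃ (γ : ℝ → Fin d → ℝ) (K : NNReal), LipschitzWith K γ ∧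
      (∀ t, γ t 0 = a) ∧ γ (-1) = um ∧ γ 1 = up := by
    refine ⟨fun t => um + ((t + 1) / 2) • (up - um), ⟨‖up - um‖, norm_nonneg _⟩,
      LipschitzWith.of_dist_le_mul fun s t => ?_, fun t => by simp [hum, hup], by simp, ?_⟩
    · rw [dist_eq_norm, dist_eq_norm, add_sub_add_left_eq_sub, ← sub_smul, norm_smul, mul_comm]
      change ‖up - um‖ * _ ≤ ‖up - um‖ * _
      gcongr
      rw [show (s + 1) / 2 - (t + 1) / 2 = (s - t) / 2 by ring, norm_div]
      simp only [Real.norm_ofNat]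
      linarith [norm_nonneg (s - t)]
    · norm_num
  have hfin : E ≠ ⊤ := ((energy_le_of_minimizer_of_curve hW hW0 hWm hWp hE h1 h2 h3 h4).trans_lt
    ENNReal.ofReal_lt_top).ne
  refine ⟨hfin, le_csInf ⟨_, γ, ⟨K, h1⟩, h2, h3, h4, rfl⟩ ?_⟩
  rintro L ⟨γ, ⟨K, h1⟩, h2, h3, h4, rfl⟩
  refine ENNReal.toReal_le_of_le_ofReal (integral_nonneg fun t => by positivity)
    (energy_le_of_minimizer_of_curve hW hW0 hWm hWp hE h1 h2 h3 h4)

lemma pd_comp {d : ℕ} {Φ u : (Fin d → ℝ) → Fin d → ℝ} (hΦ : Differentiable ℝ Φ)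
    (hu : Differentiable ℝ u) (i j : Fin d) (x : Fin d → ℝ) :
    pd i (fun x => Φ (u x)) x j = ∑ k, pd k Φ (u x) j * pd i u x k := by
  have h : pd i (fun x => Φ (u x)) x = fderiv ℝ Φ (u x) (pd i u x) := by
    unfold pd
    have := fderiv_comp x (hΦ (u x)) (hu x)
    rw [Function.comp_def] at this
    rw [this, ContinuousLinearMap.comp_apply]
  rw [h, pi_eq_sum_univ' (pd i u x), map_sum, Finset.sum_apply]
  refine Finset.sum_congr rfl fun k _ => ?_
  rw [map_smul, Pi.smul_apply, smul_eq_mul, mul_comm]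
  congr 2
  simp [pd, Pi.single, Function.update]

/-- Applying `φ` in every coordinate but the first leaves `f` unchanged as soon as this holds in one
coordinate at a time. -/
lemma eq_of_update_invariant {d : ℕ} [NeZero d] {α : Type*} {f : (Fin d → ℝ) → α} {φ : ℝ → ℝ}
    (h : ∀ x, ∀ i : Fin d, i ≠ 0 → f (Function.update x i (φ (x i))) = f x) (x : Fin d → ℝ) :
    f (fun i => if i = 0 then x i else φ (x i)) = f x := by
  have key : ∀ S : Finset (Fin d), f (fun i => if i ≠ 0 ∧ i ∈ S then φ (x i) else x i) = f x := by
    intro S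
    induction S using Finset.induction_on with
    | empty => simp
    | insert j S hj ih =>
      by_cases hj0 : j = 0
      · rw [← ih]
        congr 1
        funext i
        by_cases hi : i = 0
        · simp [hi]
        · simp [hi, hj0]
      · rw [← ih, ← h (fun i => if i ≠ 0 ∧ i ∈ S then φ (x i) else x i) j hj0]
        congr 1
        funext i
        by_cases hi : i = j
        · subst hi
          simp [hj, hj0]
        · simp [hi]
  rw [← key Finset.univ]
  congr 1
  funext i
  by_cases hi : i = 0 <;> simp [hi]

lemma strip_subset_closure_interior (d : ℕ) [NeZero d] :
    strip d ⊆ closure (interior (strip d)) := by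
  have h : strip d =
      Set.univ.pi fun i : Fin d => if i = 0 then Set.univ else Set.Ico (0 : ℝ) 1 := by
    ext x
    simp only [strip, Set.mem_ofPred_eq, Set.mem_univ_pi]
    refine forall_congr' fun i => ?_
    split_ifs with hi <;> simp [hi]
  rw [h, interior_pi_set Set.finite_univ, closure_pi_set]
  refine Set.pi_mono fun i _ => ?_
  split_ifs with hi
  · simp
  · rw [interior_Ico, closure_Ioo zero_ne_one]
    exact Set.Ico_subset_Icc_self

/-- A continuous periodic function which is a.e. constant on the strip is constant. -/
lemma eq_const_of_lintegral_strip {d : ℕ} [NeZero d] {f : (Fin d → ℝ) → ℝ} (hf : Continuous f)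
    (hper : ∀ x, ∀ i : Fin d, i ≠ 0 → f (x + Pi.single i 1) = f x) {c : ℝ}
    (h : ∫⁻ x in strip d, ‖f x - c‖ₑ = 0) (x : Fin d → ℝ) : f x = c := by
  have hae : f =ᵐ[volume.restrict (strip d)] fun _ => c := by
    have h1 := (lintegral_eq_zero_iff (hf.sub continuous_const).measurable.enorm).1 h
    filter_upwards [h1] with x hx
    have : ‖f x - c‖ₑ = 0 := hx
    rwa [enorm_eq_zero, sub_eq_zero] at this
  have hon := Measure.eqOn_of_ae_eq hae hf.continuousOn continuousOn_const
    (strip_subset_closure_interior d)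
  have hinv : ∀ x, ∀ i : Fin d, i ≠ 0 → f (Function.update x i (Int.fract (x i))) = f x := by
    intro x i hi
    have hp : Function.Periodic (fun t => f (Function.update x i t)) 1 := fun t => by
      have := hper (Function.update x i t) i hi
      have h2 := add_smul_single_eq_update (Function.update x i t) i 1
      simp only [one_smul, Function.update_self, Function.update_idem] at h2
      rw [h2] at this
      exact this
    have h3 := hp.sub_int_mul_eq ⌊x i⌋ (x := x i)
    simp only [mul_one, Function.update_eq_self] at h3
    exact h3
  rw [← eq_of_update_invariant hinv x]
  refine hon fun i hi => ?_
  simp only [hi, if_false]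
  exact ⟨Int.fract_nonneg _, Int.fract_lt_one _⟩

/-- Calibration: the flux of `F` bounds the energy from below, up to the remainder `r`. -/
lemma integral_remainder_nonpos {d : ℕ} [NeZero d] {W : (Fin d → ℝ) → ℝ} (hW : Continuous W)
    (hW0 : ∀ z, 0 ≤ W z) {u F : (Fin d → ℝ) → Fin d → ℝ} (hu : Continuous u)
    (hF : Differentiable ℝ F) (hper : IsPeriodic F) {cm cp : ℝ}
    (hm : ∀ δ > 0, ∃ᶠ t in atBot, |sliceMean (fun x => F x 0) t - cm| < δ)
    (hp : ∀ δ > 0, ∃ᶠ t in atTop, |sliceMean (fun x => F x 0) t - cp| < δ)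
    (hfin : energy d W u ≠ ⊤) (hE : (energy d W u).toReal ≤ cp - cm)
    (habs : ∀ x, |∑ i, pd i F x i| ≤ 2 * eden W u x) {r : (Fin d → ℝ) → ℝ}
    (hr : IntegrableOn r (strip d)) (hle : ∀ x, ∑ i, pd i F x i + r x ≤ eden W u x) :
    ∫ x in strip d, r x ≤ 0 := by
  have he0 : ∀ x, 0 ≤ eden W u x := fun x =>
    add_nonneg (mul_nonneg (by norm_num) (gradSq_nonneg _ _)) (hW0 _)
  have hem : Measurable (eden W u) :=
    ((measurable_gradSq _).const_mul _).add (hW.comp hu).measurable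
  have hei : IntegrableOn (eden W u) (strip d) := by
    refine ⟨hem.aestronglyMeasurable, ?_⟩
    rw [HasFiniteIntegral]
    refine lt_of_le_of_lt (lintegral_mono fun x => ?_) hfin.lt_top
    rw [Real.enorm_eq_ofReal (he0 x)]
  have heE : ∫ x in strip d, eden W u x = (energy d W u).toReal :=
    integral_eq_lintegral_of_nonneg_ae (Eventually.of_forall he0) hem.aestronglyMeasurable
  have hdm : Measurable fun x => ∑ i, pd i F x i :=
    Finset.measurable_sum _ fun i _ => measurable_pd i i F
  have hdi : IntegrableOn (fun x => ∑ i, pd i F x i) (strip d) :=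
    (hei.const_mul 2).mono' hdm.aestronglyMeasurable (Eventually.of_forall habs)
  have h1 := integral_div_strip hF hper hdi hm hp
  have h2 : ∫ x in strip d, (∑ i, pd i F x i + r x) ≤ ∫ x in strip d, eden W u x :=
    integral_mono (hdi.add hr) hei hle
  rw [integral_add hdi hr, h1, heE] at h2
  linarith

/-- If `∂₀f = 0` a.e. and the slab integrals of `f - a` vanish at infinity then `f = a`. -/
lemma eq_const_of_pdS_zero {d : ℕ} [NeZero d] {f : (Fin d → ℝ) → ℝ} (hf : Differentiable ℝ f)
    (hper : ∀ x, ∀ i : Fin d, i ≠ 0 → f (x + Pi.single i 1) = f x) {a : ℝ}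
    (h0 : ∫⁻ x in strip d, ‖pdS 0 f x‖ₑ = 0)
    (hlim : Tendsto (fun R => ∫⁻ x, ‖f x - a‖ₑ ∂(boxMeasure (slabCorner d R))) atTop (𝓝 0))
    (x : Fin d → ℝ) : f x = a := by
  have hc := hf.continuous
  have hfm : Measurable fun x => ‖f x - a‖ₑ := (hc.measurable.sub_const a).enorm
  have hfu : ∀ t, Measurable fun y : Fin d → ℝ => ‖f (Function.update y 0 t) - a‖ₑ := fun t =>
    hfm.comp (continuous_id.update 0 continuous_const).measurable
  rw [lintegral_strip (measurable_pdS 0 f).enorm] at h0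
  have hslice : ∀ s, ∫⁻ y, ‖f (Function.update y 0 s) - a‖ₑ ∂(boxMeasure (0 : Fin d → ℝ)) = 0 := by
    intro s
    by_contra hne
    obtain ⟨t, ht⟩ := (frequently_slice_lt hfm (Or.inl rfl) hlim hne).exists
    refine ht.not_ge ?_
    calc ∫⁻ y, ‖f (Function.update y 0 s) - a‖ₑ ∂(boxMeasure (0 : Fin d → ℝ))
        ≤ ∫⁻ y, ((∫⁻ r, ‖pdS 0 f (Function.update y 0 r)‖ₑ) + ‖f (Function.update y 0 t) - a‖ₑ)
            ∂(boxMeasure (0 : Fin d → ℝ)) := by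
          refine lintegral_mono fun y => ?_
          have h1 := enorm_sub_le_lintegral_line hf y 0 (s := t) (t := s) (Set.subset_univ _)
          rw [Measure.restrict_univ] at h1
          calc ‖f (Function.update y 0 s) - a‖ₑ
              = ‖(f (Function.update y 0 s) - f (Function.update y 0 t)) +
                  (f (Function.update y 0 t) - a)‖ₑ := by congr 1; ring
            _ ≤ _ := (enorm_add_le _ _).trans (by gcongr)
      _ = _ := by
          rw [lintegral_add_right _ (hfu t), h0, zero_add]
  refine eq_const_of_lintegral_strip hc hper ?_ x
  rw [lintegral_strip hfm, lintegral_lintegral_swap]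
  · simp [hslice]
  · exact (hfm.comp ((measurable_update_pair 0).comp measurable_swap)).aemeasurable

lemma eq_update_of_pdS_zero {d : ℕ} [NeZero d] {f : (Fin d → ℝ) → ℝ} (hf : Differentiable ℝ f)
    (hper : ∀ x, ∀ i : Fin d, i ≠ 0 → f (x + Pi.single i 1) = f x) {i : Fin d} (hi : i ≠ 0)
    (h0 : ∫⁻ x in strip d, ‖pdS i f x‖ₑ = 0) (x : Fin d → ℝ) : f (Function.update x i 0) = f x := by
  have hc : Continuous fun x : Fin d → ℝ => f x - f (Function.update x i 0) :=
    hf.continuous.sub (hf.continuous.comp (continuous_id.update i continuous_const))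
  have h := eq_const_of_lintegral_strip hc (c := 0) (fun x j hj => ?_) ?_ x
  · exact (sub_eq_zero.1 h).symm
  · rw [hper x j hj]
    by_cases hij : j = i
    · subst hij
      congr 2
      ext k
      by_cases hk : k = j <;> simp [hk]
    · rw [← hper (Function.update x i 0) j hj]
      congr 2
      ext k
      by_cases hk : k = i
      · subst hk; simp [Ne.symm hij]
      · simp [hk]
  · refine le_antisymm ?_ zero_le
    rw [lintegral_strip_line (measurable_pdS i f).enorm hi] at h0
    rw [← h0]
    refine setLIntegral_mono' (measurableSet_strip d) fun x hx => ?_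
    have h1 := enorm_sub_le_lintegral_line hf x i (s := 0) (t := x i) (I := Set.Ico 0 1)
      (by simpa using uIoc_subset_Ico (c := 0) (by simp) (by simpa using hx i hi))
    simpa using h1

lemma sum_lt_eq_half_sum_ne {d : ℕ} {f : Fin d → Fin d → ℝ} (hf : ∀ i j, f i j = f j i) :
    (∑ i, ∑ j, if i < j then f i j else 0) = (1 / 2) * ∑ i, ∑ j, if i = j then 0 else f i j := by
  have h1 : (∑ i, ∑ j, if i = j then 0 else f i j) =
      (∑ i, ∑ j, if i < j then f i j else 0) + ∑ i, ∑ j, if j < i then f i j else 0 := by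
    simp_rw [← Finset.sum_add_distrib]
    refine Finset.sum_congr rfl fun i _ => Finset.sum_congr rfl fun j _ => ?_
    rcases lt_trichotomy i j with h | h | h
    · simp [h, h.ne, h.not_gt]
    · simp [h]
    · simp [h, h.ne', h.not_gt]
  have h2 : (∑ i, ∑ j, if j < i then f i j else 0) = ∑ i, ∑ j, if i < j then f i j else 0 := by
    rw [Finset.sum_comm]
    simp_rw [hf]
  rw [h1, h2]
  ring

lemma sum_ne_eq_sub {d : ℕ} (f : Fin d → Fin d → ℝ) :
    (∑ i, ∑ j, if i = j then 0 else f i j) = (∑ i, ∑ j, f i j) - ∑ i, f i i := by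
  rw [← Finset.sum_sub_distrib]
  refine Finset.sum_congr rfl fun i _ => ?_
  rw [eq_sub_iff_add_eq, ← Finset.sum_erase_add _ _ (Finset.mem_univ i),
    ← Finset.sum_erase_add (f := fun j => f i j) _ (Finset.mem_univ i)]
  simp only [if_true, add_zero]
  congr 1
  exact Finset.sum_congr rfl fun j hj => if_neg (Finset.ne_of_mem_erase hj).symm

lemma sum_mul_diag_eq_zero {d : ℕ} {A p : Fin d → Fin d → ℝ} (hA : ∀ i j, A i i = A j j)
    (hp : ∑ i, p i i = 0) : ∑ i, A i i * p i i = 0 := by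
  rcases isEmpty_or_nonempty (Fin d) with h | ⟨⟨k⟩⟩
  · simp
  · simp_rw [fun i => hA i k]
    rw [← Finset.mul_sum, hp, mul_zero]

/-- The quadratic inequality behind the symmetric calibration. -/
lemma sum_mul_add_sq_diag_le {d : ℕ} {A p : Fin d → Fin d → ℝ} (hAs : ∀ i j, A i j = A j i)
    (hAd : ∀ i j, A i i = A j j) (hp : ∑ i, p i i = 0) :
    (∑ i, ∑ j, A i j * p i j) + ∑ i, p i i ^ 2 ≤
      (1 / 2) * (∑ i, ∑ j, p i j ^ 2) + (1 / 2) * (∑ i, ∑ j, if i < j then A i j ^ 2 else 0) +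
        (1 / 2) * ∑ i, ∑ j, p i j * p j i := by
  have h0 : 0 ≤ ∑ i, ∑ j, if i = j then 0 else (A i j - p i j - p j i) ^ 2 :=
    Finset.sum_nonneg fun i _ => Finset.sum_nonneg fun j _ => by positivity
  have h1 : (∑ i, ∑ j, if i = j then 0 else (A i j - p i j - p j i) ^ 2) =
      (∑ i, ∑ j, if i = j then 0 else A i j ^ 2) +
      ((-2) * (∑ i, ∑ j, if i = j then 0 else A i j * p i j) +
      ((-2) * (∑ i, ∑ j, if i = j then 0 else A i j * p j i) +
      ((∑ i, ∑ j, if i = j then 0 else p i j ^ 2) +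
      ((∑ i, ∑ j, if i = j then 0 else p j i ^ 2) +
      2 * ∑ i, ∑ j, if i = j then 0 else p i j * p j i)))) := by
    simp_rw [Finset.mul_sum, ← Finset.sum_add_distrib]
    refine Finset.sum_congr rfl fun i _ => Finset.sum_congr rfl fun j _ => ?_
    split_ifs
    · simp
    · ring
  have h2 : (∑ i, ∑ j, A i j * p j i) = ∑ i, ∑ j, A i j * p i j := by
    rw [Finset.sum_comm]
    simp_rw [fun i j => hAs j i]
  have h3 : (∑ i, ∑ j, p j i ^ 2) = ∑ i, ∑ j, p i j ^ 2 := Finset.sum_comm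
  have h4 := sum_mul_diag_eq_zero hAd hp
  have h5 := sum_lt_eq_half_sum_ne (f := fun i j => A i j ^ 2) fun i j => by rw [hAs]
  have h6 : ∑ i, p i i * p i i = ∑ i, p i i ^ 2 := by simp_rw [sq]
  rw [h1, sum_ne_eq_sub fun i j => A i j * p i j, sum_ne_eq_sub fun i j => A i j * p j i,
    sum_ne_eq_sub fun i j => p i j ^ 2, sum_ne_eq_sub fun i j => p j i ^ 2,
    sum_ne_eq_sub fun i j => p i j * p j i, h2, h3, h4, h6] at h0
  linarith

lemma abs_sum_mul_offdiag_le {d : ℕ} {A p : Fin d → Fin d → ℝ} (hAs : ∀ i j, A i j = A j i)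
    (hAd : ∀ i j, A i i = A j j) (hp : ∑ i, p i i = 0) :
    |∑ i, ∑ j, A i j * p i j| ≤
      2 * ((1 / 2) * (∑ i, ∑ j, p i j ^ 2) +
        (1 / 2) * ∑ i, ∑ j, if i < j then A i j ^ 2 else 0) := by
  have h1 := sum_ne_eq_sub fun i j => A i j * p i j
  rw [sum_mul_diag_eq_zero hAd hp, sub_zero] at h1
  have h5 := sum_lt_eq_half_sum_ne (f := fun i j => A i j ^ 2) fun i j => by rw [hAs]
  rw [← h1, h5]
  have h2 : |∑ i, ∑ j, if i = j then 0 else A i j * p i j| ≤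
      ∑ i, ∑ j, ((1 / 2) * p i j ^ 2 + (1 / 2) * if i = j then 0 else A i j ^ 2) := by
    refine (Finset.abs_sum_le_sum_abs _ _).trans (Finset.sum_le_sum fun i _ =>
      (Finset.abs_sum_le_sum_abs _ _).trans (Finset.sum_le_sum fun j _ => ?_))
    split_ifs
    · rw [abs_zero]; positivity
    · rw [abs_le]
      constructor <;> nlinarith [sq_nonneg (A i j + p i j), sq_nonneg (A i j - p i j)]
  simp_rw [Finset.sum_add_distrib, ← Finset.mul_sum] at h2
  have h3 : 0 ≤ ∑ i, ∑ j, p i j ^ 2 := by positivity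
  linarith

/-- The quadratic inequality for the flux in the first direction. -/
lemma abs_sum_mul_first_add_le {d : ℕ} [NeZero d] {A p : Fin d → Fin d → ℝ}
    (hp : p 0 0 = 0) :
    |∑ k, A 0 k * p 0 k| + (1 / 2) * (∑ i, if i = 0 then 0 else ∑ j, p i j ^ 2) ≤
      (1 / 2) * (∑ i, ∑ j, p i j ^ 2) + (1 / 2) * ∑ i, ∑ j, if i < j then A i j ^ 2 else 0 := by
  have h1 : |∑ k, A 0 k * p 0 k| ≤
      ∑ k, ((1 / 2) * p 0 k ^ 2 + (1 / 2) * if 0 < k then A 0 k ^ 2 else 0) := by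
    refine (Finset.abs_sum_le_sum_abs _ _).trans (Finset.sum_le_sum fun k _ => ?_)
    by_cases hk : k = 0
    · subst hk
      simp [hp]
    · rw [if_pos (Fin.pos_iff_ne_zero.2 hk), abs_le]
      constructor <;> nlinarith [sq_nonneg (A 0 k + p 0 k), sq_nonneg (A 0 k - p 0 k)]
  have h2 : (∑ k, if (0 : Fin d) < k then A 0 k ^ 2 else 0) ≤
      ∑ i, ∑ j, if i < j then A i j ^ 2 else 0 :=
    Finset.single_le_sum (f := fun i => ∑ j, if i < j then A i j ^ 2 else 0)
      (fun i _ => Finset.sum_nonneg fun j _ => by positivity) (Finset.mem_univ 0)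
  have h3 : (∑ i, ∑ j, p i j ^ 2) =
      (∑ i, if i = 0 then 0 else ∑ j, p i j ^ 2) + ∑ j, p 0 j ^ 2 := by
    have : ∀ i : Fin d, ∑ j, p i j ^ 2 =
        (if i = 0 then 0 else ∑ j, p i j ^ 2) + if i = 0 then ∑ j, p 0 j ^ 2 else 0 := fun i => by
      split_ifs with hi
      · subst hi; simp
      · simp
    rw [Finset.sum_congr rfl fun i _ => this i, Finset.sum_add_distrib]
    simp
  rw [Finset.sum_add_distrib, ← Finset.mul_sum, ← Finset.mul_sum] at h1
  rw [h3]
  linarith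

lemma lintegral_enorm_eq_zero_of_sq_le {α : Type*} [MeasurableSpace α] {μ : Measure α} {r g : α → ℝ}
    (hr : Integrable r μ) (hr0 : ∫ x, r x ∂μ ≤ 0) (hle : ∀ x, g x ^ 2 ≤ r x) :
    ∫⁻ x, ‖g x‖ₑ ∂μ = 0 := by
  have hnn : ∀ x, 0 ≤ r x := fun x => (sq_nonneg _).trans (hle x)
  have h1 := (integral_eq_zero_iff_of_nonneg hnn hr).1 (le_antisymm hr0 (integral_nonneg hnn))
  have h2 : (fun x => ‖g x‖ₑ) =ᵐ[μ] fun _ => 0 := by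
    filter_upwards [h1] with x hx
    have h3 : g x ^ 2 ≤ 0 := (hle x).trans_eq hx
    rw [enorm_eq_zero]
    exact pow_eq_zero_iff two_ne_zero |>.1 (le_antisymm h3 (sq_nonneg _))
  rw [lintegral_congr_ae h2, lintegral_zero]

/-- Theorem `thm:rigid_sym`: let `Φ ∈ C¹(ℝ^d,ℝ^d)` have a symmetric Jacobian
with equal diagonal entries, and let `W(z) = ½ Σ_{i<j} |∂_iΦ_j(z)|²`. If the saturation
condition `Φ₁(u⁺) - Φ₁(u⁻) = geod^a_W(u⁻,u⁺)` holds, then any global minimizer of `(P)`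
(bounded with `W ∈ C²`, or with `W` satisfying the growth condition (G)) is one-dimensional. -/
theorem statement8 (d : ℕ) [NeZero d] (hd : 2 ≤ d)
    (Φ : (Fin d → ℝ) → Fin d → ℝ) (hΦ : ContDiff ℝ 1 Φ)
    (hsym : ∀ z, ∀ i j : Fin d, pd i Φ z j = pd j Φ z i)
    (hdiag : ∀ z, ∀ i j : Fin d, pd i Φ z i = pd j Φ z j)
    (W : (Fin d → ℝ) → ℝ)
    (hW : ∀ z, W z = (1 / 2) * ∑ i, ∑ j, if i < j then (pd i Φ z j) ^ 2 else 0)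
    (a : ℝ) (um up : Fin d → ℝ)
    (hum : um 0 = a) (hup : up 0 = a) (hWm : W um = 0) (hWp : W up = 0)
    (hsat : Φ up 0 - Φ um 0 = geodA d W a um up)
    (u : (Fin d → ℝ) → Fin d → ℝ)
    (hadm : Adm d u) (hbc : BdryCond d u um up)
    (hmin : ∀ v, Adm d v → BdryCond d v um up → energy d W u ≤ energy d W v)
    (hside : ((∃ M, ∀ x, ‖u x‖ ≤ M) ∧ ContDiff ℝ 2 W) ∨ GrowthG d W) :
    ∃ g : ℝ → Fin d → ℝ, ∀ x, u x = g (x 0) := by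
  have hΦd : Differentiable ℝ Φ := hΦ.differentiable one_ne_zero
  have hpdc : ∀ i j : Fin d, Continuous fun z => pd i Φ z j := fun i j =>
    (continuous_apply j).comp ((hΦ.continuous_fderiv one_ne_zero).clm_apply continuous_const)
  have hWc : Continuous W := by
    rw [funext hW]
    refine continuous_const.mul (continuous_finsetSum _ fun i _ => continuous_finsetSum _ fun j _ => ?_)
    split_ifs
    · exact (hpdc i j).pow 2
    · exact continuous_const
  have hW0 : ∀ z, 0 ≤ W z := fun z => by
    rw [hW]
    exact mul_nonneg (by norm_num)
      (Finset.sum_nonneg fun i _ => Finset.sum_nonneg fun j _ => by positivity)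
  have hud : Differentiable ℝ u := hadm.1
  have huc : Continuous u := hud.continuous
  have hper : ∀ k : Fin d, ∀ x, ∀ i : Fin d, i ≠ 0 → u (x + Pi.single i 1) k = u x k :=
    fun k x i hi => by rw [hadm.2.1 x i hi]
  obtain ⟨hfin, hE⟩ := energy_le_geodA hWc hW0 hum hup hWm hWp hmin
  rw [← hsat] at hE
  have hside' : (∃ M, ∀ x, ‖u x‖ ≤ M) ∨ GrowthG d W := hside.imp_left And.left
  have hfm : ∀ δ > 0, ∃ᶠ t in atBot, |sliceMean (fun x => Φ (u x) 0) t - Φ um 0| < δ :=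
    fun δ hδ => frequently_sliceMean_flux hd hΦ hsym hdiag hW hadm hside' (Or.inr rfl) hbc.1 hδ
  have hfp : ∀ δ > 0, ∃ᶠ t in atTop, |sliceMean (fun x => Φ (u x) 0) t - Φ up 0| < δ :=
    fun δ hδ => frequently_sliceMean_flux hd hΦ hsym hdiag hW hadm hside' (Or.inl rfl) hbc.2 hδ
  have hΦu : Differentiable ℝ fun x => Φ (u x) := hΦd.comp hud
  have heden : ∀ x, eden W u x = (1 / 2) * (∑ i, ∑ j, pd i u x j ^ 2) +
      (1 / 2) * ∑ i, ∑ j, if i < j then pd i Φ (u x) j ^ 2 else 0 := fun x => by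
    rw [eden, hW, gradSq]
  have hNint : IntegrableOn (fun x => ∑ i, ∑ j, pd i u x j * pd j u x i) (strip d) :=
    integrable_finsetSum _ fun i _ => integrable_finsetSum _ fun j _ =>
      integrable_pd_mul_pd hadm i j j i
  have hsqint : ∀ i j : Fin d, IntegrableOn (fun x => pd i u x j ^ 2) (strip d) := fun i j => by
    simp_rw [sq]
    exact integrable_pd_mul_pd hadm i j i j
  have hDint : IntegrableOn (fun x => ∑ i, pd i u x i ^ 2) (strip d) :=
    integrable_finsetSum _ fun i _ => hsqint i i
  have hdiv : ∀ x, ∑ i, pd i (fun x => Φ (u x)) x i = ∑ i, ∑ j, pd i Φ (u x) j * pd i u x j := by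
    intro x
    simp_rw [pd_comp hΦd hud]
    refine Finset.sum_congr rfl fun i _ => Finset.sum_congr rfl fun k _ => ?_
    rw [hsym]
  have hD : ∫ x in strip d, ∑ i, pd i u x i ^ 2 ≤ 0 := by
    have h := integral_remainder_nonpos hWc hW0 huc hΦu
      (fun x i hi => by simp only [hadm.2.1 x i hi]) hfm hfp hfin hE
      (fun x => by
        rw [hdiv, heden]
        exact abs_sum_mul_offdiag_le (hsym (u x)) (hdiag (u x)) (hadm.2.2.1 x))
      (r := fun x => (∑ i, pd i u x i ^ 2) - (1 / 2) * ∑ i, ∑ j, pd i u x j * pd j u x i)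
      (hDint.sub (hNint.const_mul _))
      (fun x => by
        rw [hdiv, heden]
        linarith [sum_mul_add_sq_diag_le (hsym (u x)) (hdiag (u x)) (hadm.2.2.1 x)])
    rw [integral_sub hDint (hNint.const_mul _), integral_const_mul] at h
    linarith [integral_null_lagrangian_nonpos hadm hbc]
  have hu0 : ∀ x, u x 0 = a := by
    refine eq_const_of_pdS_zero (differentiable_component hud 0) (hper 0) ?_ ?_
    · refine lintegral_enorm_eq_zero_of_sq_le hDint hD fun x => ?_
      rw [← pd_apply hud]
      exact Finset.single_le_sum (f := fun i => pd i u x i ^ 2) (fun _ _ => sq_nonneg _)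
        (Finset.mem_univ 0)
    · refine tendsto_lintegral_of_sq
        (((continuous_apply 0).comp huc).measurable.sub_const a).enorm ?_
      refine tendsto_of_tendsto_of_tendsto_of_le_of_le tendsto_const_nhds
        (tendsto_slab_vnorm2 hadm (Or.inl rfl) hbc.2) (fun _ => zero_le) fun R => ?_
      refine lintegral_mono fun x => ?_
      rw [ofReal_vnorm2, ← hup]
      exact Finset.single_le_sum (f := fun k => ‖(u x - up) k‖ₑ ^ 2) (fun _ _ => zero_le)
        (Finset.mem_univ 0)
  have hp00 : ∀ x, pd 0 u x 0 = 0 := fun x => by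
    rw [pd_apply hud, pdS, funext hu0]
    simp
  have hF0 : ∀ x, HasFDerivAt (fun x => (Pi.single 0 (Φ (u x) 0) : Fin d → ℝ))
      ((ContinuousLinearMap.single ℝ (fun _ : Fin d => ℝ) 0).comp
        (fderiv ℝ (fun x => Φ (u x) 0) x)) x := fun x =>
    (ContinuousLinearMap.single ℝ (fun _ : Fin d => ℝ) 0).hasFDerivAt.comp x
      (differentiable_component hΦu 0 x).hasFDerivAt
  have hdiv0 : ∀ x, ∑ i, pd i (fun x => (Pi.single 0 (Φ (u x) 0) : Fin d → ℝ)) x i =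
      ∑ k, pd 0 Φ (u x) k * pd 0 u x k := fun x => by
    rw [Finset.sum_eq_single 0]
    · rw [pd, (hF0 x).fderiv]
      have h1 := pd_apply hΦu 0 0 x
      rw [pd_comp hΦd hud, pdS] at h1
      simp only [ContinuousLinearMap.comp_apply, ContinuousLinearMap.single_apply, Pi.single_eq_same]
      rw [← h1]
      exact Finset.sum_congr rfl fun k _ => by rw [hsym]
    · intro i _ hi
      rw [pd, (hF0 x).fderiv]
      simp [hi]
    · simp
  have hrint : IntegrableOn (fun x => ∑ i, if i = 0 then 0 else ∑ j, pd i u x j ^ 2) (strip d) :=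
    integrable_finsetSum _ fun i _ => by
      split_ifs
      · exact integrable_zero _ _ _
      · exact integrable_finsetSum _ fun j _ => hsqint i j
  have hbound := fun x => abs_sum_mul_first_add_le (A := fun i j => pd i Φ (u x) j)
    (p := fun i j => pd i u x j) (hp00 x)
  have hr0 : ∀ x, 0 ≤ ∑ i, if i = 0 then 0 else ∑ j, pd i u x j ^ 2 := fun x =>
    Finset.sum_nonneg fun i _ => by positivity
  have hr : ∫ x in strip d, ∑ i, (if i = 0 then 0 else ∑ j, pd i u x j ^ 2) ≤ 0 := by
    have h := integral_remainder_nonpos hWc hW0 huc (fun x => (hF0 x).differentiableAt)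
      (fun x i hi => by simp only [hadm.2.1 x i hi]) (cm := Φ um 0) (cp := Φ up 0)
      (by simpa only [Pi.single_eq_same] using hfm) (by simpa only [Pi.single_eq_same] using hfp)
      hfin hE
      (fun x => by
        rw [hdiv0, heden]
        linarith [hbound x, hr0 x, abs_nonneg (∑ k, pd 0 Φ (u x) k * pd 0 u x k)])
      (r := fun x => (1 / 2) * ∑ i, if i = 0 then 0 else ∑ j, pd i u x j ^ 2)
      (hrint.const_mul _)
      (fun x => by
        rw [hdiv0, heden]
        linarith [hbound x, le_abs_self (∑ k, pd 0 Φ (u x) k * pd 0 u x k)])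
    rw [integral_const_mul] at h
    linarith
  have hinv : ∀ x, ∀ i : Fin d, i ≠ 0 → u (Function.update x i 0) = u x := fun x i hi => by
    funext k
    refine eq_update_of_pdS_zero (differentiable_component hud k) (hper k) hi ?_ x
    refine lintegral_enorm_eq_zero_of_sq_le hrint hr fun x => ?_
    rw [← pd_apply hud]
    calc pd i u x k ^ 2 ≤ ∑ j, pd i u x j ^ 2 :=
          Finset.single_le_sum (f := fun j => pd i u x j ^ 2) (fun _ _ => sq_nonneg _)
            (Finset.mem_univ k)
      _ = if i = 0 then 0 else ∑ j, pd i u x j ^ 2 := (if_neg hi).symm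
      _ ≤ _ := Finset.single_le_sum
          (f := fun i => if i = 0 then 0 else ∑ j, pd i u x j ^ 2)
          (fun i _ => by positivity) (Finset.mem_univ i)
  refine ⟨fun t => u (Pi.single 0 t), fun x => ?_⟩
  rw [← eq_of_update_invariant (φ := fun _ => 0) hinv x]
  congr 1
  funext i
  by_cases hi : i = 0
  · subst hi; simp
  · simp [hi]
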